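/- Fix θ₀ = (σ₀,δ₀,α₀) with σ₀ > 0, δ₀ > 0 and α₀ ∈ (0,2). Let J_n(θ) be the Hessian matrix in θ = (σ,δ,α) of the log-likelihood ln L_n(θ)(y₁,…,y_n) = Σ_{i=1}^n ln p_{1/n}(y_i,θ). Then the random matrix u_n(θ₀)ᵀ J_n(θ₀) u_n(θ₀) converges to −I(θ₀) in ℙ_n-probability as n → ∞. -/

import Mathlib

open MeasureTheory Filter Set Topology Matrix

noncomputable section

namespace LevyLAN

/-- Standard Gaussian density `φ`. -/
def gauss (y : ℝ) : ℝ := (Real.sqrt (2 * Real.pi))⁻¹ * Real.exp (-(y ^ 2) / 2)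

/-- Symmetric `α`-stable density `φ_α`, defined by Fourier inversion. -/
def stableDensity (α z : ℝ) : ℝ :=
  (2 * Real.pi)⁻¹ * ∫ u : ℝ, Real.cos (z * u) * Real.exp (-(|u| ^ α))

/-- `∂_α φ_α`. -/
def stableDensityDalpha (α z : ℝ) : ℝ :=
  -(2 * Real.pi)⁻¹ * ∫ u : ℝ, Real.cos (z * u) * |u| ^ α * Real.log |u| * Real.exp (-(|u| ^ α))

/-- The operator `(D f) y = (y * f y)' = f y + y * f' y`. -/
def Dop (f : ℝ → ℝ) (y : ℝ) : ℝ := f y + y * deriv f y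

/-- `f_α(y, w)`. -/
def fFun (α y w : ℝ) : ℝ := ∫ z : ℝ, gauss (y - w * z) * stableDensity α z

/-- `g_α(y, w)`. -/
def gFun (α y w : ℝ) : ℝ := ∫ z : ℝ, Dop gauss (y - w * z) * stableDensity α z

/-- `h_α(y, w)`. -/
def hFun (α y w : ℝ) : ℝ := ∫ z : ℝ, gauss (y - w * z) * Dop (stableDensity α) z

/-- `k_α(y, w)`. -/
def kFun (α y w : ℝ) : ℝ := ∫ z : ℝ, gauss (y - w * z) * stableDensityDalpha α z

/-- `c_α`. -/
def cAlpha (α : ℝ) : ℝ :=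
  if α = 1 then 1 / Real.pi
  else -(α * (α - 1)) / (2 * Real.Gamma (2 - α) * Real.cos (Real.pi * α / 2))

/-- `w_n(θ) = n^{1/2 - 1/α} δ / σ`. -/
def wn (n : ℕ) (σ δ α : ℝ) : ℝ := (n : ℝ) ^ ((1 : ℝ) / 2 - 1 / α) * δ / σ

/-- `l_α(y, w)` (it depends on `n`). -/
def lFun (n : ℕ) (α y w : ℝ) : ℝ :=
  ((Real.log n - Real.log (Real.log n)) / (2 * α) - Real.log n / α ^ 2) * hFun α y w
    + kFun α y w

def kappa0 (σ δ α : ℝ) : ℝ := 2 * cAlpha α / (α * (2 - α) ^ (α / 2)) * (δ / σ) ^ α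

def kappa1 (σ δ α : ℝ) : ℝ :=
  Real.log (δ / σ) + deriv cAlpha α / cAlpha α - Real.log (2 - α) / 2 - 1 / α

/-- The density `p_{1/n}(y, θ)`, with parameter `θ = (σ, δ, α) : Fin 3 → ℝ`. -/
def pdens (n : ℕ) (θ : Fin 3 → ℝ) (y : ℝ) : ℝ :=
  Real.sqrt n / θ 0 * fFun (θ 2) (Real.sqrt n * y / θ 0) (wn n (θ 0) (θ 1) (θ 2))

/-- The log-likelihood `ln L_n(θ)`. -/
def logLik (n : ℕ) (θ : Fin 3 → ℝ) (x : Fin n → ℝ) : ℝ :=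
  ∑ i, Real.log (pdens n θ (x i))

/-- Partial derivative in the `j`-th parameter coordinate. -/
def pderiv (j : Fin 3) (F : (Fin 3 → ℝ) → ℝ) (θ : Fin 3 → ℝ) : ℝ :=
  deriv (fun t => F (Function.update θ j t)) (θ j)

/-- The score `G_n(θ) = ∇_θ ln L_n(θ)`. -/
def scoreVec (n : ℕ) (θ : Fin 3 → ℝ) (x : Fin n → ℝ) : Fin 3 → ℝ :=
  fun j => pderiv j (fun θ' => logLik n θ' x) θ

/-- The Hessian matrix `J_n(θ)` of the log-likelihood. -/
def hessMat (n : ℕ) (θ : Fin 3 → ℝ) (x : Fin n → ℝ) : Matrix (Fin 3) (Fin 3) ℝ :=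
  Matrix.of fun i j => pderiv i (fun θ' => pderiv j (fun θ'' => logLik n θ'' x) θ') θ

def rate (n : ℕ) (α : ℝ) : ℝ := Real.log n ^ (α / 4) / (n : ℝ) ^ (α / 4)

/-- The rate matrix `u_n(θ)`. -/
def un (n : ℕ) (θ : Fin 3 → ℝ) : Matrix (Fin 3) (Fin 3) ℝ :=
  !![1 / Real.sqrt n, 0, 0;
     0, rate n (θ 2), -(rate n (θ 2) * (θ 1 / (2 * θ 2)) * (Real.log n - Real.log (Real.log n)));
     0, 0, rate n (θ 2)]

/-- The information matrix `I(θ)`. -/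
def Imat (θ : Fin 3 → ℝ) : Matrix (Fin 3) (Fin 3) ℝ :=
  !![2 / θ 0 ^ 2, 0, 0;
     0, θ 2 ^ 2 / θ 1 ^ 2 * kappa0 (θ 0) (θ 1) (θ 2),
        θ 2 / θ 1 * kappa0 (θ 0) (θ 1) (θ 2) * kappa1 (θ 0) (θ 1) (θ 2);
     0, θ 2 / θ 1 * kappa0 (θ 0) (θ 1) (θ 2) * kappa1 (θ 0) (θ 1) (θ 2),
        kappa0 (θ 0) (θ 1) (θ 2) * (kappa1 (θ 0) (θ 1) (θ 2) ^ 2 + 1 / θ 2 ^ 2)]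

/-- `ℙ_n`, the `n`-fold product of the law with Lebesgue density `p_{1/n}(·, θ)`. -/
def Pn (n : ℕ) (θ : Fin 3 → ℝ) : Measure (Fin n → ℝ) :=
  Measure.pi fun _ => MeasureTheory.volume.withDensity fun y => ENNReal.ofReal (pdens n θ y)

/-- The standard Gaussian measure on `ℝ³`. -/
def stdGauss3 : Measure (Fin 3 → ℝ) :=
  Measure.pi fun _ => ProbabilityTheory.gaussianReal 0 1

/-- Euclidean (Frobenius) norm of a real 3×3 matrix. -/
def frobNorm (M : Matrix (Fin 3) (Fin 3) ℝ) : ℝ := Real.sqrt (∑ i, ∑ j, M i j ^ 2)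

/-- Euclidean norm of a vector of `ℝ³`. -/
def vecNorm (v : Fin 3 → ℝ) : ℝ := Real.sqrt (∑ j, v j ^ 2)

/-- The admissible families of functions `ψ_α^{(p)}`. -/
structure IsPsiFamily (ψ : ℝ → ℕ → ℝ → ℝ) : Prop where
  contDiff : ∀ α ∈ Set.Ioo (0 : ℝ) 2, ∀ p : ℕ, ContDiff ℝ 2 (ψ α p)
  pos : ∀ α ∈ Set.Ioo (0 : ℝ) 2, ∀ p : ℕ, ∀ y : ℝ, 0 < ψ α p y
  even : ∀ α ∈ Set.Ioo (0 : ℝ) 2, ∀ p : ℕ, ∀ y : ℝ, ψ α p (-y) = ψ α p y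
  eq_one : ∀ α ∈ Set.Ioo (0 : ℝ) 2, ∀ p : ℕ, ∀ y : ℝ, |y| ≤ 1 → ψ α p y = 1
  eq_tail : ∀ α ∈ Set.Ioo (0 : ℝ) 2, ∀ p : ℕ, ∀ y : ℝ, 3 ≤ |y| →
    ψ α p y = Real.log |y| ^ p / |y| ^ (α + 1)
  unifBound : ∀ K : Set ℝ, K ⊆ Set.Ioo (0 : ℝ) 2 → IsCompact K → ∀ p : ℕ,
    ∃ c > (0 : ℝ), ∃ C : ℝ, ∀ α ∈ K, ∀ y : ℝ, 1 ≤ |y| → |y| ≤ 3 →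
      c ≤ ψ α p y ∧ ψ α p y ≤ C

/-- `𝓘_α^{(k,l)}`. -/
def Ical (ψ : ℝ → ℕ → ℝ → ℝ) (α : ℝ) (k l : ℕ) (y : ℝ) : ℝ :=
  ∫ z in {z : ℝ | 1 < |z|}, Dop^[k] gauss (y - z) * ψ α l z

/-- `f_α^{(k,l,m)}`. -/
def fklm (α : ℝ) (k l m : ℕ) (y w : ℝ) : ℝ :=
  ∫ z : ℝ, Dop^[k] gauss (y - w * z)
    * Dop^[l] (fun z' => iteratedDeriv m (fun a => stableDensity a z') α) z

def Gamman (n : ℕ) (α : ℝ) : ℝ := Real.sqrt ((1 - α / 2) * Real.log n)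

def Mn (n : ℕ) (α : ℝ) : ℝ := Real.sqrt ((2 - α) * Real.log n)

def Kconst (σ δ α : ℝ) : ℝ := deriv cAlpha α + cAlpha α * Real.log (δ / σ)

section

/-! ### Contour shifts -/

lemma integrable_exp_neg_abs' {q : ℝ} (hq : 0 < q) :
    Integrable (fun ξ : ℝ => Real.exp (-q * |ξ|)) := by
  rw [← integrableOn_univ, ← Iic_union_Ioi (a := (0 : ℝ))]
  refine IntegrableOn.union ?_ ?_
  · refine (integrableOn_exp_mul_Iic hq 0).congr_fun (fun x hx => ?_) measurableSet_Iic
    simp only [mem_Iic] at hx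
    simp [abs_of_nonpos hx]
  · refine (integrableOn_exp_mul_Ioi (a := -q) (by linarith) 0).congr_fun (fun x hx => ?_)
      measurableSet_Ioi
    simp only [mem_Ioi] at hx
    simp [abs_of_pos hx]

lemma shift_integral (H : ℂ → ℂ) (hH : Differentiable ℂ H) {C q η₁ η₂ : ℝ} (hq : 0 < q)
    (h12 : η₁ ≤ η₂)
    (hb : ∀ ξ : ℝ, ∀ y ∈ Icc η₁ η₂, ‖H (ξ + y * Complex.I)‖ ≤ C * Real.exp (-q * |ξ|)) :
    ∫ ξ : ℝ, H (ξ + η₁ * Complex.I) = ∫ ξ : ℝ, H (ξ + η₂ * Complex.I) := by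
  have hint : ∀ y ∈ Icc η₁ η₂, Integrable (fun ξ : ℝ => H (ξ + y * Complex.I)) := by
    intro y hy
    refine ((integrable_exp_neg_abs' hq).const_mul C).mono' ?_ ?_
    · exact (hH.continuous.comp (by fun_prop)).aestronglyMeasurable
    · exact ae_of_all _ (fun ξ => hb ξ y hy)
  have hlim : ∀ y ∈ Icc η₁ η₂, Tendsto (fun R : ℝ => ∫ x in (-R)..R, H (x + y * Complex.I)) atTop
      (𝓝 (∫ ξ : ℝ, H (ξ + y * Complex.I))) := fun y hy =>
    intervalIntegral_tendsto_integral (hint y hy) tendsto_neg_atTop_atBot tendsto_id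
  have hvert : ∀ s : ℝ → ℝ, (∀ R, |s R| = |R|) →
      Tendsto (fun R : ℝ => ∫ y in η₁..η₂, H ((s R : ℝ) + y * Complex.I)) atTop (𝓝 0) := by
    intro s hs
    have hz : Tendsto (fun R : ℝ => C * Real.exp (-q * |R|) * |η₂ - η₁|) atTop (𝓝 0) := by
      have h1 : Tendsto (fun R : ℝ => Real.exp (-q * |R|)) atTop (𝓝 0) := by
        refine Real.tendsto_exp_atBot.comp ?_
        exact (tendsto_abs_atTop_atTop).const_mul_atTop_of_neg (by linarith)
      simpa using (h1.const_mul C).mul_const (|η₂ - η₁|)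
    refine squeeze_zero_norm (fun R => ?_) hz
    refine intervalIntegral.norm_integral_le_of_norm_le_const (fun y hy => ?_)
    rw [uIoc_of_le h12] at hy
    have := hb (s R) y ⟨hy.1.le, hy.2⟩
    rwa [hs R] at this
  have hrect : ∀ R : ℝ, (∫ x in (-R)..R, H (x + η₁ * Complex.I))
      - (∫ x in (-R)..R, H (x + η₂ * Complex.I))
      + Complex.I • (∫ y in η₁..η₂, H ((R : ℝ) + y * Complex.I))
      - Complex.I • (∫ y in η₁..η₂, H (((-R : ℝ) : ℝ) + y * Complex.I)) = 0 := by
    intro R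
    have := Complex.integral_boundary_rect_eq_zero_of_differentiableOn H
      ⟨-R, η₁⟩ ⟨R, η₂⟩ hH.differentiableOn
    simpa using this
  have hl := (((hlim η₁ ⟨le_rfl, h12⟩).sub (hlim η₂ ⟨h12, le_rfl⟩)).add
    ((hvert (fun R => R) (fun R => rfl)).const_smul Complex.I)).sub
    ((hvert (fun R => -R) (fun R => abs_neg R)).const_smul Complex.I)
  have h0 := tendsto_nhds_unique hl (by simpa only [hrect] using tendsto_const_nhds)
  simpa [sub_eq_zero] using h0

/-- `exp (p ξ - κ e^ξ) ≤ C exp (-q |ξ|)`. -/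
lemma exp_decay {p κ : ℝ} (hp : 0 < p) (hκ : 0 < κ) :
    ∃ C : ℝ, ∃ q : ℝ, 0 < C ∧ 0 < q ∧ ∀ ξ : ℝ,
      Real.exp (p * ξ - κ * Real.exp ξ) ≤ C * Real.exp (-q * |ξ|) := by
  refine ⟨Real.exp ((2 * p) ^ 2 / (2 * κ)), p, Real.exp_pos _, hp, fun ξ => ?_⟩
  rw [← Real.exp_add, Real.exp_le_exp]
  rcases le_total ξ 0 with h | h
  · rw [abs_of_nonpos h]
    have : 0 ≤ κ * Real.exp ξ := by positivity
    have : 0 ≤ (2 * p) ^ 2 / (2 * κ) := by positivity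
    nlinarith
  · rw [abs_of_nonneg h]
    have h1 := Real.quadratic_le_exp_of_nonneg h
    have h2 : κ * (ξ ^ 2 / 2) ≤ κ * Real.exp ξ :=
      mul_le_mul_of_nonneg_left (by nlinarith) hκ.le
    have h3 : 2 * p * ξ ≤ (2 * p) ^ 2 / (2 * κ) + κ * (ξ ^ 2 / 2) := by
      have : (2 * p) ^ 2 / (2 * κ) + κ * (ξ ^ 2 / 2) - 2 * p * ξ
        = (2 * p - κ * ξ) ^ 2 / (2 * κ) := by field_simp; ring
      have h4 : 0 ≤ (2 * p - κ * ξ) ^ 2 / (2 * κ) := by positivity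
      linarith
    nlinarith

lemma exp_decay2 {p κ : ℝ} (hp : 0 < p) (hκ : 0 < κ) :
    ∃ C : ℝ, ∃ q : ℝ, 0 < C ∧ 0 < q ∧ ∀ ξ : ℝ,
      Real.exp (p * ξ - κ * Real.exp (2 * ξ)) ≤ C * Real.exp (-q * |ξ|) := by
  obtain ⟨C, q, hC, hq, h⟩ := exp_decay (p := p / 2) (by positivity) hκ
  refine ⟨C, q * 2, hC, by positivity, fun ξ => ?_⟩
  have := h (2 * ξ)
  rw [abs_mul, abs_of_pos (by norm_num : (0 : ℝ) < 2)] at this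
  convert this using 2 <;> ring_nf

lemma integrable_expexp {p κ : ℝ} (hp : 0 < p) (hκ : 0 < κ) :
    Integrable (fun ξ : ℝ => Real.exp (p * ξ - κ * Real.exp ξ)) := by
  obtain ⟨C, q, hC, hq, h⟩ := exp_decay hp hκ
  refine ((integrable_exp_neg_abs' hq).const_mul C).mono' ?_ ?_
  · exact (by fun_prop : Continuous _).aestronglyMeasurable
  · exact ae_of_all _ (fun ξ => by rw [Real.norm_of_nonneg (Real.exp_pos _).le]; exact h ξ)

lemma scale_expexp {p κ x : ℝ} (hx : 0 < x) :
    (∫ ξ : ℝ, Real.exp (p * ξ - κ * x * Real.exp ξ))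
      = x ^ (-p) * ∫ ξ : ℝ, Real.exp (p * ξ - κ * Real.exp ξ) := by
  rw [← integral_add_right_eq_self _ (-Real.log x), ← integral_const_mul]
  congr 1
  ext ξ
  rw [Real.rpow_def_of_pos hx, ← Real.exp_add, Real.exp_add ξ, Real.exp_neg, Real.exp_log hx]
  congr 1
  field_simp
  ring

/-- Polynomials are dominated by exponentials. -/
lemma one_add_abs_pow_le (b : ℕ) {ε : ℝ} (hε : 0 < ε) :
    ∃ C : ℝ, 0 < C ∧ ∀ ξ : ℝ, (1 + |ξ|) ^ b ≤ C * (Real.exp (-ε * ξ) + Real.exp (ε * ξ)) := by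
  refine ⟨(b.factorial : ℝ) / ε ^ b * Real.exp ε, by positivity, fun ξ => ?_⟩
  have h1 := Real.pow_div_factorial_le_exp (x := ε * (1 + |ξ|)) (by positivity) b
  have h2 : Real.exp (ε * |ξ|) ≤ Real.exp (-ε * ξ) + Real.exp (ε * ξ) := by
    rcases abs_cases ξ with ⟨h, _⟩ | ⟨h, _⟩ <;> rw [h]
    · linarith [Real.exp_pos (-ε * ξ)]
    · have : ε * -ξ = -ε * ξ := by ring
      rw [this]; linarith [Real.exp_pos (ε * ξ)]
  rw [mul_pow, mul_add, Real.exp_add, mul_one] at h1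
  have h3 : (1 + |ξ|) ^ b ≤ (b.factorial : ℝ) / ε ^ b * (Real.exp ε * Real.exp (ε * |ξ|)) := by
    have hf : (0 : ℝ) < b.factorial := by positivity
    rw [div_le_iff₀ hf] at h1
    rw [div_mul_eq_mul_div, le_div_iff₀ (by positivity)]
    linarith
  calc _ ≤ _ := h3
    _ ≤ (b.factorial : ℝ) / ε ^ b * (Real.exp ε * (Real.exp (-ε * ξ) + Real.exp (ε * ξ))) := by
        gcongr
    _ = _ := by ring

end


section

/-! ### Rotated integrals -/

lemma integral_Ioi_exp (F : ℝ → ℂ) :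
    ∫ τ in Ioi (0 : ℝ), F τ = ∫ ξ : ℝ, (Real.exp ξ : ℂ) * F (Real.exp ξ) := by
  have h := integral_image_eq_integral_abs_deriv_smul (s := univ) (f := Real.exp)
    (f' := Real.exp) MeasurableSet.univ (fun x _ => (Real.hasDerivAt_exp x).hasDerivWithinAt)
    Real.exp_injective.injOn F
  rw [image_univ, Real.range_exp] at h
  rw [h, setIntegral_univ]
  congr 1; ext ξ
  rw [abs_of_pos (Real.exp_pos ξ)]
  simp

lemma integrableOn_Ioi_exp (F : ℝ → ℝ) :
    IntegrableOn F (Ioi 0) ↔ Integrable (fun ξ : ℝ => Real.exp ξ * F (Real.exp ξ)) := by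
  have h := integrableOn_image_iff_integrableOn_abs_deriv_smul (s := univ) (f := Real.exp)
    (f' := Real.exp) MeasurableSet.univ (fun x _ => (Real.hasDerivAt_exp x).hasDerivWithinAt)
    Real.exp_injective.injOn F
  rw [image_univ, Real.range_exp] at h
  rw [h, integrableOn_univ]
  simp [abs_of_pos (Real.exp_pos _)]

/-- The point `ξ + i y`. -/
abbrev zc (ξ y : ℝ) : ℂ := (ξ : ℂ) + y * Complex.I

lemma re_exp_mul_zc (a ξ y : ℝ) :
    (Complex.exp (a * zc ξ y)).re = Real.exp (a * ξ) * Real.cos (a * y) := by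
  simp [Complex.exp_re]

lemma norm_exp_mul_zc (a ξ y : ℝ) : ‖Complex.exp (a * zc ξ y)‖ = Real.exp (a * ξ) := by
  simp [Complex.norm_exp]

lemma norm_exp_zc (ξ y : ℝ) : ‖Complex.exp (zc ξ y)‖ = Real.exp ξ := by
  simp [Complex.norm_exp]

lemma norm_exp_I_mul (x ξ y : ℝ) : ‖Complex.exp (Complex.I * x * Complex.exp (zc ξ y))‖
    = Real.exp (-(x * (Real.exp ξ * Real.sin y))) := by
  simp [Complex.norm_exp, Complex.exp_re, Complex.exp_im]

def eta0 : ℝ := Real.pi / 8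
def kap : ℝ := Real.sin eta0

lemma eta0_pos : 0 < eta0 := by unfold eta0; positivity
lemma eta0_lt : eta0 < 1 / 2 := by unfold eta0; linarith [Real.pi_lt_four]
lemma kap_pos : 0 < kap :=
  Real.sin_pos_of_pos_of_lt_pi eta0_pos (by unfold eta0; linarith [Real.pi_pos])

def rotI (x : ℝ) (g : ℂ → ℂ) : ℂ :=
  ∫ ξ : ℝ, Complex.exp (zc ξ eta0) * Complex.exp (Complex.I * x * Complex.exp (zc ξ eta0))
    * g (zc ξ eta0)

def Jint (p : ℝ) : ℝ := ∫ ξ : ℝ, Real.exp (p * ξ - kap * Real.exp ξ)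

lemma Jint_nonneg (p : ℝ) : 0 ≤ Jint p := integral_nonneg (fun _ => (Real.exp_pos _).le)

lemma rot_bound (g : ℂ → ℂ) {p₀ p₁ A x : ℝ} (hp₀ : -1 < p₀) (hp : p₀ ≤ p₁) (hA : 0 ≤ A)
    (hg : ∀ ξ : ℝ, ‖g (zc ξ eta0)‖ ≤ A * (Real.exp (p₀ * ξ) + Real.exp (p₁ * ξ))) (hx : 1 ≤ x) :
    ‖rotI x g‖ ≤ A * (Jint (p₀ + 1) + Jint (p₁ + 1)) * x ^ (-1 - p₀) := by
  have hx0 : 0 < x := by linarith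
  have i0 := integrable_expexp (p := p₀ + 1) (κ := kap * x) (by linarith) (mul_pos kap_pos hx0)
  have i1 := integrable_expexp (p := p₁ + 1) (κ := kap * x) (by linarith) (mul_pos kap_pos hx0)
  have h1 : ‖rotI x g‖ ≤ ∫ ξ : ℝ, A * (Real.exp ((p₀ + 1) * ξ - kap * x * Real.exp ξ)
      + Real.exp ((p₁ + 1) * ξ - kap * x * Real.exp ξ)) := by
    refine norm_integral_le_of_norm_le ((i0.add i1).const_mul A) (ae_of_all _ fun ξ => ?_)
    rw [norm_mul, norm_mul, norm_exp_zc, norm_exp_I_mul]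
    calc _ ≤ Real.exp ξ * Real.exp (-(x * (Real.exp ξ * Real.sin eta0)))
          * (A * (Real.exp (p₀ * ξ) + Real.exp (p₁ * ξ))) := by gcongr; exact hg ξ
      _ = _ := by
        have e : ∀ p : ℝ, Real.exp ((p + 1) * ξ - kap * x * Real.exp ξ)
            = Real.exp ξ * Real.exp (-(x * (Real.exp ξ * Real.sin eta0))) * Real.exp (p * ξ) := by
          intro p
          rw [← Real.exp_add, ← Real.exp_add]
          congr 1
          simp only [kap]; ring
        rw [e, e]; ring
  rw [integral_const_mul, integral_add i0 i1, scale_expexp hx0, scale_expexp hx0] at h1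
  refine h1.trans ?_
  have e1 : x ^ (-(p₁ + 1)) ≤ x ^ (-1 - p₀) :=
    Real.rpow_le_rpow_of_exponent_le hx (by linarith)
  have e0 : -(p₀ + 1) = -1 - p₀ := by ring
  rw [e0]
  have := Jint_nonneg (p₁ + 1)
  calc _ ≤ A * (x ^ (-1 - p₀) * Jint (p₀ + 1) + x ^ (-1 - p₀) * Jint (p₁ + 1)) := by
        gcongr <;> exact le_rfl
    _ = _ := by ring

lemma rot_eq (g : ℂ → ℂ) (hgd : Differentiable ℂ g) {p₀ p₁ A κ x : ℝ} (hp₀ : -1 < p₀)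
    (hp₁ : -1 < p₁) (hκ : 0 < κ) (hA : 0 ≤ A)
    (hg : ∀ ξ : ℝ, ∀ y ∈ Icc 0 eta0, ‖g (zc ξ y)‖
      ≤ A * (Real.exp (p₀ * ξ) + Real.exp (p₁ * ξ)) * Real.exp (-κ * Real.exp (2 * ξ)))
    (hx : 0 ≤ x) :
    ∫ τ in Ioi (0 : ℝ), Complex.exp (Complex.I * x * τ) * g (Real.log τ) = rotI x g := by
  rw [integral_Ioi_exp]
  obtain ⟨C₀, q₀, hC₀, hq₀, h₀⟩ := exp_decay2 (p := p₀ + 1) (κ := κ) (by linarith) hκ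
  obtain ⟨C₁, q₁, hC₁, hq₁, h₁⟩ := exp_decay2 (p := p₁ + 1) (κ := κ) (by linarith) hκ
  have key := shift_integral
    (fun ζ => Complex.exp ζ * Complex.exp (Complex.I * x * Complex.exp ζ) * g ζ)
    (by fun_prop) (C := A * (C₀ + C₁)) (q := min q₀ q₁) (η₁ := 0) (η₂ := eta0)
    (lt_min hq₀ hq₁) eta0_pos.le (fun ξ y hy => ?_)
  · simp only [Complex.ofReal_zero, zero_mul, add_zero] at key
    rw [rotI, ← key]
    congr 1; ext ξ
    simp only [Real.log_exp, Complex.ofReal_exp]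
    ring
  · change ‖Complex.exp (zc ξ y) * Complex.exp (Complex.I * x * Complex.exp (zc ξ y))
      * g (zc ξ y)‖ ≤ _
    rw [norm_mul, norm_mul, norm_exp_zc, norm_exp_I_mul]
    have hs : 0 ≤ Real.sin y := Real.sin_nonneg_of_nonneg_of_le_pi hy.1
      (by have := hy.2; unfold eta0 at this; linarith [Real.pi_pos])
    have h2 : Real.exp (-(x * (Real.exp ξ * Real.sin y))) ≤ 1 := by
      rw [Real.exp_le_one_iff]
      have : 0 ≤ x * (Real.exp ξ * Real.sin y) := by positivity
      linarith
    calc _ ≤ Real.exp ξ * 1 * (A * (Real.exp (p₀ * ξ) + Real.exp (p₁ * ξ))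
            * Real.exp (-κ * Real.exp (2 * ξ))) := by
          gcongr
          exact hg ξ y hy
      _ = A * (Real.exp ((p₀ + 1) * ξ - κ * Real.exp (2 * ξ))
            + Real.exp ((p₁ + 1) * ξ - κ * Real.exp (2 * ξ))) := by
          have e : ∀ p : ℝ, Real.exp ((p + 1) * ξ - κ * Real.exp (2 * ξ))
            = Real.exp ξ * Real.exp (p * ξ) * Real.exp (-κ * Real.exp (2 * ξ)) := by
            intro p
            rw [← Real.exp_add, ← Real.exp_add]
            congr 1; ring
          rw [e, e]; ring
      _ ≤ A * (C₀ * Real.exp (-q₀ * |ξ|) + C₁ * Real.exp (-q₁ * |ξ|)) := by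
          gcongr
          · exact h₀ ξ
          · exact h₁ ξ
      _ ≤ A * (C₀ * Real.exp (-(min q₀ q₁) * |ξ|) + C₁ * Real.exp (-(min q₀ q₁) * |ξ|)) := by
          have := abs_nonneg ξ
          have a1 : min q₀ q₁ ≤ q₀ := min_le_left _ _
          have a2 : min q₀ q₁ ≤ q₁ := min_le_right _ _
          gcongr
      _ = _ := by ring

end


section

/-! ### The leading constants -/

lemma norm_zc_le (ξ : ℝ) {y : ℝ} (hy : y ∈ Icc (0 : ℝ) 2) : ‖zc ξ y‖ ≤ 2 * (1 + |ξ|) := by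
  have h1 : ‖zc ξ y‖ ≤ |ξ| + |y| := by
    refine (norm_add_le _ _).trans ?_
    simp
  rw [abs_of_nonneg hy.1] at h1
  have := hy.2
  have := abs_nonneg ξ
  linarith

/-- The leading integrand. -/
def glead (α : ℝ) (b : ℕ) (ζ : ℂ) : ℂ := Complex.exp (α * ζ) * ζ ^ b

lemma glead_bound {α ε : ℝ} (b : ℕ) (hε : 0 < ε) : ∃ A : ℝ, 0 < A ∧ ∀ ξ : ℝ,
    ∀ y ∈ Icc (0 : ℝ) 2,
    ‖glead α b (zc ξ y)‖ ≤ A * (Real.exp ((α - ε) * ξ) + Real.exp ((α + ε) * ξ)) := by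
  obtain ⟨C, hC, h⟩ := one_add_abs_pow_le b hε
  refine ⟨2 ^ b * C, by positivity, fun ξ y hy => ?_⟩
  rw [glead, norm_mul, norm_exp_mul_zc, norm_pow]
  have e : ∀ s : ℝ, Real.exp ((α + s) * ξ) = Real.exp (α * ξ) * Real.exp (s * ξ) := by
    intro s; rw [← Real.exp_add]; congr 1; ring
  have h2 : ‖zc ξ y‖ ^ b ≤ (2 * (1 + |ξ|)) ^ b := by
    gcongr; exact norm_zc_le ξ hy
  rw [mul_pow] at h2
  calc _ ≤ Real.exp (α * ξ) * (2 ^ b * (C * (Real.exp (-ε * ξ) + Real.exp (ε * ξ)))) := by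
        gcongr
        exact h2.trans (by gcongr; exact h ξ)
    _ = _ := by rw [sub_eq_add_neg, e, e]; ring

lemma differentiable_glead (α : ℝ) (b : ℕ) : Differentiable ℂ (glead α b) := by
  unfold glead; fun_prop

lemma lead_integrable {α : ℝ} (b : ℕ) (hα : 0 < α) : Integrable (fun ξ : ℝ =>
    Complex.exp (zc ξ eta0) * Complex.exp (Complex.I * (1 : ℝ) * Complex.exp (zc ξ eta0))
    * glead α b (zc ξ eta0)) := by
  obtain ⟨A, hA, h⟩ := glead_bound (α := α) b hα
  have i0 := integrable_expexp (p := 1 + (α - α)) (κ := kap) (by linarith) kap_pos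
  have i1 := integrable_expexp (p := 1 + (α + α)) (κ := kap) (by linarith) kap_pos
  refine ((i0.add i1).const_mul A).mono' ?_ (ae_of_all _ fun ξ => ?_)
  · have := (differentiable_glead α b).continuous
    exact (by fun_prop : Continuous _).aestronglyMeasurable
  · rw [norm_mul, norm_mul, norm_exp_zc, norm_exp_I_mul]
    have e : ∀ p : ℝ, Real.exp ((1 + p) * ξ - kap * Real.exp ξ)
            = Real.exp ξ * Real.exp (-(1 * (Real.exp ξ * Real.sin eta0))) * Real.exp (p * ξ) := by
          intro p
          rw [← Real.exp_add, ← Real.exp_add]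
          congr 1
          simp only [kap]; ring
    calc _ ≤ Real.exp ξ * Real.exp (-(1 * (Real.exp ξ * Real.sin eta0)))
          * (A * (Real.exp ((α - α) * ξ) + Real.exp ((α + α) * ξ))) := by
          gcongr
          exact h ξ eta0 ⟨eta0_pos.le, by linarith [eta0_lt]⟩
      _ = _ := by
        simp only [Pi.add_apply]
        rw [e, e]; ring

/-- Rotating the leading integral up to the imaginary axis. -/
lemma lead_rot {α : ℝ} (b : ℕ) (hα : 0 < α) :
    rotI 1 (glead α b) = ∫ ξ : ℝ, Complex.exp ((1 + α) * zc ξ (Real.pi / 2))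
      * zc ξ (Real.pi / 2) ^ b * (Real.exp (-Real.exp ξ) : ℂ) := by
  obtain ⟨A, hA, h⟩ := glead_bound (α := α) b hα
  obtain ⟨C₀, q₀, hC₀, hq₀, h₀⟩ := exp_decay (p := 1 + (α - α)) (κ := kap) (by linarith) kap_pos
  obtain ⟨C₁, q₁, hC₁, hq₁, h₁⟩ := exp_decay (p := 1 + (α + α)) (κ := kap) (by linarith) kap_pos
  have hd := differentiable_glead α b
  have hpi : eta0 ≤ Real.pi / 2 := by unfold eta0; linarith [Real.pi_pos]
  have key := shift_integral
    (fun ζ => Complex.exp ζ * Complex.exp (Complex.I * (1 : ℝ) * Complex.exp ζ) * glead α b ζ)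
    (by fun_prop) (C := A * (C₀ + C₁)) (q := min q₀ q₁) (η₁ := eta0) (η₂ := Real.pi / 2)
    (lt_min hq₀ hq₁) hpi (fun ξ y hy => ?_)
  · rw [rotI]
    refine key.trans ?_
    congr 1; ext ξ
    have e1 : Complex.exp ((ξ : ℂ) + ((Real.pi / 2 : ℝ) : ℂ) * Complex.I)
        = Complex.I * Complex.exp ξ := by
      rw [Complex.exp_add]
      push_cast
      rw [Complex.exp_pi_div_two_mul_I]; ring
    have e2 : Complex.exp (Complex.I * ((1 : ℝ) : ℂ) *
        Complex.exp ((ξ : ℂ) + ((Real.pi / 2 : ℝ) : ℂ) * Complex.I))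
        = (Real.exp (-Real.exp ξ) : ℂ) := by
      rw [e1]
      push_cast
      congr 1
      linear_combination (Complex.exp ξ) * Complex.I_mul_I
    rw [e2]
    have e3 : Complex.exp ((1 + (α : ℂ)) * zc ξ (Real.pi / 2)) = Complex.exp (zc ξ (Real.pi / 2))
        * Complex.exp (α * zc ξ (Real.pi / 2)) := by
      rw [← Complex.exp_add]; congr 1; ring
    rw [e3]
    simp only [glead, zc]
    ring
  · change ‖Complex.exp (zc ξ y) * Complex.exp (Complex.I * (1 : ℝ) * Complex.exp (zc ξ y))
      * glead α b (zc ξ y)‖ ≤ _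
    rw [norm_mul, norm_mul, norm_exp_zc, norm_exp_I_mul]
    have hs : kap ≤ Real.sin y := by
      refine Real.sin_le_sin_of_le_of_le_pi_div_two ?_ hy.2 hy.1
      linarith [eta0_pos, Real.pi_pos]
    have hy2 : y ∈ Icc (0 : ℝ) 2 := ⟨eta0_pos.le.trans hy.1, hy.2.trans (by
      linarith [Real.pi_lt_four])⟩
    calc _ ≤ Real.exp ξ * Real.exp (-(1 * (Real.exp ξ * kap)))
            * (A * (Real.exp ((α - α) * ξ) + Real.exp ((α + α) * ξ))) := by
          gcongr
          exact h ξ y hy2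
      _ = A * (Real.exp ((1 + (α - α)) * ξ - kap * Real.exp ξ)
            + Real.exp ((1 + (α + α)) * ξ - kap * Real.exp ξ)) := by
          have e : ∀ p : ℝ, Real.exp ((1 + p) * ξ - kap * Real.exp ξ)
            = Real.exp ξ * Real.exp (-(1 * (Real.exp ξ * kap))) * Real.exp (p * ξ) := by
            intro p
            rw [← Real.exp_add, ← Real.exp_add]
            congr 1; ring
          rw [e, e]; ring
      _ ≤ A * (C₀ * Real.exp (-q₀ * |ξ|) + C₁ * Real.exp (-q₁ * |ξ|)) := by
          gcongr
          · exact h₀ ξ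
          · exact h₁ ξ
      _ ≤ A * (C₀ * Real.exp (-(min q₀ q₁) * |ξ|) + C₁ * Real.exp (-(min q₀ q₁) * |ξ|)) := by
          have := abs_nonneg ξ
          have a1 : min q₀ q₁ ≤ q₀ := min_le_left _ _
          have a2 : min q₀ q₁ ≤ q₁ := min_le_right _ _
          gcongr
      _ = _ := by ring

lemma rotI_scale {x : ℝ} (hx : 0 < x) (g : ℂ → ℂ) :
    rotI x g = ∫ ξ : ℝ, (x : ℂ)⁻¹ * (Complex.exp (zc ξ eta0)
      * Complex.exp (Complex.I * (1 : ℝ) * Complex.exp (zc ξ eta0))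
      * g (zc ξ eta0 - Real.log x)) := by
  rw [rotI, ← integral_add_right_eq_self _ (-Real.log x)]
  congr 1; ext ξ
  have e : zc (ξ + -Real.log x) eta0 = zc ξ eta0 - Real.log x := by simp [zc]; ring
  have hx' : (x : ℂ) ≠ 0 := by exact_mod_cast hx.ne'
  have e2 : Complex.exp (zc ξ eta0 - Real.log x) = Complex.exp (zc ξ eta0) * (x : ℂ)⁻¹ := by
    rw [Complex.exp_sub, ← Complex.ofReal_exp, Real.exp_log hx, div_eq_mul_inv]
  rw [e, e2]
  have e3 : Complex.I * (x : ℂ) * (Complex.exp (zc ξ eta0) * (x : ℂ)⁻¹)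
    = Complex.I * (1 : ℝ) * Complex.exp (zc ξ eta0) := by
    field_simp; simp
  rw [e3]; ring

lemma lead_scale0 {α x : ℝ} (hx : 0 < x) :
    rotI x (glead α 0) = ((x ^ (-1 - α) : ℝ) : ℂ) * rotI 1 (glead α 0) := by
  rw [rotI_scale hx, rotI, ← integral_const_mul]
  congr 1; ext ξ
  simp only [glead, pow_zero, mul_one]
  have e : Complex.exp ((α : ℂ) * (zc ξ eta0 - Real.log x))
      = Complex.exp ((α : ℂ) * zc ξ eta0) / Complex.exp ((Real.log x : ℂ) * α) := by
    rw [← Complex.exp_sub]; congr 1; ring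
  rw [e, Real.rpow_sub hx, Real.rpow_neg_one, Real.rpow_def_of_pos hx]
  rw [Complex.ofReal_div, Complex.ofReal_exp, Complex.ofReal_mul, Complex.ofReal_inv]
  ring

lemma lead_scale1 {α x : ℝ} (hα : 0 < α) (hx : 0 < x) :
    rotI x (glead α 1) = ((x ^ (-1 - α) : ℝ) : ℂ) *
      (rotI 1 (glead α 1) - Real.log x * rotI 1 (glead α 0)) := by
  rw [rotI_scale hx, rotI, rotI, ← integral_const_mul (Real.log x : ℂ), ← integral_sub
    (lead_integrable 1 hα) ((lead_integrable 0 hα).const_mul _), ← integral_const_mul]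
  congr 1; ext ξ
  simp only [glead, pow_zero, mul_one, pow_one]
  have e : Complex.exp ((α : ℂ) * (zc ξ eta0 - Real.log x))
      = Complex.exp ((α : ℂ) * zc ξ eta0) / Complex.exp ((Real.log x : ℂ) * α) := by
    rw [← Complex.exp_sub]; congr 1; ring
  rw [e, Real.rpow_sub hx, Real.rpow_neg_one, Real.rpow_def_of_pos hx]
  rw [Complex.ofReal_div, Complex.ofReal_exp, Complex.ofReal_mul, Complex.ofReal_inv]
  ring

end


section

/-! ### Gamma function identification -/

lemma gammaInt_log {s : ℝ} (hs : 0 < s) :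
    HasDerivAt Real.Gamma (∫ ξ : ℝ, Real.exp (s * ξ) * ξ * Real.exp (-Real.exp ξ)) s := by
  have h1 := Complex.hasDerivAt_GammaIntegral (s := (s : ℂ)) (by simpa using hs)
  have h2 : HasDerivAt Complex.Gamma (∫ t : ℝ in Ioi 0, (t : ℂ) ^ ((s : ℂ) - 1) *
      (Real.log t * Real.exp (-t))) s := by
    refine h1.congr_of_eventuallyEq ?_
    have : ∀ᶠ z : ℂ in 𝓝 (s : ℂ), 0 < z.re :=
      (Complex.continuous_re.isOpen_preimage _ isOpen_Ioi).mem_nhds (by simpa using hs)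
    filter_upwards [this] with z hz
    exact Complex.Gamma_eq_integral hz
  have h3 := h2.real_of_complex
  rw [integral_Ioi_exp] at h3
  have h4 : (∫ ξ : ℝ, (Real.exp ξ : ℂ) * ((Real.exp ξ : ℂ) ^ ((s : ℂ) - 1) *
      (Real.log (Real.exp ξ) * Real.exp (-Real.exp ξ))))
      = ((∫ ξ : ℝ, Real.exp (s * ξ) * ξ * Real.exp (-Real.exp ξ) : ℝ) : ℂ) := by
    rw [← integral_complex_ofReal]
    congr 1; ext ξ
    rw [Real.log_exp, Complex.cpow_def_of_ne_zero (by exact_mod_cast (Real.exp_pos ξ).ne'),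
      ← Complex.ofReal_log (Real.exp_pos ξ).le, Real.log_exp]
    push_cast
    rw [← mul_assoc, ← mul_assoc, ← Complex.exp_add]
    congr 3
    ring
  rw [h4] at h3
  simpa [Complex.Gamma_ofReal] using h3

lemma gammaInt {s : ℝ} (hs : 0 < s) :
    Real.Gamma s = ∫ ξ : ℝ, Real.exp (s * ξ) * Real.exp (-Real.exp ξ) := by
  have h1 := Complex.Gamma_eq_integral (s := (s : ℂ)) (by simpa using hs)
  rw [Complex.GammaIntegral, integral_Ioi_exp, Complex.Gamma_ofReal] at h1
  have h4 : (∫ ξ : ℝ, (Real.exp ξ : ℂ) * (((-Real.exp ξ).exp : ℝ) *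
      (Real.exp ξ : ℂ) ^ ((s : ℂ) - 1)))
      = ((∫ ξ : ℝ, Real.exp (s * ξ) * Real.exp (-Real.exp ξ) : ℝ) : ℂ) := by
    rw [← integral_complex_ofReal]
    congr 1; ext ξ
    rw [Complex.cpow_def_of_ne_zero (by exact_mod_cast (Real.exp_pos ξ).ne'),
      ← Complex.ofReal_log (Real.exp_pos ξ).le, Real.log_exp]
    push_cast
    rw [mul_left_comm, mul_comm, ← Complex.exp_add]
    congr 2
    ring
  rw [h4] at h1
  exact_mod_cast h1

def Cfun (α : ℝ) : ℝ := -(Real.Gamma (1 + α) * Real.cos ((1 + α) * (Real.pi / 2))) / Real.pi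

lemma integrable_gam {s : ℝ} (hs : 0 < s) :
    Integrable (fun ξ : ℝ => Real.exp (s * ξ) * Real.exp (-Real.exp ξ)) := by
  have := integrable_expexp (p := s) (κ := 1) hs one_pos
  refine this.congr (ae_of_all _ fun ξ => ?_)
  simp only [← Real.exp_add]; congr 1; ring

lemma integrable_gam1 {s : ℝ} (hs : 0 < s) :
    Integrable (fun ξ : ℝ => Real.exp (s * ξ) * ξ * Real.exp (-Real.exp ξ)) := by
  obtain ⟨C, hC, h⟩ := one_add_abs_pow_le 1 (half_pos hs)
  have i1 := integrable_gam (s := s - s / 2) (by linarith)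
  have i2 := integrable_gam (s := s + s / 2) (by linarith)
  refine ((i1.add i2).const_mul C).mono' (by fun_prop) (ae_of_all _ fun ξ => ?_)
  have h1 := h ξ
  rw [pow_one] at h1
  have e : ∀ r : ℝ, Real.exp ((s + r) * ξ) = Real.exp (s * ξ) * Real.exp (r * ξ) := by
    intro r; rw [← Real.exp_add]; congr 1; ring
  simp only [norm_mul, Pi.add_apply, Real.norm_eq_abs, Real.abs_exp]
  rw [sub_eq_add_neg, e, e]
  calc _ ≤ Real.exp (s * ξ) * (C * (Real.exp (-(s / 2) * ξ) + Real.exp (s / 2 * ξ)))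
        * Real.exp (-Real.exp ξ) := by gcongr; linarith
    _ = _ := by ring

lemma re_integral_exp_zc {s : ℝ} :
    ∀ ξ : ℝ, Complex.exp ((1 + (s : ℂ)) * zc ξ (Real.pi / 2))
      = (Real.exp ((1 + s) * ξ) : ℂ) * (Real.cos ((1 + s) * (Real.pi / 2))
        + Real.sin ((1 + s) * (Real.pi / 2)) * Complex.I) := by
  intro ξ
  have : (1 + (s : ℂ)) * zc ξ (Real.pi / 2) = (((1 + s) * ξ : ℝ) : ℂ)
      + (((1 + s) * (Real.pi / 2) : ℝ) : ℂ) * Complex.I := by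
    simp only [zc]; push_cast; ring
  rw [this, Complex.exp_add, Complex.exp_mul_I]
  simp only [Complex.ofReal_exp, Complex.ofReal_cos, Complex.ofReal_sin]

lemma lead_const0 {α : ℝ} (hα : 0 < α) : (rotI 1 (glead α 0)).re = -Real.pi * Cfun α := by
  rw [lead_rot 0 hα]
  have : (∫ ξ : ℝ, Complex.exp ((1 + α) * zc ξ (Real.pi / 2))
      * zc ξ (Real.pi / 2) ^ 0 * (Real.exp (-Real.exp ξ) : ℂ))
      = (Real.Gamma (1 + α) : ℂ) * (Real.cos ((1 + α) * (Real.pi / 2))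
        + Real.sin ((1 + α) * (Real.pi / 2)) * Complex.I) := by
    rw [gammaInt (by linarith), ← integral_complex_ofReal, ← integral_mul_const]
    congr 1; ext ξ
    rw [re_integral_exp_zc]
    push_cast; ring
  rw [this, Cfun]
  have := Real.pi_pos
  simp [-Complex.ofReal_cos, -Complex.ofReal_sin]
  field_simp

lemma lead_const1 {α : ℝ} (hα : 0 < α) :
    HasDerivAt Cfun (-(rotI 1 (glead α 1)).re / Real.pi) α := by
  have hg := gammaInt_log (s := 1 + α) (by linarith)
  have h1 : HasDerivAt Cfun (-((∫ ξ : ℝ, Real.exp ((1 + α) * ξ) * ξ * Real.exp (-Real.exp ξ))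
      * Real.cos ((1 + α) * (Real.pi / 2)) + Real.Gamma (1 + α) *
      (-Real.sin ((1 + α) * (Real.pi / 2)) * (Real.pi / 2))) / Real.pi) α := by
    have ha : HasDerivAt (fun a : ℝ => 1 + a) 1 α := by
      simpa using (hasDerivAt_id α).const_add 1
    have hb : HasDerivAt (fun a : ℝ => Real.cos ((1 + a) * (Real.pi / 2)))
        (-Real.sin ((1 + α) * (Real.pi / 2)) * (Real.pi / 2)) α := by
      have := (ha.mul_const (Real.pi / 2)).cos
      simpa using this
    have hc : HasDerivAt (fun a : ℝ => Real.Gamma (1 + a))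
        (∫ ξ : ℝ, Real.exp ((1 + α) * ξ) * ξ * Real.exp (-Real.exp ξ)) α := by
      have := HasDerivAt.comp α hg ha
      rw [mul_one] at this
      exact this
    exact ((hc.mul hb).neg).div_const _
  convert h1 using 2
  rw [lead_rot 1 hα]
  have : (∫ ξ : ℝ, Complex.exp ((1 + α) * zc ξ (Real.pi / 2))
      * zc ξ (Real.pi / 2) ^ 1 * (Real.exp (-Real.exp ξ) : ℂ))
      = (Real.cos ((1 + α) * (Real.pi / 2)) + Real.sin ((1 + α) * (Real.pi / 2)) * Complex.I)
       * (((∫ ξ : ℝ, Real.exp ((1 + α) * ξ) * ξ * Real.exp (-Real.exp ξ) : ℝ) : ℂ)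
       + (Real.pi / 2) * Complex.I * (Real.Gamma (1 + α) : ℂ)) := by
    rw [gammaInt (by linarith), ← integral_complex_ofReal, ← integral_complex_ofReal,
      ← integral_const_mul, ← integral_add, ← integral_const_mul]
    · congr 1; ext ξ
      rw [re_integral_exp_zc]
      simp only [zc]
      push_cast; ring
    · exact (integrable_gam1 (by linarith)).ofReal
    · exact (integrable_gam (by linarith)).ofReal.const_mul _
  rw [this]
  simp [-Complex.ofReal_cos, -Complex.ofReal_sin]
  ring

lemma cAlpha_eq {α : ℝ} (hα : α ∈ Ioo (0 : ℝ) 2) : cAlpha α = Cfun α := by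
  have hp := Real.pi_pos
  unfold cAlpha Cfun
  split_ifs with h
  · subst h
    have : ((1 : ℝ) + 1) * (Real.pi / 2) = Real.pi := by ring
    rw [this, show (1 : ℝ) + 1 = 2 by norm_num, Real.cos_pi, Real.Gamma_two]
    ring
  · have h1 : Real.Gamma (1 + α) * (Real.Gamma (2 - α) / (1 - α)) = α * (Real.pi / Real.sin (Real.pi * α)) := by
      rw [← Real.Gamma_mul_Gamma_one_sub, add_comm, Real.Gamma_add_one hα.1.ne',
        show 2 - α = (1 - α) + 1 by ring, Real.Gamma_add_one (sub_ne_zero.2 (Ne.symm h))]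
      have : 1 - α ≠ 0 := sub_ne_zero.2 (Ne.symm h)
      field_simp
    have hg : Real.Gamma (2 - α) ≠ 0 := (Real.Gamma_pos_of_pos (by linarith [hα.2])).ne'
    have h1a : 1 - α ≠ 0 := sub_ne_zero.2 (Ne.symm h)
    have hs : 0 < Real.sin (Real.pi * α / 2) :=
      Real.sin_pos_of_pos_of_lt_pi (by have := hα.1; positivity) (by nlinarith [hα.2])
    have hc : Real.cos (Real.pi * α / 2) ≠ 0 := by
      intro hc
      rcases lt_or_gt_of_ne h with h' | h'
      · have := Real.cos_pos_of_mem_Ioo (x := Real.pi * α / 2)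
          ⟨by have := mul_pos hp hα.1; linarith, by nlinarith⟩
        linarith
      · have := Real.cos_neg_of_pi_div_two_lt_of_lt (x := Real.pi * α / 2)
          (by nlinarith) (by nlinarith [hα.2])
        linarith
    have e1 : Real.sin (Real.pi * α) = 2 * Real.sin (Real.pi * α / 2) * Real.cos (Real.pi * α / 2) := by
      rw [← Real.sin_two_mul]; congr 1; ring
    have e2 : Real.cos ((1 + α) * (Real.pi / 2)) = - Real.sin (Real.pi * α / 2) := by
      rw [← Real.cos_add_pi_div_two]; congr 1; ring
    rw [e1] at h1
    rw [e2]
    generalize Real.sin (Real.pi * α / 2) = S at *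
    generalize Real.cos (Real.pi * α / 2) = K at *
    generalize Real.Gamma (1 + α) = G1 at *
    generalize Real.Gamma (2 - α) = G2 at *
    have hs' := hs.ne'
    field_simp at h1 ⊢
    linarith

lemma cAlpha_pos {α : ℝ} (hα : α ∈ Ioo (0 : ℝ) 2) : 0 < cAlpha α := by
  rw [cAlpha_eq hα, Cfun]
  have hp := Real.pi_pos
  have e2 : Real.cos ((1 + α) * (Real.pi / 2)) = - Real.sin (Real.pi * α / 2) := by
    rw [← Real.cos_add_pi_div_two]; congr 1; ring
  have hs : 0 < Real.sin (Real.pi * α / 2) :=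
      Real.sin_pos_of_pos_of_lt_pi (by have := hα.1; positivity) (by nlinarith [hα.2])
  have hg : 0 < Real.Gamma (1 + α) := Real.Gamma_pos_of_pos (by linarith [hα.1])
  rw [e2, mul_neg, neg_neg]
  positivity

lemma lead0 {α : ℝ} (hα : α ∈ Ioo (0 : ℝ) 2) :
    (rotI 1 (glead α 0)).re = -Real.pi * cAlpha α := by
  rw [lead_const0 hα.1, cAlpha_eq hα]

lemma lead1 {α : ℝ} (hα : α ∈ Ioo (0 : ℝ) 2) :
    (rotI 1 (glead α 1)).re = -Real.pi * deriv cAlpha α := by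
  have h : HasDerivAt cAlpha (-(rotI 1 (glead α 1)).re / Real.pi) α := by
    refine (lead_const1 hα.1).congr_of_eventuallyEq ?_
    filter_upwards [isOpen_Ioo.mem_nhds hα] with a ha using cAlpha_eq ha
  rw [h.deriv]
  have := Real.pi_pos
  field_simp

end


section

/-! ### Cosine transforms -/

/-- Normalised cosine transform. -/
def FT (G : ℝ → ℝ) (x : ℝ) : ℝ := Real.pi⁻¹ * ∫ τ in Ioi (0 : ℝ), Real.cos (x * τ) * G τ

lemma FT_neg (G : ℝ → ℝ) (x : ℝ) : FT G (-x) = FT G x := by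
  unfold FT; simp

lemma FT_abs (G : ℝ → ℝ) (x : ℝ) : FT G |x| = FT G x := by
  rcases abs_choice x with h | h <;> rw [h]
  exact FT_neg G x

/-- `G` extends to `g` with good bounds. -/
structure Ext (g : ℂ → ℂ) (G : ℝ → ℝ) (p₀ p₁ κ A : ℝ) : Prop where
  diff : Differentiable ℂ g
  eq : ∀ ξ : ℝ, g ξ = (G (Real.exp ξ) : ℂ)
  bound : ∀ ξ : ℝ, ∀ y ∈ Icc 0 eta0, ‖g (zc ξ y)‖
      ≤ A * (Real.exp (p₀ * ξ) + Real.exp (p₁ * ξ)) * Real.exp (-κ * Real.exp (2 * ξ))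

section ExtSec

variable {g : ℂ → ℂ} {G : ℝ → ℝ} {p₀ p₁ κ A : ℝ}

lemma Ext.A_nonneg (h : Ext g G p₀ p₁ κ A) : 0 ≤ A := by
  have := (norm_nonneg _).trans (h.bound 0 0 ⟨le_rfl, eta0_pos.le⟩)
  by_contra hA
  push Not at hA
  have : A * (Real.exp (p₀ * 0) + Real.exp (p₁ * 0)) * Real.exp (-κ * Real.exp (2 * 0)) < 0 := by
    have h1 := Real.exp_pos (-κ * Real.exp (2 * 0))
    have h2 := Real.exp_pos (p₀ * 0)
    have h3 := Real.exp_pos (p₁ * 0)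
    exact mul_neg_of_neg_of_pos (mul_neg_of_neg_of_pos hA (by positivity)) h1
  linarith

def Kint (p κ : ℝ) : ℝ := ∫ ξ : ℝ, Real.exp (p * ξ - κ * Real.exp (2 * ξ))

lemma Kint_nonneg (p κ : ℝ) : 0 ≤ Kint p κ := integral_nonneg fun _ => (Real.exp_pos _).le

lemma integrable_Kint {p κ : ℝ} (hp : 0 < p) (hκ : 0 < κ) :
    Integrable (fun ξ : ℝ => Real.exp (p * ξ - κ * Real.exp (2 * ξ))) := by
  obtain ⟨C, q, hC, hq, h⟩ := exp_decay2 hp hκ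
  refine ((integrable_exp_neg_abs' hq).const_mul C).mono' ?_ ?_
  · exact (by fun_prop : Continuous _).aestronglyMeasurable
  · exact ae_of_all _ (fun ξ => by rw [Real.norm_of_nonneg (Real.exp_pos _).le]; exact h ξ)

lemma Ext.cont (h : Ext g G p₀ p₁ κ A) : ContinuousOn G (Ioi 0) := by
  have h1 : Continuous (fun ξ : ℝ => (g ξ).re) :=
    Complex.continuous_re.comp (h.diff.continuous.comp Complex.continuous_ofReal)
  have h2 : ∀ τ ∈ Ioi (0 : ℝ), G τ = (g (Real.log τ)).re := by
    intro τ hτ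
    rw [h.eq, Real.exp_log hτ, Complex.ofReal_re]
  refine ContinuousOn.congr ?_ h2
  exact h1.comp_continuousOn (Real.continuousOn_log.mono (fun x hx => ne_of_gt hx))

lemma Ext.abs_le (h : Ext g G p₀ p₁ κ A) (ξ : ℝ) : Real.exp ξ * |G (Real.exp ξ)|
    ≤ A * (Real.exp ((p₀ + 1) * ξ - κ * Real.exp (2 * ξ))
      + Real.exp ((p₁ + 1) * ξ - κ * Real.exp (2 * ξ))) := by
  have h1 := h.bound ξ 0 ⟨le_rfl, eta0_pos.le⟩
  simp only [zc, Complex.ofReal_zero, zero_mul, add_zero] at h1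
  rw [h.eq, Complex.norm_real, Real.norm_eq_abs] at h1
  have e : ∀ p : ℝ, Real.exp ((p + 1) * ξ - κ * Real.exp (2 * ξ))
            = Real.exp ξ * Real.exp (p * ξ) * Real.exp (-κ * Real.exp (2 * ξ)) := by
    intro p
    rw [← Real.exp_add, ← Real.exp_add]
    congr 1; ring
  rw [e, e]
  have := Real.exp_pos ξ
  nlinarith

lemma Ext.integrable' (h : Ext g G p₀ p₁ κ A) (hp₀ : -1 < p₀) (hp : p₀ ≤ p₁) (hκ : 0 < κ) :
    Integrable (fun ξ : ℝ => Real.exp ξ * G (Real.exp ξ)) := by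
  refine (((integrable_Kint (p := p₀ + 1) (by linarith) hκ).add
    (integrable_Kint (p := p₁ + 1) (by linarith) hκ)).const_mul A).mono' ?_ ?_
  · have h1 : Continuous (fun ξ : ℝ => (g ξ).re) :=
      Complex.continuous_re.comp (h.diff.continuous.comp Complex.continuous_ofReal)
    have h2 : (fun ξ : ℝ => G (Real.exp ξ)) = fun ξ : ℝ => (g ξ).re := by
      ext ξ; rw [h.eq, Complex.ofReal_re]
    have h3 : Continuous (fun ξ : ℝ => G (Real.exp ξ)) := by rw [h2]; exact h1
    exact (Real.continuous_exp.mul h3).aestronglyMeasurable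
  · refine ae_of_all _ fun ξ => ?_
    rw [norm_mul, Real.norm_eq_abs, Real.norm_eq_abs, Real.abs_exp]
    exact h.abs_le ξ

lemma Ext.integrableOn (h : Ext g G p₀ p₁ κ A) (hp₀ : -1 < p₀) (hp : p₀ ≤ p₁) (hκ : 0 < κ) :
    IntegrableOn G (Ioi 0) := (integrableOn_Ioi_exp G).2 (h.integrable' hp₀ hp hκ)

lemma integrableOn_cos_mul {G : ℝ → ℝ} (h : IntegrableOn G (Ioi 0)) (x : ℝ) :
    IntegrableOn (fun τ => Real.cos (x * τ) * G τ) (Ioi 0) := by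
  refine Integrable.bdd_mul (c := 1) h ?_ ?_
  · exact (by fun_prop : Continuous _).aestronglyMeasurable
  · exact ae_of_all _ fun τ => by simpa using Real.abs_cos_le_one _

lemma Ext.FT_eq (h : Ext g G p₀ p₁ κ A) (hp₀ : -1 < p₀) (hp : p₀ ≤ p₁) (hκ : 0 < κ)
    {x : ℝ} (hx : 0 ≤ x) : FT G x = Real.pi⁻¹ * (rotI x g).re := by
  rw [← rot_eq g h.diff hp₀ (by linarith) hκ h.A_nonneg h.bound hx, FT]
  congr 1
  have hi : IntegrableOn (fun τ : ℝ => Complex.exp (Complex.I * x * τ) * g (Real.log τ)) (Ioi 0) := by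
    have : IntegrableOn (fun τ : ℝ => Complex.exp (Complex.I * x * τ) * (G τ : ℂ)) (Ioi 0) := by
      refine Integrable.bdd_mul (c := 1) (h.integrableOn hp₀ hp hκ).ofReal ?_ ?_
      · exact (by fun_prop : Continuous _).aestronglyMeasurable
      · refine ae_of_all _ fun τ => ?_
        simp [Complex.norm_exp]
    refine this.congr_fun (fun τ hτ => ?_) measurableSet_Ioi
    simp only [h.eq, Real.exp_log hτ]
  have h3 := integral_re hi
  simp only [RCLike.re_to_complex] at h3
  rw [← h3]
  refine setIntegral_congr_fun measurableSet_Ioi (fun τ hτ => ?_)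
  simp only [h.eq, Real.exp_log hτ]
  rw [show Complex.I * (x : ℂ) * τ = ((x * τ : ℝ) : ℂ) * Complex.I by push_cast; ring,
    Complex.exp_mul_I, ← Complex.ofReal_cos, ← Complex.ofReal_sin]
  simp [-Complex.ofReal_cos, -Complex.ofReal_sin]

def Kc (p₀ p₁ κ : ℝ) : ℝ := Real.pi⁻¹ * (Jint (p₀ + 1) + Jint (p₁ + 1) + Kint (p₀ + 1) κ
  + Kint (p₁ + 1) κ) * 2 ^ (1 + p₀)

lemma Kc_nonneg (p₀ p₁ κ : ℝ) : 0 ≤ Kc p₀ p₁ κ := by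
  have := Jint_nonneg (p₀ + 1)
  have := Jint_nonneg (p₁ + 1)
  have := Kint_nonneg (p₀ + 1) κ
  have := Kint_nonneg (p₁ + 1) κ
  have := Real.pi_pos
  unfold Kc; positivity

lemma Ext.FT_bound (h : Ext g G p₀ p₁ κ A) (hp₀ : -1 < p₀) (hp : p₀ ≤ p₁) (hκ : 0 < κ)
    (x : ℝ) : |FT G x| ≤ A * Kc p₀ p₁ κ * (1 + |x|) ^ (-1 - p₀) := by
  have j0 := Jint_nonneg (p₀ + 1)
  have j1 := Jint_nonneg (p₁ + 1)
  have k0 := Kint_nonneg (p₀ + 1) κ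
  have k1 := Kint_nonneg (p₁ + 1) κ
  have hpi := Real.pi_pos
  have hA := h.A_nonneg
  have e1 : (2 : ℝ) ^ (1 + p₀) * (2 : ℝ) ^ (-1 - p₀) = 1 := by
    rw [← Real.rpow_add two_pos]; simp
  rw [← FT_abs]
  have hx := abs_nonneg x
  generalize |x| = x at *
  rcases le_total x 1 with h1 | h1
  · have b1 : |FT G x| ≤ Real.pi⁻¹ * (A * (Kint (p₀ + 1) κ + Kint (p₁ + 1) κ)) := by
      rw [FT, abs_mul, abs_of_pos (by positivity : 0 < Real.pi⁻¹)]
      gcongr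
      have i0 := integrable_Kint (p := p₀ + 1) (κ := κ) (by linarith) hκ
      have i1 := integrable_Kint (p := p₁ + 1) (κ := κ) (by linarith) hκ
      have hGi := h.integrableOn hp₀ hp hκ
      calc _ ≤ ∫ τ in Ioi (0 : ℝ), |G τ| := by
            refine abs_integral_le_integral_abs.trans ?_
            refine integral_mono_ae (integrableOn_cos_mul hGi x).abs hGi.abs
              (ae_of_all _ fun τ => ?_)
            simp only [abs_mul]
            exact mul_le_of_le_one_left (abs_nonneg _) (Real.abs_cos_le_one _)
        _ = ∫ ξ : ℝ, Real.exp ξ * |G (Real.exp ξ)| := by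
            have := integral_image_eq_integral_abs_deriv_smul (s := univ) (f := Real.exp)
              (f' := Real.exp) MeasurableSet.univ
              (fun x _ => (Real.hasDerivAt_exp x).hasDerivWithinAt)
              Real.exp_injective.injOn (fun τ => |G τ|)
            rw [image_univ, Real.range_exp, setIntegral_univ] at this
            simpa [abs_of_pos (Real.exp_pos _)] using this
        _ ≤ ∫ ξ : ℝ, A * (Real.exp ((p₀ + 1) * ξ - κ * Real.exp (2 * ξ))
            + Real.exp ((p₁ + 1) * ξ - κ * Real.exp (2 * ξ))) := by
            refine integral_mono_of_nonneg (ae_of_all _ fun ξ => by positivity)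
              ((i0.add i1).const_mul A) (ae_of_all _ fun ξ => h.abs_le ξ)
        _ = _ := by
            rw [integral_const_mul, integral_add i0 i1]; rfl
    have b2 : (2 : ℝ) ^ (-1 - p₀) ≤ (1 + x) ^ (-1 - p₀) := by
      refine Real.rpow_le_rpow_of_nonpos (by linarith) (by linarith) (by linarith)
    calc _ ≤ _ := b1
      _ ≤ A * Kc p₀ p₁ κ * 2 ^ (-1 - p₀) := by
        have : A * Kc p₀ p₁ κ * 2 ^ (-1 - p₀) = Real.pi⁻¹ * (A * ((Jint (p₀ + 1) + Jint (p₁ + 1)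
          + Kint (p₀ + 1) κ + Kint (p₁ + 1) κ))) := by
          unfold Kc; linear_combination (Real.pi⁻¹ * (A * ((Jint (p₀ + 1) + Jint (p₁ + 1)
          + Kint (p₀ + 1) κ + Kint (p₁ + 1) κ)))) * e1
        rw [this]
        gcongr
        linarith
      _ ≤ _ := by
        have := Kc_nonneg p₀ p₁ κ
        gcongr
  · rw [h.FT_eq hp₀ hp hκ hx, abs_mul, abs_of_pos (by positivity : 0 < Real.pi⁻¹)]
    have b1 := rot_bound g hp₀ hp hA (A := A) (x := x) (fun ξ =>
      (h.bound ξ eta0 ⟨eta0_pos.le, le_rfl⟩).trans (by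
        refine mul_le_of_le_one_right (by positivity) ?_
        rw [Real.exp_le_one_iff]
        have := Real.exp_pos (2 * ξ)
        nlinarith)) h1
    have b2 : x ^ (-1 - p₀) ≤ 2 ^ (1 + p₀) * (1 + x) ^ (-1 - p₀) := by
      have : (2 * x) ^ (-1 - p₀) ≤ (1 + x) ^ (-1 - p₀) :=
        Real.rpow_le_rpow_of_nonpos (by linarith) (by linarith) (by linarith)
      rw [Real.mul_rpow (by norm_num) hx] at this
      calc x ^ (-1 - p₀) = 2 ^ (1 + p₀) * (2 ^ (-1 - p₀) * x ^ (-1 - p₀)) := by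
            rw [← mul_assoc, e1, one_mul]
        _ ≤ _ := by gcongr
    calc _ ≤ Real.pi⁻¹ * (A * (Jint (p₀ + 1) + Jint (p₁ + 1))
          * (2 ^ (1 + p₀) * (1 + x) ^ (-1 - p₀))) := by
          gcongr
          exact (Complex.abs_re_le_norm _).trans (b1.trans (by gcongr))
      _ ≤ Real.pi⁻¹ * (A * (Jint (p₀ + 1) + Jint (p₁ + 1) + Kint (p₀ + 1) κ
          + Kint (p₁ + 1) κ) * (2 ^ (1 + p₀) * (1 + x) ^ (-1 - p₀))) := by
          refine mul_le_mul_of_nonneg_left (mul_le_mul_of_nonneg_right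
            (mul_le_mul_of_nonneg_left ?_ hA) (by positivity)) (by positivity)
          linarith
      _ = _ := by unfold Kc; ring

end ExtSec

lemma rotI_integrable (g : ℂ → ℂ) (hgc : Continuous g) {p₀ p₁ A x : ℝ} (hp₀ : -1 < p₀)
    (hp : p₀ ≤ p₁)
    (hg : ∀ ξ : ℝ, ‖g (zc ξ eta0)‖ ≤ A * (Real.exp (p₀ * ξ) + Real.exp (p₁ * ξ))) (hx : 0 < x) :
    Integrable (fun ξ : ℝ => Complex.exp (zc ξ eta0)
      * Complex.exp (Complex.I * x * Complex.exp (zc ξ eta0)) * g (zc ξ eta0)) := by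
  have i0 := integrable_expexp (p := p₀ + 1) (κ := kap * x) (by linarith) (mul_pos kap_pos hx)
  have i1 := integrable_expexp (p := p₁ + 1) (κ := kap * x) (by linarith) (mul_pos kap_pos hx)
  refine ((i0.add i1).const_mul A).mono' ?_ (ae_of_all _ fun ξ => ?_)
  · exact (by fun_prop : Continuous _).aestronglyMeasurable
  rw [norm_mul, norm_mul, norm_exp_zc, norm_exp_I_mul]
  calc _ ≤ Real.exp ξ * Real.exp (-(x * (Real.exp ξ * Real.sin eta0)))
        * (A * (Real.exp (p₀ * ξ) + Real.exp (p₁ * ξ))) := by gcongr; exact hg ξ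
    _ = _ := by
      have e : ∀ p : ℝ, Real.exp ((p + 1) * ξ - kap * x * Real.exp ξ)
          = Real.exp ξ * Real.exp (-(x * (Real.exp ξ * Real.sin eta0))) * Real.exp (p * ξ) := by
        intro p
        rw [← Real.exp_add, ← Real.exp_add]
        congr 1
        simp only [kap]; ring
      simp only [Pi.add_apply]
      rw [e, e]; ring

end


section

/-! ### The specific integrands -/

lemma norm_exp_neg_sub_one_le {z : ℂ} (hz : 0 ≤ z.re) : ‖Complex.exp (-z) - 1‖ ≤ ‖z‖ := by
  have hconv : Convex ℝ {w : ℂ | 0 ≤ w.re} := convex_halfSpace_re_ge 0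
  have hd : ∀ w ∈ {w : ℂ | 0 ≤ w.re}, HasDerivWithinAt (fun w : ℂ => Complex.exp (-w))
      (Complex.exp (-w) * (-1)) {w : ℂ | 0 ≤ w.re} w := fun w _ =>
    ((hasDerivAt_id w).neg.cexp).hasDerivWithinAt
  have := hconv.norm_image_sub_le_of_norm_hasDerivWithin_le (C := 1) hd (fun w hw => by
    simp only [mem_ofPred_eq] at hw
    simpa [Complex.norm_exp] using hw) (x := 0) (y := z) (by simp) hz
  simpa using this

lemma norm_exp_neg_sub_one_add_le {z : ℂ} (hz : 0 ≤ z.re) :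
    ‖Complex.exp (-z) - 1 + z‖ ≤ ‖z‖ ^ 2 := by
  have hconv : Convex ℝ ({w : ℂ | 0 ≤ w.re} ∩ Metric.closedBall 0 ‖z‖) :=
    (convex_halfSpace_re_ge 0).inter (convex_closedBall _ _)
  have hd : ∀ w ∈ {w : ℂ | 0 ≤ w.re} ∩ Metric.closedBall 0 ‖z‖,
      HasDerivWithinAt (fun w : ℂ => Complex.exp (-w) - 1 + w)
      (Complex.exp (-w) * (-1) + 1) ({w : ℂ | 0 ≤ w.re} ∩ Metric.closedBall 0 ‖z‖) w := fun w _ =>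
    ((((hasDerivAt_id w).neg.cexp).sub_const 1).add (hasDerivAt_id w)).hasDerivWithinAt
  have := hconv.norm_image_sub_le_of_norm_hasDerivWithin_le (C := ‖z‖) hd (fun w hw => by
    have h1 := norm_exp_neg_sub_one_le hw.1
    have h2 : ‖w‖ ≤ ‖z‖ := by simpa using hw.2
    rw [← norm_neg]
    calc _ = ‖Complex.exp (-w) - 1‖ := by congr 1; ring
      _ ≤ _ := h1.trans h2) (x := 0) (y := z) (by simp) (by simpa using hz)
  simp only [neg_zero, Complex.exp_zero, sub_self, add_zero, sub_zero] at this
  rw [sq]; exact this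

lemma re_exp2 (ξ : ℝ) {y : ℝ} (hy : y ∈ Icc 0 eta0) :
    Real.exp (2 * ξ) / 2 ≤ (Complex.exp (2 * zc ξ y)).re := by
  have h := re_exp_mul_zc 2 ξ y
  push_cast at h
  rw [h]
  have : 1 / 2 ≤ Real.cos (2 * y) := by
    rw [← Real.cos_pi_div_three]
    refine Real.cos_le_cos_of_nonneg_of_le_pi (by linarith [hy.1]) (by linarith [Real.pi_pos]) ?_
    have := hy.2
    unfold eta0 at this
    linarith [Real.pi_pos]
  have := Real.exp_pos (2 * ξ)
  nlinarith

lemma re_expα {α : ℝ} (hα : α ∈ Ioo (0 : ℝ) 2) (ξ : ℝ) {y : ℝ} (hy : y ∈ Icc 0 eta0) :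
    0 ≤ (Complex.exp (α * zc ξ y)).re := by
  rw [re_exp_mul_zc]
  have : 0 ≤ Real.cos (α * y) := by
    have h1 : α * y ≤ 2 * eta0 := mul_le_mul hα.2.le hy.2 hy.1 (by norm_num)
    refine Real.cos_nonneg_of_mem_Icc ⟨?_, ?_⟩
    · have := mul_nonneg hα.1.le hy.1; linarith [Real.pi_pos]
    · unfold eta0 at h1; linarith [Real.pi_pos]
  positivity

def Gq (α v a : ℝ) (b : ℕ) (τ : ℝ) : ℝ :=
  τ ^ a * Real.log τ ^ b * Real.exp (-(τ ^ 2 / 2) - v * τ ^ α)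

def Wc (α v : ℝ) (ζ : ℂ) : ℂ :=
  Complex.exp (-(Complex.exp (2 * ζ) / 2)) * Complex.exp (-(v * Complex.exp (α * ζ)))

def gq (α v a : ℝ) (b : ℕ) (ζ : ℂ) : ℂ := glead a b ζ * Wc α v ζ

lemma gq_eq (α v a : ℝ) (b : ℕ) (ξ : ℝ) : gq α v a b ξ = (Gq α v a b (Real.exp ξ) : ℂ) := by
  have e1 : Real.exp ξ ^ a = Real.exp (a * ξ) := by
    rw [← Real.exp_mul]; congr 1; ring
  have e2 : Real.exp ξ ^ α = Real.exp (α * ξ) := by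
    rw [← Real.exp_mul]; congr 1; ring
  have e3 : Real.exp ξ ^ 2 = Real.exp (2 * ξ) := by
    rw [← Real.exp_nat_mul]; simp
  rw [gq, Gq, e1, e2, e3, Real.log_exp, glead, Wc, ← Complex.exp_add]
  push_cast
  congr 2

lemma diff_Wc (α v : ℝ) : Differentiable ℂ (Wc α v) := by unfold Wc; fun_prop

lemma diff_gq (α v a : ℝ) (b : ℕ) : Differentiable ℂ (gq α v a b) :=
  (differentiable_glead a b).mul (diff_Wc α v)

lemma norm_gaussc (ξ : ℝ) {y : ℝ} (hy : y ∈ Icc 0 eta0) :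
    ‖Complex.exp (-(Complex.exp (2 * zc ξ y) / 2))‖ ≤ Real.exp (-(1 / 4) * Real.exp (2 * ξ)) := by
  rw [Complex.norm_exp, Real.exp_le_exp]
  have := re_exp2 ξ hy
  have e : (-(Complex.exp (2 * zc ξ y) / 2)).re = -((Complex.exp (2 * zc ξ y)).re / 2) := by
    rw [Complex.neg_re, Complex.div_ofNat_re]
  rw [e]
  linarith

lemma norm_gaussc_le_one (ξ : ℝ) {y : ℝ} (hy : y ∈ Icc 0 eta0) :
    ‖Complex.exp (-(Complex.exp (2 * zc ξ y) / 2))‖ ≤ 1 := by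
  refine (norm_gaussc ξ hy).trans ?_
  rw [Real.exp_le_one_iff]
  have := Real.exp_pos (2 * ξ)
  linarith

lemma re_vexp {α v : ℝ} (hα : α ∈ Ioo (0 : ℝ) 2) (hv : 0 ≤ v) (ξ : ℝ) {y : ℝ}
    (hy : y ∈ Icc 0 eta0) : 0 ≤ ((v : ℂ) * Complex.exp (α * zc ξ y)).re := by
  rw [Complex.re_ofReal_mul]
  exact mul_nonneg hv (re_expα hα ξ hy)

lemma norm_stabc_le_one {α v : ℝ} (hα : α ∈ Ioo (0 : ℝ) 2) (hv : 0 ≤ v) (ξ : ℝ) {y : ℝ}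
    (hy : y ∈ Icc 0 eta0) : ‖Complex.exp (-(v * Complex.exp (α * zc ξ y)))‖ ≤ 1 := by
  rw [Complex.norm_exp, Real.exp_le_one_iff, Complex.neg_re]
  have := re_vexp hα hv ξ hy
  linarith

lemma norm_vexp {α v : ℝ} (hv : 0 ≤ v) (ξ y : ℝ) :
    ‖(v : ℂ) * Complex.exp (α * zc ξ y)‖ = v * Real.exp (α * ξ) := by
  rw [norm_mul, norm_exp_mul_zc, Complex.norm_real, Real.norm_of_nonneg hv]

lemma eta0_Icc {y : ℝ} (hy : y ∈ Icc 0 eta0) : y ∈ Icc (0 : ℝ) 2 :=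
  ⟨hy.1, hy.2.trans (by linarith [eta0_lt])⟩

lemma ext_gq {α : ℝ} (hα : α ∈ Ioo (0 : ℝ) 2) (a : ℝ) (b : ℕ) {ε : ℝ} (hε : 0 < ε) :
    ∃ A : ℝ, 0 < A ∧ ∀ v : ℝ, 0 ≤ v →
      Ext (gq α v a b) (Gq α v a b) (a - ε) (a + ε) (1 / 4) A := by
  obtain ⟨A, hA, h⟩ := glead_bound (α := a) b hε
  refine ⟨A, hA, fun v hv => ⟨diff_gq α v a b, gq_eq α v a b, fun ξ y hy => ?_⟩⟩
  rw [gq, Wc, norm_mul, norm_mul]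
  calc _ ≤ (A * (Real.exp ((a - ε) * ξ) + Real.exp ((a + ε) * ξ))) *
        (Real.exp (-(1 / 4) * Real.exp (2 * ξ)) * 1) := by
        gcongr
        · exact h ξ y (eta0_Icc hy)
        · exact norm_gaussc ξ hy
        · exact norm_stabc_le_one hα hv ξ hy
    _ = _ := by ring

lemma ext_diff {α : ℝ} (hα : α ∈ Ioo (0 : ℝ) 2) (a : ℝ) {v : ℝ} (hv : 0 ≤ v) :
      Ext (fun ζ => gq α v a 0 ζ - gq α 0 a 0 ζ) (fun τ => Gq α v a 0 τ - Gq α 0 a 0 τ)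
        (a + α) (a + α) (1 / 4) v := by
  refine ⟨(diff_gq α v a 0).sub (diff_gq α 0 a 0), fun ξ => ?_, fun ξ y hy => ?_⟩
  · rw [gq_eq, gq_eq]; push_cast; rfl
  · have e : gq α v a 0 (zc ξ y) - gq α 0 a 0 (zc ξ y) = Complex.exp (a * zc ξ y)
      * Complex.exp (-(Complex.exp (2 * zc ξ y) / 2))
      * (Complex.exp (-(v * Complex.exp (α * zc ξ y))) - 1) := by
      simp only [gq, Wc, glead]; simp; ring
    rw [e, norm_mul, norm_mul, norm_exp_mul_zc]
    have e2 : Real.exp ((a + α) * ξ) = Real.exp (a * ξ) * Real.exp (α * ξ) := by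
      rw [← Real.exp_add]; congr 1; ring
    calc _ ≤ Real.exp (a * ξ) * Real.exp (-(1 / 4) * Real.exp (2 * ξ))
          * (v * Real.exp (α * ξ)) := by
          gcongr
          · exact norm_gaussc ξ hy
          · rw [← norm_vexp hv ξ y]
            exact norm_exp_neg_sub_one_le (re_vexp hα hv ξ hy)
      _ ≤ _ := by
        rw [e2]
        have : 0 ≤ v * (Real.exp (a * ξ) * Real.exp (α * ξ))
          * Real.exp (-(1 / 4) * Real.exp (2 * ξ)) := by positivity
        nlinarith

/-- The transforms. -/
def T (α v a : ℝ) (b : ℕ) (x : ℝ) : ℝ := FT (Gq α v a b) x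

def om (α x : ℝ) : ℝ := (1 + |x|) ^ (-1 - 7 * α / 8)

lemma om_pos (α x : ℝ) : 0 < om α x := by unfold om; positivity

lemma om_ge {α x p : ℝ} (hp : 7 * α / 8 ≤ p) : (1 + |x|) ^ (-1 - p) ≤ om α x :=
  Real.rpow_le_rpow_of_exponent_le (by linarith [abs_nonneg x]) (by linarith)

lemma Gq_integrableOn {α : ℝ} (hα : α ∈ Ioo (0 : ℝ) 2) {a : ℝ} (ha : 0 ≤ a) (b : ℕ) {v : ℝ}
    (hv : 0 ≤ v) : IntegrableOn (Gq α v a b) (Ioi 0) := by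
  obtain ⟨A, hA, h⟩ := ext_gq hα a b (ε := 1 / 2) (by norm_num)
  exact (h v hv).integrableOn (by linarith) (by linarith) (by norm_num)

lemma T_bound {α : ℝ} (hα : α ∈ Ioo (0 : ℝ) 2) {a : ℝ} (ha : α ≤ a) (b : ℕ) :
    ∃ C : ℝ, 0 < C ∧ ∀ v : ℝ, 0 ≤ v → ∀ x, |T α v a b x| ≤ C * om α x := by
  obtain ⟨A, hA, h⟩ := ext_gq hα a b (ε := α / 8) (by linarith [hα.1])
  refine ⟨A * Kc (a - α / 8) (a + α / 8) (1 / 4) + 1,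
    by have := Kc_nonneg (a - α / 8) (a + α / 8) (1 / 4); positivity, fun v hv x => ?_⟩
  have h1 := (h v hv).FT_bound (by linarith [hα.1]) (by linarith [hα.1]) (by norm_num) x
  have h2 := om_ge (α := α) (x := x) (p := a - α / 8) (by linarith)
  have h3 := om_pos α x
  have := Kc_nonneg (a - α / 8) (a + α / 8) (1 / 4)
  calc _ ≤ _ := h1
    _ ≤ A * Kc (a - α / 8) (a + α / 8) (1 / 4) * om α x := by gcongr
    _ ≤ _ := by nlinarith

lemma FT_sub {G H : ℝ → ℝ} (hG : IntegrableOn G (Ioi 0)) (hH : IntegrableOn H (Ioi 0)) (x : ℝ) :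
    FT (fun τ => G τ - H τ) x = FT G x - FT H x := by
  unfold FT
  rw [← mul_sub, ← integral_sub (integrableOn_cos_mul hG x) (integrableOn_cos_mul hH x)]
  congr 2; ext τ; ring

lemma FT_add {G H : ℝ → ℝ} (hG : IntegrableOn G (Ioi 0)) (hH : IntegrableOn H (Ioi 0)) (x : ℝ) :
    FT (fun τ => G τ + H τ) x = FT G x + FT H x := by
  unfold FT
  rw [← mul_add, ← integral_add (integrableOn_cos_mul hG x) (integrableOn_cos_mul hH x)]
  congr 2; ext τ; ring

lemma FT_const_mul (c : ℝ) (G : ℝ → ℝ) (x : ℝ) : FT (fun τ => c * G τ) x = c * FT G x := by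
  unfold FT
  rw [mul_left_comm, ← integral_const_mul c]
  congr 1
  refine integral_congr_ae (ae_of_all _ fun τ => ?_)
  simp only; ring

lemma T_diff_bound {α : ℝ} (hα : α ∈ Ioo (0 : ℝ) 2) {a : ℝ} (ha : 0 ≤ a) :
    ∃ C : ℝ, 0 < C ∧ ∀ v : ℝ, 0 ≤ v → ∀ x,
      |T α v a 0 x - T α 0 a 0 x| ≤ C * v * om α x := by
  refine ⟨Kc (a + α) (a + α) (1 / 4) + 1,
    by have := Kc_nonneg (a + α) (a + α) (1 / 4); positivity, fun v hv x => ?_⟩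
  have hα1 := hα.1
  have h1 := (ext_diff hα a hv).FT_bound (by linarith) (by linarith) (by norm_num) x
  rw [FT_sub (Gq_integrableOn hα ha 0 hv) (Gq_integrableOn hα ha 0 le_rfl)] at h1
  have h2 := om_ge (α := α) (x := x) (p := a + α) (by linarith)
  have h3 := om_pos α x
  have := Kc_nonneg (a + α) (a + α) (1 / 4)
  calc _ ≤ _ := h1
    _ ≤ v * Kc (a + α) (a + α) (1 / 4) * om α x := by gcongr
    _ ≤ _ := by nlinarith [mul_nonneg hv h3.le]

lemma exp_between {p q r : ℝ} (h1 : p ≤ q) (h2 : q ≤ r) (ξ : ℝ) :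
    Real.exp (q * ξ) ≤ Real.exp (p * ξ) + Real.exp (r * ξ) := by
  rcases le_total 0 ξ with h | h
  · have : Real.exp (q * ξ) ≤ Real.exp (r * ξ) := by gcongr
    linarith [Real.exp_pos (p * ξ)]
  · have : Real.exp (q * ξ) ≤ Real.exp (p * ξ) := by
      rw [Real.exp_le_exp]; nlinarith
    linarith [Real.exp_pos (r * ξ)]

lemma eta0_mem : eta0 ∈ Icc 0 eta0 := ⟨eta0_pos.le, le_rfl⟩

/-- the rotated integrals of `gq` vs. the leading term -/
lemma lead_error {α : ℝ} (hα : α ∈ Ioo (0 : ℝ) 2) (b : ℕ) :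
    ∃ C : ℝ, 0 < C ∧ ∀ v : ℝ, 0 ≤ v → v ≤ 1 → ∀ x : ℝ, 1 ≤ x →
      |T α v α b x - Real.pi⁻¹ * (rotI x (glead α b)).re| ≤ C * x ^ (-1 - 3 * α / 2) := by
  have hα1 := hα.1
  have hα2 := hα.2
  obtain ⟨A, hA, h⟩ := glead_bound (α := α) b (half_pos hα.1)
  have hpi := Real.pi_pos
  set p₀ := 3 * α / 2 with hp₀
  set p₁ := 2 + 3 * α / 2 with hp₁
  have hJ0 := Jint_nonneg (p₀ + 1)
  have hJ1 := Jint_nonneg (p₁ + 1)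
  refine ⟨Real.pi⁻¹ * (A * 4 * (Jint (p₀ + 1) + Jint (p₁ + 1))) + 1, by positivity,
    fun v hv hv1 x hx => ?_⟩
  have hx0 : 0 < x := by linarith
  obtain ⟨A', hA', hE⟩ := ext_gq hα α b (half_pos hα.1)
  rw [T, (hE v hv).FT_eq (by linarith) (by linarith) (by norm_num) hx0.le]
  have i1 := rotI_integrable (gq α v α b) (diff_gq α v α b).continuous (p₀ := α - α / 2)
    (p₁ := α + α / 2) (A := A') (x := x) (by linarith) (by linarith) (fun ξ =>
      ((hE v hv).bound ξ eta0 eta0_mem).trans (by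
        refine mul_le_of_le_one_right (by positivity) ?_
        rw [Real.exp_le_one_iff]
        have := Real.exp_pos (2 * ξ)
        linarith)) hx0
  have i2 := rotI_integrable (glead α b) (differentiable_glead α b).continuous (p₀ := α - α / 2)
    (p₁ := α + α / 2) (A := A) (x := x) (by linarith) (by linarith) (fun ξ =>
      h ξ eta0 (eta0_Icc eta0_mem)) hx0
  have e : rotI x (gq α v α b) - rotI x (glead α b)
      = rotI x (fun ζ => gq α v α b ζ - glead α b ζ) := by
    rw [rotI, rotI, rotI, ← integral_sub i1 i2]
    congr 1; ext ξ; ring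
  rw [← mul_sub, ← Complex.sub_re, e, abs_mul, abs_of_pos (by positivity : 0 < Real.pi⁻¹)]
  have hb := rot_bound (fun ζ => gq α v α b ζ - glead α b ζ) (p₀ := p₀) (p₁ := p₁) (A := A * 4)
    (x := x) (by linarith) (by linarith) (by positivity) (fun ξ => by
      have e1 : gq α v α b (zc ξ eta0) - glead α b (zc ξ eta0)
        = glead α b (zc ξ eta0) * (Complex.exp (-(Complex.exp (2 * zc ξ eta0) / 2)
          + -(v * Complex.exp (α * zc ξ eta0))) - 1) := by
        rw [gq, Wc, ← Complex.exp_add]; ring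
      rw [e1, norm_mul]
      have r1 : ‖Complex.exp (-(Complex.exp (2 * zc ξ eta0) / 2)
          + -(v * Complex.exp (α * zc ξ eta0))) - 1‖ ≤ Real.exp (2 * ξ) + Real.exp (α * ξ) := by
        rw [← neg_add]
        refine (norm_exp_neg_sub_one_le ?_).trans ?_
        · rw [Complex.add_re, Complex.div_ofNat_re]
          have := re_vexp hα hv ξ eta0_mem
          have := re_exp2 ξ eta0_mem
          have := Real.exp_pos (2 * ξ)
          linarith
        · refine (norm_add_le _ _).trans ?_
          rw [norm_vexp hv, norm_div]
          have := norm_exp_mul_zc 2 ξ eta0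
          push_cast at this
          rw [this]
          have := Real.exp_pos (2 * ξ)
          have := Real.exp_pos (α * ξ)
          have : v * Real.exp (α * ξ) ≤ Real.exp (α * ξ) := by nlinarith
          have : ‖(2 : ℂ)‖ = 2 := by simp
          rw [this]
          linarith
      have r2 := h ξ eta0 (eta0_Icc eta0_mem)
      have ee : ∀ p q : ℝ, Real.exp (p * ξ) * Real.exp (q * ξ) = Real.exp ((p + q) * ξ) := by
        intro p q; rw [← Real.exp_add]; congr 1; ring
      calc _ ≤ A * (Real.exp ((α - α / 2) * ξ) + Real.exp ((α + α / 2) * ξ))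
            * (Real.exp (2 * ξ) + Real.exp (α * ξ)) := by gcongr
        _ = A * (Real.exp ((α - α / 2 + 2) * ξ) + Real.exp ((α - α / 2 + α) * ξ)
            + Real.exp ((α + α / 2 + 2) * ξ) + Real.exp ((α + α / 2 + α) * ξ)) := by
            rw [← ee (α - α / 2) 2, ← ee (α - α / 2) α, ← ee (α + α / 2) 2, ← ee (α + α / 2) α]; ring
        _ ≤ A * ((Real.exp (p₀ * ξ) + Real.exp (p₁ * ξ)) + (Real.exp (p₀ * ξ) + Real.exp (p₁ * ξ))
            + (Real.exp (p₀ * ξ) + Real.exp (p₁ * ξ))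
            + (Real.exp (p₀ * ξ) + Real.exp (p₁ * ξ))) := by
            refine mul_le_mul_of_nonneg_left (add_le_add (add_le_add (add_le_add ?_ ?_) ?_) ?_) hA.le <;>
            exact exp_between (by linarith) (by linarith) ξ
        _ = _ := by ring) hx
  have hxp : 0 < x ^ (-1 - p₀) := by positivity
  calc _ ≤ Real.pi⁻¹ * (A * 4 * (Jint (p₀ + 1) + Jint (p₁ + 1)) * x ^ (-1 - p₀)) := by
        gcongr
        exact (Complex.abs_re_le_norm _).trans hb
    _ ≤ _ := by nlinarith

lemma f_error {α : ℝ} (hα : α ∈ Ioo (0 : ℝ) 2) :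
    ∃ C : ℝ, 0 < C ∧ ∀ v : ℝ, 0 ≤ v → v ≤ 1 → ∀ x : ℝ, 1 ≤ x →
      |T α v 0 0 x - T α 0 0 0 x + v * (Real.pi⁻¹ * (rotI x (glead α 0)).re)|
        ≤ C * v * x ^ (-1 - 3 * α / 2) := by
  have hα1 := hα.1
  have hα2 := hα.2
  have hpi := Real.pi_pos
  set p₀ := 3 * α / 2 with hp₀
  set p₁ := 2 + 3 * α / 2 with hp₁
  have hJ0 := Jint_nonneg (p₀ + 1)
  have hJ1 := Jint_nonneg (p₁ + 1)
  refine ⟨Real.pi⁻¹ * (2 * (Jint (p₀ + 1) + Jint (p₁ + 1))) + 1, by positivity,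
    fun v hv hv1 x hx => ?_⟩
  have hx0 : 0 < x := by linarith
  have hE := ext_diff hα 0 hv
  have := hE.FT_eq (by linarith) (by linarith) (by norm_num) hx0.le
  rw [FT_sub (Gq_integrableOn hα le_rfl 0 hv) (Gq_integrableOn hα le_rfl 0 le_rfl)] at this
  rw [T, T, this]
  have i1 := rotI_integrable (fun ζ => gq α v 0 0 ζ - gq α 0 0 0 ζ) hE.diff.continuous
    (p₀ := 0 + α) (p₁ := 0 + α) (A := v) (x := x) (by linarith) (by linarith) (fun ξ =>
      (hE.bound ξ eta0 eta0_mem).trans (by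
        refine mul_le_of_le_one_right (by positivity) ?_
        rw [Real.exp_le_one_iff]
        have := Real.exp_pos (2 * ξ)
        linarith)) hx0
  obtain ⟨A, hA, h⟩ := glead_bound (α := α) 0 (half_pos hα.1)
  have i2 := rotI_integrable (glead α 0) (differentiable_glead α 0).continuous (p₀ := α - α / 2)
    (p₁ := α + α / 2) (A := A) (x := x) (by linarith) (by linarith) (fun ξ =>
      h ξ eta0 (eta0_Icc eta0_mem)) hx0
  have e : rotI x (fun ζ => gq α v 0 0 ζ - gq α 0 0 0 ζ) + v * rotI x (glead α 0)
      = rotI x (fun ζ => gq α v 0 0 ζ - gq α 0 0 0 ζ + v * glead α 0 ζ) := by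
    rw [rotI, rotI, rotI, ← integral_const_mul, ← integral_add i1 (i2.const_mul _)]
    congr 1; ext ξ; ring
  have e' : Real.pi⁻¹ * (rotI x (fun ζ => gq α v 0 0 ζ - gq α 0 0 0 ζ)).re
      + v * (Real.pi⁻¹ * (rotI x (glead α 0)).re)
      = Real.pi⁻¹ * (rotI x (fun ζ => gq α v 0 0 ζ - gq α 0 0 0 ζ + v * glead α 0 ζ)).re := by
    rw [← e, Complex.add_re, Complex.re_ofReal_mul]; ring
  rw [e', abs_mul, abs_of_pos (by positivity : 0 < Real.pi⁻¹)]
  have hb := rot_bound (fun ζ => gq α v 0 0 ζ - gq α 0 0 0 ζ + v * glead α 0 ζ) (p₀ := p₀)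
    (p₁ := p₁) (A := v * 2)
    (x := x) (by linarith) (by linarith) (by positivity) (fun ξ => by
      have e1 : gq α v 0 0 (zc ξ eta0) - gq α 0 0 0 (zc ξ eta0) + v * glead α 0 (zc ξ eta0)
        = Complex.exp (-(Complex.exp (2 * zc ξ eta0) / 2))
          * (Complex.exp (-(v * Complex.exp (α * zc ξ eta0))) - 1
            + v * Complex.exp (α * zc ξ eta0))
          - (Complex.exp (-(Complex.exp (2 * zc ξ eta0) / 2)) - 1)
            * (v * Complex.exp (α * zc ξ eta0)) := by
        simp only [gq, Wc, glead]; simp; ring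
      rw [e1]
      have ee : ∀ p q : ℝ, Real.exp (p * ξ) * Real.exp (q * ξ) = Real.exp ((p + q) * ξ) := by
        intro p q; rw [← Real.exp_add]; congr 1; ring
      have r2 : ‖Complex.exp (-(Complex.exp (2 * zc ξ eta0) / 2)) - 1‖ ≤ Real.exp (2 * ξ) := by
        refine (norm_exp_neg_sub_one_le ?_).trans ?_
        · rw [Complex.div_ofNat_re]
          have := re_exp2 ξ eta0_mem
          have := Real.exp_pos (2 * ξ)
          linarith
        · rw [norm_div]
          have := norm_exp_mul_zc 2 ξ eta0
          push_cast at this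
          rw [this]
          have := Real.exp_pos (2 * ξ)
          have : ‖(2 : ℂ)‖ = 2 := by simp
          rw [this]
          linarith
      calc _ ≤ 1 * (v * Real.exp (α * ξ)) ^ 2 + Real.exp (2 * ξ) * (v * Real.exp (α * ξ)) := by
            refine (norm_sub_le _ _).trans ?_
            rw [norm_mul, norm_mul, norm_vexp hv]
            gcongr
            · exact norm_gaussc_le_one ξ eta0_mem
            · rw [← norm_vexp hv ξ eta0]
              exact norm_exp_neg_sub_one_add_le (re_vexp hα hv ξ eta0_mem)
        _ = v ^ 2 * Real.exp ((α + α) * ξ) + v * Real.exp ((2 + α) * ξ) := by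
            rw [← ee, ← ee]; ring
        _ ≤ v * (Real.exp (p₀ * ξ) + Real.exp (p₁ * ξ))
            + v * (Real.exp (p₀ * ξ) + Real.exp (p₁ * ξ)) := by
            gcongr
            · nlinarith
            · exact exp_between (by linarith) (by linarith) ξ
            · exact exp_between (by linarith) (by linarith) ξ
        _ = _ := by ring) hx
  have hxp : 0 < x ^ (-1 - p₀) := by positivity
  calc _ ≤ Real.pi⁻¹ * (v * 2 * (Jint (p₀ + 1) + Jint (p₁ + 1)) * x ^ (-1 - p₀)) := by
        gcongr
        exact (Complex.abs_re_le_norm _).trans hb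
    _ ≤ _ := by
      have := mul_nonneg hv hxp.le
      nlinarith

end


section

/-! ### Gaussian transforms -/

lemma hda {f g : ℝ → ℝ} {f' g' x : ℝ} (h : HasDerivAt f f' x) (hf : ∀ t, g t = f t)
    (hd : g' = f') : HasDerivAt g g' x := by
  have : g = f := funext hf
  rw [this, hd]; exact h

lemma gauss_int_pow (k : ℕ) {b : ℝ} (hb : 0 < b) :
    IntegrableOn (fun τ : ℝ => τ ^ k * Real.exp (-b * τ ^ 2)) (Ioi 0) := by
  have := integrableOn_rpow_mul_exp_neg_mul_sq hb (s := (k : ℝ)) (by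
    have : (0 : ℝ) ≤ k := by positivity
    linarith)
  simpa using this

lemma gauss_deriv (x : ℝ) (k : ℕ) {b : ℝ} (hb : 0 < b) :
    HasDerivAt (fun b : ℝ => ∫ τ in Ioi (0 : ℝ), Real.cos (x * τ) * (τ ^ k * Real.exp (-b * τ ^ 2)))
      (-∫ τ in Ioi (0 : ℝ), Real.cos (x * τ) * (τ ^ (k + 2) * Real.exp (-b * τ ^ 2))) b := by
  rw [← integral_neg]
  refine (hasDerivAt_integral_of_dominated_loc_of_deriv_le
    (F := fun b τ => Real.cos (x * τ) * (τ ^ k * Real.exp (-b * τ ^ 2)))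
    (F' := fun b τ => -(Real.cos (x * τ) * (τ ^ (k + 2) * Real.exp (-b * τ ^ 2))))
    (bound := fun τ => τ ^ (k + 2) * Real.exp (-(b / 2) * τ ^ 2))
    (Ioi_mem_nhds (half_lt_self hb)) ?_ ?_ ?_ ?_ ?_ ?_).2
  · exact Eventually.of_forall fun b => (by fun_prop : Continuous _).aestronglyMeasurable
  · exact integrableOn_cos_mul (gauss_int_pow k hb) x
  · exact (by fun_prop : Continuous _).aestronglyMeasurable
  · refine (ae_restrict_iff' measurableSet_Ioi).2 (ae_of_all _ fun τ hτ b' hb' => ?_)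
    simp only [mem_Ioi] at hτ hb'
    rw [norm_neg, norm_mul, norm_mul, norm_pow, Real.norm_of_nonneg hτ.le,
      Real.norm_of_nonneg (Real.exp_pos _).le]
    refine (mul_le_of_le_one_left (by positivity) (Real.abs_cos_le_one _)).trans ?_
    gcongr
  · exact gauss_int_pow (k + 2) (half_pos hb)
  · refine ae_of_all _ fun τ b' _ => ?_
    have h1 : HasDerivAt (fun b : ℝ => Real.exp (-b * τ ^ 2))
        (Real.exp (-b' * τ ^ 2) * (-1 * τ ^ 2)) b' :=
      (((hasDerivAt_id b').neg).mul_const (τ ^ 2)).exp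
    have h2 := (h1.const_mul (τ ^ k)).const_mul (Real.cos (x * τ))
    exact hda h2 (fun _ => rfl) (by ring)

lemma gauss_base (x : ℝ) {b : ℝ} (hb : 0 < b) :
    ∫ τ in Ioi (0 : ℝ), Real.cos (x * τ) * (τ ^ 0 * Real.exp (-b * τ ^ 2))
      = Real.sqrt (Real.pi / b) / 2 * Real.exp (-x ^ 2 / (4 * b)) := by
  have h1 := fourierIntegral_gaussian (b := (b : ℂ)) (by simpa using hb) (x : ℂ)
  have hint : Integrable (fun τ : ℝ => Complex.exp (Complex.I * x * τ) * Complex.exp (-b * (τ : ℂ) ^ 2)) := by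
    refine Integrable.bdd_mul (c := 1) ?_ ?_ ?_
    · have := (integrable_exp_neg_mul_sq hb).ofReal (𝕜 := ℂ)
      refine this.congr (ae_of_all _ fun τ => ?_)
      simp
    · exact (by fun_prop : Continuous _).aestronglyMeasurable
    · refine ae_of_all _ fun τ => ?_
      simp [Complex.norm_exp]
  have h3 := integral_re hint
  simp only [RCLike.re_to_complex] at h3
  rw [h1] at h3
  have e1 : ((Real.pi / (b : ℂ)) ^ (1 / 2 : ℂ) * Complex.exp (-(x : ℂ) ^ 2 / (4 * b))).re
      = Real.sqrt (Real.pi / b) * Real.exp (-x ^ 2 / (4 * b)) := by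
    have : ((Real.pi : ℂ) / (b : ℂ)) ^ (1 / 2 : ℂ) = ((Real.sqrt (Real.pi / b) : ℝ) : ℂ) := by
      rw [Real.sqrt_eq_rpow, Complex.ofReal_cpow (by positivity)]
      push_cast; rfl
    rw [this, Complex.re_ofReal_mul]
    congr 1
    rw [← Complex.ofReal_re (Real.exp _)]
    push_cast; rfl
  have e2 : ∀ τ : ℝ, (Complex.exp (Complex.I * x * τ) * Complex.exp (-b * (τ : ℂ) ^ 2)).re
      = (fun τ => Real.cos (x * τ) * Real.exp (-b * τ ^ 2)) |τ| := by
    intro τ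
    rw [show Complex.I * (x : ℂ) * τ = ((x * τ : ℝ) : ℂ) * Complex.I by push_cast; ring,
      Complex.exp_mul_I, ← Complex.ofReal_cos, ← Complex.ofReal_sin,
      show (-(b : ℂ) * (τ : ℂ) ^ 2) = ((-b * τ ^ 2 : ℝ) : ℂ) by push_cast; ring,
      ← Complex.ofReal_exp, mul_comm, Complex.re_ofReal_mul]
    have : Real.cos (x * |τ|) = Real.cos (x * τ) := by
      rcases abs_choice τ with h | h <;> rw [h]
      rw [mul_neg, Real.cos_neg]
    simp only [sq_abs, this]
    simp [-Complex.ofReal_cos, -Complex.ofReal_sin, mul_comm]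
  rw [e1] at h3
  simp_rw [e2] at h3
  rw [integral_comp_abs (f := fun τ => Real.cos (x * τ) * Real.exp (-b * τ ^ 2))] at h3
  simp only [pow_zero, one_mul]
  linarith

lemma gauss_H_deriv (x : ℝ) {b : ℝ} (hb : 0 < b) :
    HasDerivAt (fun b : ℝ => Real.sqrt (Real.pi / b) / 2 * Real.exp (-x ^ 2 / (4 * b)))
      (Real.sqrt (Real.pi / b) / 2 * Real.exp (-x ^ 2 / (4 * b)) *
        (-1 / (2 * b) + x ^ 2 / (4 * b ^ 2))) b := by
  have hpi := Real.pi_pos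
  have h1 : HasDerivAt (fun b : ℝ => Real.pi / b) (-Real.pi / b ^ 2) b := by
    have := (hasDerivAt_inv hb.ne').const_mul Real.pi
    exact hda this (fun t => by ring) (by ring)
  have hs : 0 < Real.sqrt (Real.pi / b) := Real.sqrt_pos.2 (by positivity)
  have h2 := (h1.sqrt (by positivity)).div_const 2
  have h3 : HasDerivAt (fun b : ℝ => -x ^ 2 / (4 * b)) (x ^ 2 / (4 * b ^ 2)) b := by
    have := (hasDerivAt_inv hb.ne').const_mul (-x ^ 2 / 4)
    exact hda this (fun t => by ring) (by ring)
  refine hda (h2.mul h3.exp) (fun t => rfl) ?_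
  have hs2 : Real.sqrt (Real.pi / b) ^ 2 = Real.pi / b := Real.sq_sqrt (by positivity)
  have : -Real.pi / b ^ 2 / (2 * Real.sqrt (Real.pi / b)) = Real.sqrt (Real.pi / b) * (-1 / (2 * b)) := by
    rw [div_eq_iff (by positivity)]
    have : Real.sqrt (Real.pi / b) * (-1 / (2 * b)) * (2 * Real.sqrt (Real.pi / b))
      = Real.sqrt (Real.pi / b) ^ 2 * (-1 / b) := by field_simp
    rw [this, hs2]; field_simp
  rw [this]; ring

lemma gauss_one (x : ℝ) {b : ℝ} (hb : 0 < b) :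
    ∫ τ in Ioi (0 : ℝ), Real.cos (x * τ) * (τ ^ 2 * Real.exp (-b * τ ^ 2))
      = Real.sqrt (Real.pi / b) / 2 * Real.exp (-x ^ 2 / (4 * b)) *
        (1 / (2 * b) - x ^ 2 / (4 * b ^ 2)) := by
  have h1 := gauss_deriv x 0 hb
  have h2 := (gauss_H_deriv x hb).congr_of_eventuallyEq
    (f₁ := fun b : ℝ => ∫ τ in Ioi (0 : ℝ), Real.cos (x * τ) * (τ ^ 0 * Real.exp (-b * τ ^ 2))) (by
    filter_upwards [Ioi_mem_nhds hb] with b' hb' using gauss_base x hb')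
  have := h1.unique h2
  simp only [zero_add] at this
  linear_combination -this

lemma gauss_two (x : ℝ) {b : ℝ} (hb : 0 < b) :
    ∫ τ in Ioi (0 : ℝ), Real.cos (x * τ) * (τ ^ 4 * Real.exp (-b * τ ^ 2))
      = Real.sqrt (Real.pi / b) / 2 * Real.exp (-x ^ 2 / (4 * b)) *
        ((1 / (2 * b) - x ^ 2 / (4 * b ^ 2)) ^ 2 + 1 / (2 * b ^ 2) - x ^ 2 / (2 * b ^ 3)) := by
  have h1 := gauss_deriv x 2 hb
  have h3 : HasDerivAt (fun b : ℝ => 1 / (2 * b) - x ^ 2 / (4 * b ^ 2))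
      (- 1 / (2 * b ^ 2) + x ^ 2 / (2 * b ^ 3)) b := by
    have a1 := (hasDerivAt_inv hb.ne').const_mul (1 / 2)
    have a2 := (((hasDerivAt_id b).pow 2).inv (by simpa using hb.ne')).const_mul (x ^ 2 / 4)
    have a3 := a1.sub a2
    refine hda a3 (fun t => ?_) ?_
    · simp; ring
    · simp; field_simp; ring
  have h2 := ((gauss_H_deriv x hb).mul h3).congr_of_eventuallyEq
    (f₁ := fun b : ℝ => ∫ τ in Ioi (0 : ℝ), Real.cos (x * τ) * (τ ^ 2 * Real.exp (-b * τ ^ 2))) (by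
    filter_upwards [Ioi_mem_nhds hb] with b' hb' using gauss_one x hb')
  have := h1.unique h2
  simp only [Nat.reduceAdd] at this
  linear_combination -this

lemma gauss_pos (x : ℝ) : 0 < gauss x := by
  have := Real.pi_pos
  unfold gauss; positivity

lemma T_zero_aux (α : ℝ) (k : ℕ) (x : ℝ) : T α 0 k 0 x = Real.pi⁻¹ *
    ∫ τ in Ioi (0 : ℝ), Real.cos (x * τ) * (τ ^ k * Real.exp (-(1 / 2) * τ ^ 2)) := by
  unfold T FT Gq
  congr 1
  refine integral_congr_ae (ae_of_all _ fun τ => ?_)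
  simp only [pow_zero, mul_one, zero_mul, sub_zero, Real.rpow_natCast]
  congr 3; ring

lemma gauss_norm (x : ℝ) : Real.pi⁻¹ * (Real.sqrt (Real.pi / (1 / 2)) / 2
    * Real.exp (-x ^ 2 / (4 * (1 / 2)))) = gauss x := by
  have hpi := Real.pi_pos
  rw [gauss]
  have e1 : Real.pi / (1 / 2) = 2 * Real.pi := by ring
  have hs : 0 < Real.sqrt (2 * Real.pi) := Real.sqrt_pos.2 (by positivity)
  have hs2 : Real.sqrt (2 * Real.pi) ^ 2 = 2 * Real.pi := Real.sq_sqrt (by positivity)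
  rw [e1, show -x ^ 2 / (4 * (1 / 2)) = -x ^ 2 / 2 by ring]
  generalize Real.sqrt (2 * Real.pi) = S at *
  field_simp
  linarith

lemma T_zero0 (α x : ℝ) : T α 0 0 0 x = gauss x := by
  have := T_zero_aux α 0 x
  simp only [Nat.cast_zero] at this
  rw [this, gauss_base x (by norm_num), gauss_norm]

lemma T_zero2 (α x : ℝ) : T α 0 2 0 x = (1 - x ^ 2) * gauss x := by
  have := T_zero_aux α 2 x
  simp only [Nat.cast_ofNat] at this
  rw [this, gauss_one x (by norm_num), ← gauss_norm]; ring

lemma T_zero4 (α x : ℝ) : T α 0 4 0 x = (x ^ 4 - 6 * x ^ 2 + 3) * gauss x := by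
  have := T_zero_aux α 4 x
  simp only [Nat.cast_ofNat] at this
  rw [this, gauss_two x (by norm_num), ← gauss_norm]; ring

end


section

/-! ### Final bounds for the transforms -/

def rho (α x : ℝ) : ℝ := (1 + |x|) ^ (-1 - α)

lemma rho_pos (α x : ℝ) : 0 < rho α x := by unfold rho; positivity

lemma rho_le_one {α : ℝ} (hα : 0 < α) (x : ℝ) : rho α x ≤ 1 :=
  Real.rpow_le_one_of_one_le_of_nonpos (by linarith [abs_nonneg x]) (by linarith)

lemma om_le_one {α : ℝ} (hα : 0 < α) (x : ℝ) : om α x ≤ 1 :=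
  Real.rpow_le_one_of_one_le_of_nonpos (by linarith [abs_nonneg x]) (by linarith)

lemma asym_f {α : ℝ} (hα : α ∈ Ioo (0 : ℝ) 2) :
    ∃ C : ℝ, 0 < C ∧ ∀ v : ℝ, 0 ≤ v → v ≤ 1 → ∀ x : ℝ, 1 ≤ x →
      |T α v 0 0 x - gauss x - v * cAlpha α * x ^ (-1 - α)| ≤ C * v * x ^ (-1 - 3 * α / 2) := by
  obtain ⟨C, hC, h⟩ := f_error hα
  refine ⟨C, hC, fun v hv hv1 x hx => ?_⟩
  have h1 := h v hv hv1 x hx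
  have hpi := Real.pi_pos
  rw [lead_scale0 (by linarith), Complex.re_ofReal_mul, lead0 hα, T_zero0] at h1
  convert h1 using 2
  field_simp
  ring

lemma asym_T0 {α : ℝ} (hα : α ∈ Ioo (0 : ℝ) 2) :
    ∃ C : ℝ, 0 < C ∧ ∀ v : ℝ, 0 ≤ v → v ≤ 1 → ∀ x : ℝ, 1 ≤ x →
      |T α v α 0 x + cAlpha α * x ^ (-1 - α)| ≤ C * x ^ (-1 - 3 * α / 2) := by
  obtain ⟨C, hC, h⟩ := lead_error hα 0
  refine ⟨C, hC, fun v hv hv1 x hx => ?_⟩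
  have h1 := h v hv hv1 x hx
  have hpi := Real.pi_pos
  rw [lead_scale0 (by linarith), Complex.re_ofReal_mul, lead0 hα] at h1
  convert h1 using 2
  field_simp
  ring

lemma asym_T1 {α : ℝ} (hα : α ∈ Ioo (0 : ℝ) 2) :
    ∃ C : ℝ, 0 < C ∧ ∀ v : ℝ, 0 ≤ v → v ≤ 1 → ∀ x : ℝ, 1 ≤ x →
      |T α v α 1 x + (deriv cAlpha α - cAlpha α * Real.log x) * x ^ (-1 - α)|
        ≤ C * x ^ (-1 - 3 * α / 2) := by
  obtain ⟨C, hC, h⟩ := lead_error hα 1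
  refine ⟨C, hC, fun v hv hv1 x hx => ?_⟩
  have h1 := h v hv hv1 x hx
  have hpi := Real.pi_pos
  rw [lead_scale1 hα.1 (by linarith), Complex.re_ofReal_mul, Complex.sub_re, Complex.re_ofReal_mul,
    lead0 hα, lead1 hα] at h1
  convert h1 using 2
  field_simp
  ring

lemma gauss_abs (x : ℝ) : gauss |x| = gauss x := by simp [gauss]

lemma gauss_anti {x y : ℝ} (h : |x| ≤ |y|) : gauss y ≤ gauss x := by
  unfold gauss
  have := Real.pi_pos
  have h2 : x ^ 2 ≤ y ^ 2 := sq_le_sq.2 h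
  gcongr

lemma f_diff {α : ℝ} (hα : α ∈ Ioo (0 : ℝ) 2) :
    ∃ C : ℝ, 0 < C ∧ ∀ v : ℝ, 0 ≤ v → ∀ x, |T α v 0 0 x - gauss x| ≤ C * v * om α x := by
  obtain ⟨C, hC, h⟩ := T_diff_bound hα (a := 0) le_rfl
  refine ⟨C, hC, fun v hv x => ?_⟩
  have := h v hv x
  rwa [T_zero0] at this

lemma f_lower {α : ℝ} (hα : α ∈ Ioo (0 : ℝ) 2) :
    ∃ c₁ : ℝ, 0 < c₁ ∧ ∃ v₀ : ℝ, 0 < v₀ ∧ v₀ ≤ 1 ∧ ∀ v : ℝ, 0 ≤ v → v ≤ v₀ → ∀ x,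
      c₁ * (gauss x + v * rho α x) ≤ T α v 0 0 x := by
  obtain ⟨C, hC, h⟩ := f_diff hα
  obtain ⟨D, hD, h'⟩ := asym_f hα
  have hc := cAlpha_pos hα
  have hα1 := hα.1
  -- threshold
  have hlim : Tendsto (fun x : ℝ => D * x ^ (-(α / 2))) atTop (𝓝 (D * 0)) :=
    (tendsto_rpow_neg_atTop (by linarith)).const_mul D
  rw [mul_zero] at hlim
  obtain ⟨X, hX⟩ := ((hlim.eventually (gt_mem_nhds (half_pos hc))).and
    (eventually_ge_atTop 1)).exists_forall_of_atTop
  have hX1 : 1 ≤ X := (hX X le_rfl).2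
  have hg := gauss_pos X
  set v₀ := min 1 (gauss X / (2 * C)) with hv₀
  have hv0 : 0 < v₀ := lt_min one_pos (by positivity)
  refine ⟨min (1 / 4) (min (cAlpha α / 2) (C / 2)), by positivity, v₀, hv0, min_le_left _ _,
    fun v hv hvv x => ?_⟩
  have hv1 : v ≤ 1 := hvv.trans (min_le_left _ _)
  set c₁ := min (1 / 4) (min (cAlpha α / 2) (C / 2)) with hc₁
  have hc1a : c₁ ≤ 1 / 4 := min_le_left _ _
  have hc1b : c₁ ≤ cAlpha α / 2 := (min_le_right _ _).trans (min_le_left _ _)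
  have hc1c : c₁ ≤ C / 2 := (min_le_right _ _).trans (min_le_right _ _)
  have hc1p : 0 < c₁ := by positivity
  have hr := rho_pos α x
  have hgx := gauss_pos x
  rcases le_total X |x| with hx | hx
  · obtain ⟨ha, hb⟩ := hX |x| hx
    have h1 := abs_le.1 (h' v hv hv1 |x| hb)
    rw [gauss_abs, T, FT_abs] at h1
    have hxp : 0 < |x| := by linarith
    have e : |x| ^ (-1 - 3 * α / 2) = |x| ^ (-1 - α) * |x| ^ (-(α / 2)) := by
      rw [← Real.rpow_add hxp]; congr 1; ring
    have hp : 0 < |x| ^ (-1 - α) := by positivity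
    have h2 : D * v * |x| ^ (-1 - 3 * α / 2) ≤ cAlpha α / 2 * v * |x| ^ (-1 - α) := by
      rw [e]
      have : 0 ≤ v * |x| ^ (-1 - α) := by positivity
      calc _ = (D * |x| ^ (-(α / 2))) * (v * |x| ^ (-1 - α)) := by ring
        _ ≤ cAlpha α / 2 * (v * |x| ^ (-1 - α)) := by gcongr
        _ = _ := by ring
    have h3 : rho α x ≤ |x| ^ (-1 - α) :=
      Real.rpow_le_rpow_of_nonpos hxp (by linarith) (by linarith)
    have h4 : gauss x + cAlpha α / 2 * v * |x| ^ (-1 - α) ≤ T α v 0 0 x := by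
      rw [T]; linarith [h1.1]
    refine le_trans ?_ h4
    have : c₁ * (v * rho α x) ≤ cAlpha α / 2 * (v * |x| ^ (-1 - α)) := by gcongr
    nlinarith
  · have h1 := abs_le.1 (h v hv x)
    have h2 : gauss X ≤ gauss x := gauss_anti (by rwa [abs_of_nonneg (by linarith : 0 ≤ X)])
    have h3 : v * (2 * C) ≤ gauss X := by
      have := hvv.trans (min_le_right _ _)
      rwa [le_div_iff₀ (by positivity)] at this
    have h4 := om_le_one hα1 x
    have h5 := rho_le_one hα1 x
    have h6 : C * v * om α x ≤ C * v := mul_le_of_le_one_right (by positivity) h4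
    have h7 : c₁ * (v * rho α x) ≤ C / 2 * v := by
      have : v * rho α x ≤ v := mul_le_of_le_one_right hv h5
      exact mul_le_mul hc1c this (by positivity) (by positivity)
    nlinarith [h1.1]

lemma T2_bound {α : ℝ} (hα : α ∈ Ioo (0 : ℝ) 2) :
    ∃ C : ℝ, 0 < C ∧ ∀ v : ℝ, 0 ≤ v → ∀ x,
      |T α v 2 0 x - (1 - x ^ 2) * gauss x| ≤ C * v * om α x := by
  obtain ⟨C, hC, h⟩ := T_diff_bound hα (a := 2) (by norm_num)
  refine ⟨C, hC, fun v hv x => ?_⟩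
  have := h v hv x
  rwa [T_zero2] at this

lemma T4_bound {α : ℝ} (hα : α ∈ Ioo (0 : ℝ) 2) :
    ∃ C : ℝ, 0 < C ∧ ∀ v : ℝ, 0 ≤ v → ∀ x,
      |T α v 4 0 x - (x ^ 4 - 6 * x ^ 2 + 3) * gauss x| ≤ C * v * om α x := by
  obtain ⟨C, hC, h⟩ := T_diff_bound hα (a := 4) (by norm_num)
  refine ⟨C, hC, fun v hv x => ?_⟩
  have := h v hv x
  rwa [T_zero4] at this

end


section

/-! ### Fourier representation of the density -/

lemma gauss_integrable : Integrable gauss := by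
  unfold gauss
  refine Integrable.const_mul ?_ _
  have := integrable_exp_neg_mul_sq (b := 1 / 2) (by norm_num)
  refine this.congr (ae_of_all _ fun y => ?_)
  simp only; congr 1; ring

lemma continuous_gauss : Continuous gauss := by unfold gauss; fun_prop

lemma gauss_cos (u : ℝ) : ∫ s, gauss s * Real.cos (s * u) = Real.exp (-(u ^ 2) / 2) := by
  have hpi := Real.pi_pos
  have h1 := gauss_base u (b := 1 / 2) (by norm_num)
  have h2 : ∀ s : ℝ, gauss s * Real.cos (s * u) = (fun s => gauss s * Real.cos (s * u)) |s| := by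
    intro s
    have : Real.cos (|s| * u) = Real.cos (s * u) := by
      rcases abs_choice s with h | h <;> rw [h]
      rw [neg_mul, Real.cos_neg]
    simp only [gauss_abs, this]
  rw [integral_congr_ae (ae_of_all _ h2), integral_comp_abs (f := fun s => gauss s * Real.cos (s * u))]
  have h3 : ∀ s : ℝ, gauss s * Real.cos (s * u) = (Real.sqrt (2 * Real.pi))⁻¹ *
    (Real.cos (u * s) * (s ^ 0 * Real.exp (-(1 / 2) * s ^ 2))) := by
    intro s
    rw [gauss, pow_zero, one_mul, mul_comm s u, show -(s ^ 2) / 2 = -(1 / 2) * s ^ 2 by ring]; ring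
  simp_rw [h3]
  rw [integral_const_mul, h1]
  have e1 : Real.pi / (1 / 2) = 2 * Real.pi := by ring
  have hs : 0 < Real.sqrt (2 * Real.pi) := Real.sqrt_pos.2 (by positivity)
  rw [e1, show -u ^ 2 / (4 * (1 / 2)) = -u ^ 2 / 2 by ring]
  field_simp

lemma gauss_sin (u : ℝ) : ∫ s, gauss s * Real.sin (s * u) = 0 := by
  have h := integral_neg_eq_self (fun s => gauss s * Real.sin (s * u)) volume
  have h2 : ∀ s : ℝ, gauss (-s) * Real.sin (-s * u) = -(gauss s * Real.sin (s * u)) := by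
    intro s; simp [gauss]
  simp_rw [h2] at h
  rw [integral_neg] at h
  linarith

lemma gauss_inner {w : ℝ} (hw : 0 < w) (y u : ℝ) :
    ∫ z, gauss (y - w * z) * Real.cos (z * u)
      = w⁻¹ * (Real.cos (y * (u / w)) * Real.exp (-((u / w) ^ 2) / 2)) := by
  have h1 := Measure.integral_comp_mul_left (fun s => gauss (y - s) * Real.cos (s * (u / w))) w
  have e1 : ∀ z : ℝ, w * z * (u / w) = z * u := by intro z; field_simp
  simp only [e1] at h1
  rw [h1, abs_of_pos (inv_pos.2 hw), smul_eq_mul]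
  congr 1
  have h2 := integral_sub_left_eq_self (fun s => gauss (y - s) * Real.cos (s * (u / w))) volume y
  rw [← h2]
  have e2 : ∀ s : ℝ, gauss (y - (y - s)) * Real.cos ((y - s) * (u / w))
      = Real.cos (y * (u / w)) * (gauss s * Real.cos (s * (u / w)))
        + Real.sin (y * (u / w)) * (gauss s * Real.sin (s * (u / w))) := by
    intro s
    rw [sub_sub_cancel, sub_mul, Real.cos_sub]; ring
  simp_rw [e2]
  have i1 : Integrable (fun s => gauss s * Real.cos (s * (u / w))) := by
    refine gauss_integrable.mul_bdd (c := 1) ?_ ?_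
    · exact (by fun_prop : Continuous _).aestronglyMeasurable
    · exact ae_of_all _ fun τ => by simpa using Real.abs_cos_le_one _
  have i2 : Integrable (fun s => gauss s * Real.sin (s * (u / w))) := by
    refine gauss_integrable.mul_bdd (c := 1) ?_ ?_
    · exact (by fun_prop : Continuous _).aestronglyMeasurable
    · exact ae_of_all _ fun τ => by simpa using Real.abs_sin_le_one _
  rw [integral_add (i1.const_mul _) (i2.const_mul _), integral_const_mul, integral_const_mul,
    gauss_cos, gauss_sin]
  ring

lemma integrable_comp_abs' {f : ℝ → ℝ} (hf : IntegrableOn f (Ioi 0)) :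
    Integrable (fun x => f |x|) := by
  have hf1 : IntegrableOn (fun x => f |x|) (Ioi 0) := by
    refine hf.congr_fun (fun x hx => ?_) measurableSet_Ioi
    simp only [mem_Ioi] at hx
    simp only [abs_of_pos hx]
  have int_Iic : IntegrableOn (fun x ↦ f |x|) (Iic 0) := by
    rw [← Measure.map_neg_eq_self (volume : Measure ℝ)]
    let m : MeasurableEmbedding fun x : ℝ => -x := (Homeomorph.neg ℝ).measurableEmbedding
    rw [m.integrableOn_map_iff]
    simp_rw [Function.comp_def, abs_neg, neg_preimage, neg_Iic, neg_zero]
    exact Iff.mpr integrableOn_Ici_iff_integrableOn_Ioi hf1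
  rw [← integrableOn_univ, ← Iic_union_Ioi (a := (0:ℝ))]
  exact int_Iic.union hf1

lemma integrable_exp_neg_abs_rpow {α : ℝ} (hα : 0 < α) :
    Integrable (fun u : ℝ => Real.exp (-(|u| ^ α))) := by
  have h : IntegrableOn (fun u : ℝ => Real.exp (-(u ^ α))) (Ioi 0) := by
    have := integrableOn_rpow_mul_exp_neg_mul_rpow (p := α) (s := 0) (b := 1) (by norm_num) hα one_pos
    simpa using this
  exact integrable_comp_abs' h

lemma fFun_eq {α : ℝ} (hα : 0 < α) {w : ℝ} (hw : 0 < w) (y : ℝ) :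
    fFun α y w = FT (fun τ => Real.exp (-(τ ^ 2 / 2) - (w * τ) ^ α)) y := by
  have hpi := Real.pi_pos
  have hi : Integrable (Function.uncurry fun z u : ℝ =>
      gauss (y - w * z) * Real.cos (z * u) * Real.exp (-(|u| ^ α))) (volume.prod volume) := by
    have g1 : Integrable (fun z => gauss (y - w * z)) := by
      have := (gauss_integrable.comp_sub_left y).comp_mul_left' hw.ne'
      exact this
    have h1 := g1.mul_prod (integrable_exp_neg_abs_rpow hα)
    have : Integrable (fun p : ℝ × ℝ => Real.cos (p.1 * p.2) *
        (gauss (y - w * p.1) * Real.exp (-(|p.2| ^ α)))) (volume.prod volume) := by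
      refine h1.bdd_mul (c := 1) ?_ ?_
      · exact (by fun_prop : Continuous _).aestronglyMeasurable
      · exact ae_of_all _ fun τ => by simpa using Real.abs_cos_le_one _
    refine this.congr (ae_of_all _ fun p => ?_)
    simp only [Function.uncurry]; ring
  unfold fFun stableDensity
  have e1 : ∀ z : ℝ, gauss (y - w * z) * ((2 * Real.pi)⁻¹ * ∫ u : ℝ, Real.cos (z * u)
      * Real.exp (-(|u| ^ α))) = (2 * Real.pi)⁻¹ * ∫ u : ℝ, gauss (y - w * z) * Real.cos (z * u)
      * Real.exp (-(|u| ^ α)) := by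
    intro z
    rw [mul_left_comm, ← integral_const_mul]
    congr 2; ext u; ring
  simp_rw [e1]
  rw [integral_const_mul, integral_integral_swap hi]
  have e2 : ∀ u : ℝ, ∫ z, gauss (y - w * z) * Real.cos (z * u) * Real.exp (-(|u| ^ α))
      = w⁻¹ * ((fun t => Real.cos (y * t) * Real.exp (-(t ^ 2 / 2) - (w * t) ^ α)) |w⁻¹ * u|) := by
    intro u
    rw [integral_mul_const, gauss_inner hw, mul_assoc, mul_assoc, ← Real.exp_add]
    congr 1
    have h1 : |w⁻¹ * u| = |u| / w := by
      rw [abs_mul, abs_of_pos (inv_pos.2 hw)]; ring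
    have h2 : Real.cos (y * (|u| / w)) = Real.cos (y * (u / w)) := by
      rcases abs_choice u with h | h <;> rw [h]
      rw [neg_div, mul_neg, Real.cos_neg]
    simp only [h1, h2]
    rw [mul_div_cancel₀ _ hw.ne', div_pow, div_pow, sq_abs]
    congr 2; ring
  simp_rw [e2]
  rw [integral_const_mul,
    Measure.integral_comp_mul_left (fun u => (fun t => Real.cos (y * t) * Real.exp (-(t ^ 2 / 2) - (w * t) ^ α)) |u|) w⁻¹,
    integral_comp_abs (f := fun t => Real.cos (y * t) * Real.exp (-(t ^ 2 / 2) - (w * t) ^ α)), FT]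
  rw [inv_inv, abs_of_pos hw, smul_eq_mul]
  field_simp

lemma FT_comp_mul {s : ℝ} (hs : 0 < s) (G : ℝ → ℝ) (x : ℝ) :
    FT G (x / s) = s * FT (fun τ => G (s * τ)) x := by
  have h := integral_comp_mul_left_Ioi (fun τ => Real.cos (x / s * τ) * G τ) 0 hs
  rw [mul_zero] at h
  have e : ∀ τ : ℝ, x / s * (s * τ) = x * τ := by intro τ; field_simp
  simp only [e] at h
  rw [FT, FT, h, smul_eq_mul]
  field_simp

/-- The exponent. -/
def ell (n : ℕ) (σ₀ : ℝ) (θ : Fin 3 → ℝ) (τ : ℝ) : ℝ :=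
  Real.log (θ 1) + (Real.log n / 2 - Real.log σ₀) + Real.log τ

def Efun (n : ℕ) (σ₀ : ℝ) (θ : Fin 3 → ℝ) (τ : ℝ) : ℝ := Real.exp (θ 2 * ell n σ₀ θ τ) / n

def psi (n : ℕ) (σ₀ : ℝ) (θ : Fin 3 → ℝ) (τ : ℝ) : ℝ :=
  θ 0 ^ 2 * τ ^ 2 / (2 * σ₀ ^ 2) + Efun n σ₀ θ τ

def PF (n : ℕ) (σ₀ : ℝ) (θ : Fin 3 → ℝ) (x : ℝ) : ℝ := FT (fun τ => Real.exp (-psi n σ₀ θ τ)) x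

lemma pdens_eq {n : ℕ} (hn : 1 ≤ n) {σ₀ : ℝ} (hσ : 0 < σ₀) {θ : Fin 3 → ℝ} (h0 : 0 < θ 0)
    (h1 : 0 < θ 1) (h2 : 0 < θ 2) (y : ℝ) :
    pdens n θ y = Real.sqrt n / σ₀ * PF n σ₀ θ (Real.sqrt n * y / σ₀) := by
  have hn0 : (0 : ℝ) < n := by exact_mod_cast hn
  have hw : 0 < wn n (θ 0) (θ 1) (θ 2) := by unfold wn; positivity
  rw [pdens, fFun_eq h2 hw]
  have hs : 0 < θ 0 / σ₀ := by positivity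
  have e1 : Real.sqrt n * y / θ 0 = (Real.sqrt n * y / σ₀) / (θ 0 / σ₀) := by field_simp
  rw [e1, FT_comp_mul hs, PF]
  have e2 : FT (fun τ => Real.exp (-((θ 0 / σ₀ * τ) ^ 2 / 2)
      - (wn n (θ 0) (θ 1) (θ 2) * (θ 0 / σ₀ * τ)) ^ θ 2)) (Real.sqrt n * y / σ₀)
      = FT (fun τ => Real.exp (-psi n σ₀ θ τ)) (Real.sqrt n * y / σ₀) := by
    unfold FT
    congr 1
    refine setIntegral_congr_fun measurableSet_Ioi fun τ hτ => ?_
    simp only [mem_Ioi] at hτ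
    simp only
    congr 2
    have e3 : wn n (θ 0) (θ 1) (θ 2) * (θ 0 / σ₀ * τ)
        = Real.exp (ell n σ₀ θ τ - Real.log n / θ 2) := by
      unfold ell wn
      rw [show Real.log (θ 1) + (Real.log n / 2 - Real.log σ₀) + Real.log τ - Real.log n / θ 2
        = Real.log n * (1 / 2 - 1 / θ 2) + Real.log (θ 1) - Real.log σ₀ + Real.log τ by ring,
        Real.exp_add, Real.exp_sub, Real.exp_add, Real.exp_log h1, Real.exp_log hσ,
        Real.exp_log hτ, Real.rpow_def_of_pos hn0]
      field_simp
    have e4 : Real.exp (ell n σ₀ θ τ - Real.log n / θ 2) ^ θ 2 = Efun n σ₀ θ τ := by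
      rw [← Real.exp_mul, Efun, sub_mul, div_mul_cancel₀ _ h2.ne', Real.exp_sub, Real.exp_log hn0,
        mul_comm]
    rw [e3, e4, psi]
    field_simp
    ring
  rw [e2]
  field_simp

end


section

def psi1 (n : ℕ) (σ₀ : ℝ) (θ : Fin 3 → ℝ) (τ : ℝ) : Fin 3 → ℝ :=
  ![θ 0 * τ ^ 2 / σ₀ ^ 2, θ 2 / θ 1 * Efun n σ₀ θ τ, ell n σ₀ θ τ * Efun n σ₀ θ τ]

def psi2 (n : ℕ) (σ₀ : ℝ) (θ : Fin 3 → ℝ) (τ : ℝ) : Matrix (Fin 3) (Fin 3) ℝ :=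
  !![τ ^ 2 / σ₀ ^ 2, 0, 0;
     0, (θ 2 ^ 2 / θ 1 ^ 2 - θ 2 / θ 1 ^ 2) * Efun n σ₀ θ τ,
       (1 / θ 1 + θ 2 / θ 1 * ell n σ₀ θ τ) * Efun n σ₀ θ τ;
     0, (1 / θ 1 + θ 2 / θ 1 * ell n σ₀ θ τ) * Efun n σ₀ θ τ,
       ell n σ₀ θ τ ^ 2 * Efun n σ₀ θ τ]

lemma ell_deriv (n : ℕ) (σ₀ : ℝ) (θ : Fin 3 → ℝ) (h1 : 0 < θ 1) (τ : ℝ) (j : Fin 3) :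
    HasDerivAt (fun t => ell n σ₀ (Function.update θ j t) τ) ((![0, 1 / θ 1, 0] : Fin 3 → ℝ) j) (θ j) := by
  fin_cases j
  · simpa [ell] using hasDerivAt_const _ _
  · simp only [ell, Fin.mk_one, Function.update_self]
    have := ((Real.hasDerivAt_log h1.ne').add_const (Real.log n / 2 - Real.log σ₀)).add_const (Real.log τ)
    simpa using this
  · simpa [ell] using hasDerivAt_const _ _

lemma th_deriv (θ : Fin 3 → ℝ) (i j : Fin 3) :
    HasDerivAt (fun t => Function.update θ j t i) (if i = j then 1 else 0) (θ j) := by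
  by_cases h : i = j
  · subst h
    simpa using hasDerivAt_id' (θ i)
  · simpa [h] using hasDerivAt_const _ _

lemma Efun_deriv (n : ℕ) (σ₀ : ℝ) (θ : Fin 3 → ℝ) (h1 : 0 < θ 1) (τ : ℝ) (j : Fin 3) :
    HasDerivAt (fun t => Efun n σ₀ (Function.update θ j t) τ)
      ((![0, θ 2 / θ 1, ell n σ₀ θ τ] : Fin 3 → ℝ) j * Efun n σ₀ θ τ) (θ j) := by
  have h := (((th_deriv θ 2 j).mul (ell_deriv n σ₀ θ h1 τ j)).exp).div_const (n : ℝ)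
  refine h.congr_deriv ?_
  simp only [Function.update_eq_self]
  fin_cases j <;> simp [Efun] <;> ring

lemma psi_deriv (n : ℕ) (σ₀ : ℝ) (θ : Fin 3 → ℝ) (h1 : 0 < θ 1) (τ : ℝ) (j : Fin 3) :
    HasDerivAt (fun t => psi n σ₀ (Function.update θ j t) τ) (psi1 n σ₀ θ τ j) (θ j) := by
  have h := (((((th_deriv θ 0 j).pow 2).mul_const (τ ^ 2)).div_const (2 * σ₀ ^ 2)).add
    (Efun_deriv n σ₀ θ h1 τ j))
  refine h.congr_deriv ?_
  fin_cases j <;> simp [psi1] <;> ring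

lemma psi1_deriv (n : ℕ) (σ₀ : ℝ) (θ : Fin 3 → ℝ) (h1 : 0 < θ 1) (τ : ℝ) (i j : Fin 3) :
    HasDerivAt (fun t => psi1 n σ₀ (Function.update θ i t) τ j) (psi2 n σ₀ θ τ i j) (θ i) := by
  have hE := Efun_deriv n σ₀ θ h1 τ i
  have hl := ell_deriv n σ₀ θ h1 τ i
  have h1' : Function.update θ i (θ i) 1 ≠ 0 := by simpa using h1.ne'
  have h1n := h1.ne'
  fin_cases j
  · refine ((((th_deriv θ 0 i).mul_const (τ ^ 2)).div_const (σ₀ ^ 2))).congr_deriv ?_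
    fin_cases i <;> simp [psi2]
  · refine ((((th_deriv θ 2 i).div (th_deriv θ 1 i) h1').mul hE)).congr_deriv ?_
    fin_cases i <;> simp [psi2] <;> field_simp <;> ring
  · refine (hl.mul hE).congr_deriv ?_
    fin_cases i <;> simp [psi2] <;> ring

/-- Box of parameters. -/
def Box (σ₀ δ₀ α₀ : ℝ) : Set (Fin 3 → ℝ) :=
  {θ | σ₀ / 2 < θ 0 ∧ θ 0 < 2 * σ₀ ∧ δ₀ / 2 < θ 1 ∧ θ 1 < 2 * δ₀ ∧ α₀ / 2 < θ 2 ∧ θ 2 < 2}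

lemma isOpen_Box (σ₀ δ₀ α₀ : ℝ) : IsOpen (Box σ₀ δ₀ α₀) := by
  have a : ∀ (c : ℝ) (i : Fin 3), IsOpen {θ : Fin 3 → ℝ | c < θ i} := fun c i =>
    isOpen_lt continuous_const (continuous_apply i)
  have b : ∀ (c : ℝ) (i : Fin 3), IsOpen {θ : Fin 3 → ℝ | θ i < c} := fun c i =>
    isOpen_lt (continuous_apply i) continuous_const
  exact (a _ 0).inter ((b _ 0).inter ((a _ 1).inter ((b _ 1).inter ((a _ 2).inter (b _ 2)))))

lemma Box_update {σ₀ δ₀ α₀ : ℝ} {θ : Fin 3 → ℝ} (h : θ ∈ Box σ₀ δ₀ α₀) (j : Fin 3) :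
    {t | Function.update θ j t ∈ Box σ₀ δ₀ α₀} ∈ 𝓝 (θ j) := by
  have hc : Continuous (fun t => Function.update θ j t) := by fun_prop
  refine ((isOpen_Box σ₀ δ₀ α₀).preimage hc).mem_nhds ?_
  simpa using h

def domF (τ : ℝ) : ℝ := (1 + τ) ^ 4 * (1 + |Real.log τ|) ^ 2 * Real.exp (-(τ ^ 2 / 8))

lemma log_bound {τ : ℝ} (hτ : 0 < τ) : (1 + |Real.log τ|) ^ 2
    ≤ 50 * (τ ^ (1 / 2 : ℝ) + τ ^ (-1 / 2 : ℝ)) := by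
  have e1 : τ ^ (1 / 2 : ℝ) = (Real.exp (Real.log τ / 4)) ^ 2 := by
    rw [Real.rpow_def_of_pos hτ, ← Real.exp_nat_mul]; congr 1; push_cast; ring
  have e2 : τ ^ (-1 / 2 : ℝ) = (Real.exp (-(Real.log τ / 4))) ^ 2 := by
    rw [Real.rpow_def_of_pos hτ, ← Real.exp_nat_mul]; congr 1; push_cast; ring
  rw [e1, e2]
  set a := Real.exp (Real.log τ / 4)
  set b := Real.exp (-(Real.log τ / 4))
  have ha : Real.log τ / 4 + 1 ≤ a := Real.add_one_le_exp _
  have hb : -(Real.log τ / 4) + 1 ≤ b := Real.add_one_le_exp _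
  have ha0 : 0 < a := Real.exp_pos _
  have hb0 : 0 < b := Real.exp_pos _
  have h : 1 + |Real.log τ| ≤ 5 * (a + b) := by
    rcases abs_cases (Real.log τ) with ⟨h, _⟩ | ⟨h, _⟩ <;> rw [h] <;> linarith
  have h0 : 0 ≤ 1 + |Real.log τ| := by positivity
  calc _ ≤ (5 * (a + b)) ^ 2 := by gcongr
    _ ≤ _ := by nlinarith [sq_nonneg (a - b)]

lemma domF_integrable : IntegrableOn domF (Ioi 0) := by
  have i1 := integrableOn_rpow_mul_exp_neg_mul_sq (b := 1 / 8) (s := 1 / 2) (by norm_num) (by norm_num)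
  have i2 := integrableOn_rpow_mul_exp_neg_mul_sq (b := 1 / 8) (s := -1 / 2) (by norm_num) (by norm_num)
  have i3 := integrableOn_rpow_mul_exp_neg_mul_sq (b := 1 / 8) (s := 4 + 1 / 2) (by norm_num) (by norm_num)
  have i4 := integrableOn_rpow_mul_exp_neg_mul_sq (b := 1 / 8) (s := 4 + -1 / 2) (by norm_num) (by norm_num)
  refine Integrable.mono' ((((i1.add i2).add i3).add i4).const_mul 400) ?_ ?_
  · exact (by unfold domF; fun_prop : Measurable domF).aestronglyMeasurable
  · filter_upwards [ae_restrict_mem measurableSet_Ioi] with τ hτ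
    simp only [mem_Ioi] at hτ
    have h1 := log_bound hτ
    have h2 : (1 + τ) ^ 4 ≤ 8 * (1 + τ ^ 4) := by nlinarith [sq_nonneg (τ - 1), sq_nonneg (τ ^ 2 - 1), sq_nonneg (τ ^ 2 - τ), hτ, mul_pos hτ hτ]
    rw [Real.norm_of_nonneg (by unfold domF; positivity)]
    simp only [Pi.add_apply]
    rw [Real.rpow_add hτ, Real.rpow_add hτ, show (4 : ℝ) = (4 : ℕ) by norm_num, Real.rpow_natCast,
      show -(1 / 8) * τ ^ 2 = -(τ ^ 2 / 8) by ring]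
    unfold domF
    set p := τ ^ (1 / 2 : ℝ)
    set q := τ ^ (-1 / 2 : ℝ)
    have hp : 0 < p := by positivity
    have hq : 0 < q := by positivity
    set e := Real.exp (-(τ ^ 2 / 8))
    have he : 0 < e := Real.exp_pos _
    calc _ ≤ 8 * (1 + τ ^ 4) * (50 * (p + q)) * e := by gcongr
      _ = _ := by push_cast; ring

lemma FT_hasDerivAt {F F' : ℝ → ℝ → ℝ} {t₀ K : ℝ} {s : Set ℝ} (hs : s ∈ 𝓝 t₀)
    (hm : ∀ t, Measurable (F t)) (hm' : ∀ t, Measurable (F' t))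
    (h0 : ∀ τ > 0, |F t₀ τ| ≤ K * domF τ)
    (hd : ∀ t ∈ s, ∀ τ > 0, HasDerivAt (fun t => F t τ) (F' t τ) t)
    (hb : ∀ t ∈ s, ∀ τ > 0, |F' t τ| ≤ K * domF τ) (x : ℝ) :
    HasDerivAt (fun t => FT (F t) x) (FT (F' t₀) x) t₀ := by
  unfold FT
  refine HasDerivAt.const_mul _ ?_
  have hc : Measurable fun τ : ℝ => Real.cos (x * τ) := by fun_prop
  have h := hasDerivAt_integral_of_dominated_loc_of_deriv_le
    (μ := volume.restrict (Ioi (0 : ℝ))) (F := fun t τ => Real.cos (x * τ) * F t τ)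
    (F' := fun t τ => Real.cos (x * τ) * F' t τ) (bound := fun τ => K * domF τ) (x₀ := t₀) hs
    (Eventually.of_forall fun t => (hc.mul (hm t)).aestronglyMeasurable) ?_
    (hc.mul (hm' t₀)).aestronglyMeasurable ?_ (domF_integrable.const_mul K) ?_
  · exact h.2
  · refine integrableOn_cos_mul ?_ x
    refine Integrable.mono' (domF_integrable.const_mul K) (hm t₀).aestronglyMeasurable ?_
    filter_upwards [ae_restrict_mem measurableSet_Ioi] with τ hτ
    exact h0 τ hτ
  · filter_upwards [ae_restrict_mem measurableSet_Ioi] with τ hτ t ht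
    rw [norm_mul]
    calc _ ≤ 1 * |F' t τ| := by
          gcongr
          · exact Real.abs_cos_le_one _
          · exact le_rfl
      _ ≤ _ := by rw [one_mul]; exact hb t ht τ hτ
  · filter_upwards [ae_restrict_mem measurableSet_Ioi] with τ hτ t ht
    exact (hd t ht τ hτ).const_mul _

end


section

set_option maxHeartbeats 1600000 in
lemma box_bounds {σ₀ δ₀ α₀ : ℝ} (hσ : 0 < σ₀) (hδ : 0 < δ₀) (hα : α₀ ∈ Ioo (0 : ℝ) 2) {n : ℕ}
    (hn : 1 ≤ n) : ∃ K : ℝ, 1 ≤ K ∧ ∀ θ ∈ Box σ₀ δ₀ α₀, ∀ τ > 0,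
      (∀ j, |psi1 n σ₀ θ τ j| ≤ K * ((1 + τ) ^ 2 * (1 + |Real.log τ|))) ∧
      (∀ i j, |psi2 n σ₀ θ τ i j| ≤ K * ((1 + τ) ^ 2 * (1 + |Real.log τ|) ^ 2)) ∧
      Real.exp (-psi n σ₀ θ τ) ≤ Real.exp (-(τ ^ 2 / 8)) := by
  set A : ℝ := |Real.log (δ₀ / 2)| + |Real.log (2 * δ₀)| + |Real.log n / 2 - Real.log σ₀| with hA
  have hA0 : 0 ≤ A := by positivity
  set B : ℝ := Real.exp (2 * A) with hB
  have hB0 : 0 < B := Real.exp_pos _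
  have hn1 : (1 : ℝ) ≤ n := by exact_mod_cast hn
  set K : ℝ := 1 + 2 / σ₀ + 4 / δ₀ * B + (A + 1) * B + 1 / σ₀ ^ 2 + 24 / δ₀ ^ 2 * B
    + (2 / δ₀ + 4 / δ₀ * (A + 1)) * B + (A + 1) ^ 2 * B with hK
  have k1 : 0 < 2 / σ₀ := by positivity
  have k2 : 0 < 4 / δ₀ * B := by positivity
  have k3 : 0 < (A + 1) * B := by positivity
  have k4 : 0 < 1 / σ₀ ^ 2 := by positivity
  have k5 : 0 < 24 / δ₀ ^ 2 * B := by positivity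
  have k6 : 0 < (2 / δ₀ + 4 / δ₀ * (A + 1)) * B := by positivity
  have k7 : 0 < (A + 1) ^ 2 * B := by positivity
  refine ⟨K, by linarith, ?_⟩
  rintro θ ⟨h0, h0', h1, h1', h2, h2'⟩ τ hτ
  have p0 : 0 < θ 0 := by linarith
  have p1 : 0 < θ 1 := by linarith
  have p2 : 0 < θ 2 := by linarith [hα.1]
  set L := 1 + |Real.log τ| with hL
  have hL1 : 1 ≤ L := by have := abs_nonneg (Real.log τ); linarith
  set S := (1 + τ) ^ 2 with hS
  have hS1 : 1 ≤ S := by nlinarith only [hS, hτ]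
  have hSτ : τ ^ 2 ≤ S := by nlinarith only [hS, hτ]
  have hlog : |Real.log (θ 1)| ≤ |Real.log (δ₀ / 2)| + |Real.log (2 * δ₀)| := by
    have a1 : Real.log (δ₀ / 2) ≤ Real.log (θ 1) := Real.log_le_log (by positivity) h1.le
    have a2 : Real.log (θ 1) ≤ Real.log (2 * δ₀) := Real.log_le_log (by positivity) h1'.le
    rw [abs_le]
    constructor <;> linarith [neg_abs_le (Real.log (δ₀ / 2)), le_abs_self (Real.log (2 * δ₀)), abs_nonneg (Real.log (δ₀ / 2)), abs_nonneg (Real.log (2 * δ₀))]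
  have hl0 : |Real.log (θ 1) + (Real.log n / 2 - Real.log σ₀)| ≤ A := by
    refine (abs_add_le _ _).trans ?_
    linarith
  have hl : |ell n σ₀ θ τ| ≤ (A + 1) * L := by
    unfold ell
    refine (abs_add_le _ _).trans ?_
    nlinarith only [hl0, hA0, hL1, hL]
  have hE0 : 0 ≤ Efun n σ₀ θ τ := by unfold Efun; positivity
  have hE : Efun n σ₀ θ τ ≤ B * S := by
    unfold Efun
    refine (div_le_self (Real.exp_pos _).le hn1).trans ?_
    rw [ell, mul_add, Real.exp_add]
    have b1 : Real.exp (θ 2 * (Real.log (θ 1) + (Real.log n / 2 - Real.log σ₀))) ≤ B := by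
      apply Real.exp_le_exp.2
      have := (abs_le.1 hl0).2
      exact (mul_le_mul_of_nonneg_left this p2.le).trans (by gcongr)
    have b2 : Real.exp (θ 2 * Real.log τ) ≤ S := by
      rw [mul_comm, ← Real.rpow_def_of_pos hτ]
      calc τ ^ θ 2 ≤ (1 + τ) ^ θ 2 := by gcongr; linarith
        _ ≤ (1 + τ) ^ (2 : ℝ) := Real.rpow_le_rpow_of_exponent_le (by linarith) h2'.le
        _ = S := by rw [hS]; norm_cast
    gcongr
  have hSL : S ≤ S * L := by nlinarith only [hS1, hL1]
  have hSL2 : S * L ≤ S * L ^ 2 := by nlinarith only [hL1, hS1, mul_pos (by linarith : 0 < S) (by linarith : 0 < L)]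
  have q1 : θ 2 / θ 1 ≤ 4 / δ₀ := by rw [div_le_div_iff₀ p1 hδ]; nlinarith only [h1, h2', p2, hδ]
  have q2 : 1 / θ 1 ≤ 2 / δ₀ := by rw [div_le_div_iff₀ p1 hδ]; nlinarith only [h1]
  have q10 : 0 ≤ θ 2 / θ 1 := by positivity
  have q20 : 0 ≤ 1 / θ 1 := by positivity
  have z : (0 : ℝ) ≤ K := by linarith
  have fin1 : ∀ c X : ℝ, c ≤ K → 0 ≤ X → c * X ≤ K * X := fun c X h hX => by gcongr
  refine ⟨?_, ?_, ?_⟩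
  · intro j
    fin_cases j
    · simp only [psi1, Fin.zero_eta, Matrix.cons_val_zero]
      rw [abs_of_nonneg (by positivity)]
      calc θ 0 * τ ^ 2 / σ₀ ^ 2 ≤ 2 * σ₀ * S / σ₀ ^ 2 := by gcongr
        _ = 2 / σ₀ * S := by field_simp
        _ ≤ 2 / σ₀ * (S * L) := by gcongr
        _ ≤ _ := fin1 _ _ (by linarith) (by positivity)
    · simp only [psi1, Fin.mk_one, Matrix.cons_val_one, Matrix.cons_val_zero]
      rw [abs_of_nonneg (by positivity)]
      calc θ 2 / θ 1 * Efun n σ₀ θ τ ≤ 4 / δ₀ * (B * S) := by gcongr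
        _ = 4 / δ₀ * B * S := by ring
        _ ≤ 4 / δ₀ * B * (S * L) := by gcongr
        _ ≤ _ := fin1 _ _ (by linarith) (by positivity)
    · simp only [psi1, Fin.reduceFinMk, Matrix.cons_val]
      rw [abs_mul, abs_of_nonneg hE0]
      calc _ ≤ (A + 1) * L * (B * S) := by gcongr
        _ = (A + 1) * B * (S * L) := by ring
        _ ≤ _ := fin1 _ _ (by linarith) (by positivity)
  · have mid : |(1 / θ 1 + θ 2 / θ 1 * ell n σ₀ θ τ) * Efun n σ₀ θ τ| ≤ K * (S * L ^ 2) := by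
      rw [abs_mul, abs_of_nonneg hE0]
      have : |1 / θ 1 + θ 2 / θ 1 * ell n σ₀ θ τ| ≤ 2 / δ₀ * L + 4 / δ₀ * ((A + 1) * L) := by
        refine (abs_add_le _ _).trans ?_
        rw [abs_mul, abs_of_nonneg q20, abs_of_nonneg q10]
        have : 2 / δ₀ ≤ 2 / δ₀ * L := by have : 0 < 2 / δ₀ := by positivity
                                         nlinarith only [this, hL1]
        gcongr
        linarith
      calc _ ≤ (2 / δ₀ * L + 4 / δ₀ * ((A + 1) * L)) * (B * S) := by gcongr
        _ = (2 / δ₀ + 4 / δ₀ * (A + 1)) * B * (S * L) := by ring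
        _ ≤ (2 / δ₀ + 4 / δ₀ * (A + 1)) * B * (S * L ^ 2) := by gcongr
        _ ≤ _ := fin1 _ _ (by linarith) (by positivity)
    intro i j
    fin_cases i <;> fin_cases j
    · simp only [psi2, Fin.zero_eta, Matrix.cons_val_zero, Matrix.of_apply, Matrix.cons_val', Matrix.cons_val]
      rw [abs_of_nonneg (by positivity)]
      calc τ ^ 2 / σ₀ ^ 2 ≤ S / σ₀ ^ 2 := by gcongr
        _ = 1 / σ₀ ^ 2 * S := by field_simp
        _ ≤ 1 / σ₀ ^ 2 * (S * L ^ 2) := by gcongr; linarith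
        _ ≤ _ := fin1 _ _ (by linarith) (by positivity)
    · simpa [psi2] using (by positivity : 0 ≤ K * (S * L ^ 2))
    · simpa [psi2] using (by positivity : 0 ≤ K * (S * L ^ 2))
    · simpa [psi2] using (by positivity : 0 ≤ K * (S * L ^ 2))
    · simp only [psi2, Fin.mk_one, Matrix.cons_val_one, Matrix.of_apply, Matrix.cons_val', Matrix.cons_val]
      rw [abs_mul, abs_of_nonneg hE0]
      have : |θ 2 ^ 2 / θ 1 ^ 2 - θ 2 / θ 1 ^ 2| ≤ 24 / δ₀ ^ 2 := by
        have e : θ 2 ^ 2 / θ 1 ^ 2 - θ 2 / θ 1 ^ 2 = (θ 2 ^ 2 - θ 2) / θ 1 ^ 2 := by ring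
        rw [e, abs_div, abs_of_pos (by positivity : 0 < θ 1 ^ 2)]
        have : |θ 2 ^ 2 - θ 2| ≤ 6 := by rw [abs_le]; constructor <;> nlinarith only [p2, h2']
        calc _ ≤ 6 / (δ₀ / 2) ^ 2 := by gcongr
          _ = _ := by field_simp; norm_num
      calc _ ≤ 24 / δ₀ ^ 2 * (B * S) := by gcongr
        _ = 24 / δ₀ ^ 2 * B * S := by ring
        _ ≤ 24 / δ₀ ^ 2 * B * (S * L ^ 2) := by gcongr; linarith
        _ ≤ _ := fin1 _ _ (by linarith) (by positivity)
    · simpa [psi2] using mid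
    · simpa [psi2] using (by positivity : 0 ≤ K * (S * L ^ 2))
    · simpa [psi2] using mid
    · simp only [psi2, Fin.reduceFinMk, Matrix.of_apply, Matrix.cons_val', Matrix.cons_val]
      rw [abs_mul, abs_of_nonneg hE0, abs_pow]
      calc _ ≤ ((A + 1) * L) ^ 2 * (B * S) := by gcongr
        _ = (A + 1) ^ 2 * B * (S * L ^ 2) := by ring
        _ ≤ _ := fin1 _ _ (by linarith) (by positivity)
  · apply Real.exp_le_exp.2
    have : τ ^ 2 / 8 ≤ θ 0 ^ 2 * τ ^ 2 / (2 * σ₀ ^ 2) := by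
      rw [div_le_div_iff₀ (by norm_num) (by positivity)]
      have : σ₀ ^ 2 ≤ 4 * θ 0 ^ 2 := by nlinarith only [h0, hσ]
      linarith only [mul_le_mul_of_nonneg_left this (sq_nonneg τ)]
    unfold psi
    linarith

/-- first and second derivatives of `PF`. -/
def PF1 (n : ℕ) (σ₀ : ℝ) (θ : Fin 3 → ℝ) (j : Fin 3) (x : ℝ) : ℝ :=
  FT (fun τ => -psi1 n σ₀ θ τ j * Real.exp (-psi n σ₀ θ τ)) x

def PF2 (n : ℕ) (σ₀ : ℝ) (θ : Fin 3 → ℝ) (i j : Fin 3) (x : ℝ) : ℝ :=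
  FT (fun τ => (psi1 n σ₀ θ τ i * psi1 n σ₀ θ τ j - psi2 n σ₀ θ τ i j)
    * Real.exp (-psi n σ₀ θ τ)) x

lemma measurable_ell (n : ℕ) (σ₀ : ℝ) (θ : Fin 3 → ℝ) : Measurable (ell n σ₀ θ) := by
  unfold ell; fun_prop

lemma measurable_Efun (n : ℕ) (σ₀ : ℝ) (θ : Fin 3 → ℝ) : Measurable (Efun n σ₀ θ) := by
  have := measurable_ell n σ₀ θ
  unfold Efun; fun_prop

lemma measurable_psi (n : ℕ) (σ₀ : ℝ) (θ : Fin 3 → ℝ) : Measurable (psi n σ₀ θ) := by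
  have := measurable_Efun n σ₀ θ
  unfold psi; fun_prop

lemma measurable_psi1 (n : ℕ) (σ₀ : ℝ) (θ : Fin 3 → ℝ) (j : Fin 3) :
    Measurable (fun τ => psi1 n σ₀ θ τ j) := by
  have := measurable_Efun n σ₀ θ
  have := measurable_ell n σ₀ θ
  fin_cases j <;> simp [psi1] <;> fun_prop

lemma measurable_psi2 (n : ℕ) (σ₀ : ℝ) (θ : Fin 3 → ℝ) (i j : Fin 3) :
    Measurable (fun τ => psi2 n σ₀ θ τ i j) := by
  have := measurable_Efun n σ₀ θ
  have := measurable_ell n σ₀ θ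
  fin_cases i <;> fin_cases j <;> simp [psi2] <;> fun_prop

end


section

section hess
variable {σ₀ δ₀ α₀ : ℝ} {n : ℕ}

lemma Box_pos {σ₀ δ₀ α₀ : ℝ} (hσ : 0 < σ₀) (hδ : 0 < δ₀) (hα : α₀ ∈ Ioo (0 : ℝ) 2)
    {θ : Fin 3 → ℝ} (hθ : θ ∈ Box σ₀ δ₀ α₀) : 0 < θ 0 ∧ 0 < θ 1 ∧ 0 < θ 2 := by
  obtain ⟨h0, h0', h1, h1', h2, h2'⟩ := hθ
  exact ⟨by linarith, by linarith, by linarith [hα.1]⟩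

lemma PF_deriv (θ : Fin 3 → ℝ) (hσ : 0 < σ₀) (hδ : 0 < δ₀) (hα : α₀ ∈ Ioo (0 : ℝ) 2)
    (hn : 1 ≤ n) (hθ : θ ∈ Box σ₀ δ₀ α₀) (j : Fin 3) (x : ℝ) :
    HasDerivAt (fun t => PF n σ₀ (Function.update θ j t) x) (PF1 n σ₀ θ j x) (θ j) := by
  obtain ⟨K, hK, hb⟩ := box_bounds hσ hδ hα hn
  have key := FT_hasDerivAt (F := fun t τ => Real.exp (-psi n σ₀ (Function.update θ j t) τ))
    (F' := fun t τ => -psi1 n σ₀ (Function.update θ j t) τ j *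
      Real.exp (-psi n σ₀ (Function.update θ j t) τ)) (t₀ := θ j) (K := K) (Box_update hθ j)
    ?_ ?_ ?_ ?_ ?_ x
  · simpa [PF, PF1] using key
  · intro t; exact (measurable_psi _ _ _).neg.exp
  · intro t; exact (measurable_psi1 _ _ _ _).neg.mul (measurable_psi _ _ _).neg.exp
  · intro τ hτ
    simp only [Function.update_eq_self]
    rw [abs_of_pos (Real.exp_pos _)]
    refine (hb θ hθ τ hτ).2.2.trans ?_
    unfold domF
    have a1 : 1 ≤ (1 + τ) ^ 4 := one_le_pow₀ (by linarith)
    have a2 : 1 ≤ (1 + |Real.log τ|) ^ 2 := one_le_pow₀ (by linarith [abs_nonneg (Real.log τ)])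
    have := Real.exp_pos (-(τ ^ 2 / 8))
    calc Real.exp (-(τ ^ 2 / 8)) = 1 * (1 * 1 * Real.exp (-(τ ^ 2 / 8))) := by ring
      _ ≤ _ := by gcongr
  · intro t ht τ hτ
    have h := psi_deriv n σ₀ (Function.update θ j t) (Box_pos hσ hδ hα ht).2.1 τ j
    simp only [Function.update_idem, Function.update_self] at h
    refine (h.neg.exp).congr_deriv ?_
    simp only [Pi.neg_apply]
    ring
  · intro t ht τ hτ
    obtain ⟨h1, h2, h3⟩ := hb _ ht τ hτ
    rw [abs_mul, abs_neg, abs_of_pos (Real.exp_pos _)]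
    unfold domF
    have a1 : 1 ≤ (1 + τ) := (by linarith)
    have a2 : 1 ≤ (1 + |Real.log τ|)  := (by linarith [abs_nonneg (Real.log τ)])
    calc _ ≤ K * ((1 + τ) ^ 2 * (1 + |Real.log τ|)) * Real.exp (-(τ ^ 2 / 8)) := by
            gcongr; exact h1 j
      _ ≤ K * ((1 + τ) ^ 4 * (1 + |Real.log τ|) ^ 2) * Real.exp (-(τ ^ 2 / 8)) := by
            gcongr
            · norm_num
            · exact le_self_pow₀ a2 (by norm_num)
      _ = _ := by ring

lemma PF1_deriv (θ : Fin 3 → ℝ) (hσ : 0 < σ₀) (hδ : 0 < δ₀) (hα : α₀ ∈ Ioo (0 : ℝ) 2)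
    (hn : 1 ≤ n) (hθ : θ ∈ Box σ₀ δ₀ α₀) (i j : Fin 3) (x : ℝ) :
    HasDerivAt (fun t => PF1 n σ₀ (Function.update θ i t) j x) (PF2 n σ₀ θ i j x) (θ i) := by
  obtain ⟨K, hK, hb⟩ := box_bounds hσ hδ hα hn
  have key := FT_hasDerivAt (F := fun t τ => -psi1 n σ₀ (Function.update θ i t) τ j *
      Real.exp (-psi n σ₀ (Function.update θ i t) τ))
    (F' := fun t τ => (psi1 n σ₀ (Function.update θ i t) τ i * psi1 n σ₀ (Function.update θ i t) τ j
      - psi2 n σ₀ (Function.update θ i t) τ i j) *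
      Real.exp (-psi n σ₀ (Function.update θ i t) τ)) (t₀ := θ i) (K := K ^ 2 + K) (Box_update hθ i)
    ?_ ?_ ?_ ?_ ?_ x
  · simpa [PF1, PF2] using key
  · intro t; exact (measurable_psi1 _ _ _ _).neg.mul (measurable_psi _ _ _).neg.exp
  · intro t
    exact (((measurable_psi1 _ _ _ _).mul (measurable_psi1 _ _ _ _)).sub
      (measurable_psi2 _ _ _ _ _)).mul (measurable_psi _ _ _).neg.exp
  · intro τ hτ
    simp only [Function.update_eq_self]
    obtain ⟨h1, h2, h3⟩ := hb _ hθ τ hτ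
    rw [abs_mul, abs_neg, abs_of_pos (Real.exp_pos _)]
    unfold domF
    have a1 : 1 ≤ (1 + τ) := (by linarith)
    have a2 : 1 ≤ (1 + |Real.log τ|)  := (by linarith [abs_nonneg (Real.log τ)])
    calc _ ≤ K * ((1 + τ) ^ 2 * (1 + |Real.log τ|)) * Real.exp (-(τ ^ 2 / 8)) := by
            gcongr; exact h1 j
      _ ≤ (K ^ 2 + K) * ((1 + τ) ^ 4 * (1 + |Real.log τ|) ^ 2) * Real.exp (-(τ ^ 2 / 8)) := by
            gcongr
            · nlinarith
            · norm_num
            · exact le_self_pow₀ a2 (by norm_num)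
      _ = _ := by ring
  · intro t ht τ hτ
    have h := psi_deriv n σ₀ (Function.update θ i t) (Box_pos hσ hδ hα ht).2.1 τ i
    simp only [Function.update_idem, Function.update_self] at h
    have h' := psi1_deriv n σ₀ (Function.update θ i t) (Box_pos hσ hδ hα ht).2.1 τ i j
    simp only [Function.update_idem, Function.update_self] at h'
    refine (h'.neg.mul h.neg.exp).congr_deriv ?_
    simp only [Pi.neg_apply]
    ring
  · intro t ht τ hτ
    obtain ⟨h1, h2, h3⟩ := hb _ ht τ hτ
    rw [abs_mul, abs_of_pos (Real.exp_pos _)]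
    unfold domF
    have a1 : 1 ≤ (1 + τ) := (by linarith)
    have a2 : 1 ≤ (1 + |Real.log τ|)  := (by linarith [abs_nonneg (Real.log τ)])
    set L := 1 + |Real.log τ|
    set θ' := Function.update θ i t
    have b : |psi1 n σ₀ θ' τ i * psi1 n σ₀ θ' τ j - psi2 n σ₀ θ' τ i j|
        ≤ (K ^ 2 + K) * ((1 + τ) ^ 4 * L ^ 2) := by
      refine (abs_sub _ _).trans ?_
      rw [abs_mul]
      have h22 := h2 i j
      calc _ ≤ (K * ((1 + τ) ^ 2 * L)) * (K * ((1 + τ) ^ 2 * L)) + K * ((1 + τ) ^ 2 * L ^ 2) := by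
            gcongr
            · exact h1 i
            · exact h1 j
        _ ≤ (K * ((1 + τ) ^ 2 * L)) * (K * ((1 + τ) ^ 2 * L)) + K * ((1 + τ) ^ 4 * L ^ 2) := by
            gcongr
            norm_num
        _ = _ := by ring
    calc _ ≤ (K ^ 2 + K) * ((1 + τ) ^ 4 * L ^ 2) * Real.exp (-(τ ^ 2 / 8)) := by gcongr
      _ = _ := by ring

lemma logLik_deriv (θ : Fin 3 → ℝ) (hσ : 0 < σ₀) (hδ : 0 < δ₀) (hα : α₀ ∈ Ioo (0 : ℝ) 2)
    (hn : 1 ≤ n) (hθ : θ ∈ Box σ₀ δ₀ α₀) (j : Fin 3) (y : Fin n → ℝ)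
    (hpos : ∀ k, 0 < PF n σ₀ θ (Real.sqrt n * y k / σ₀)) :
    pderiv j (fun θ'' => logLik n θ'' y) θ = ∑ k, PF1 n σ₀ θ j (Real.sqrt n * y k / σ₀)
      / PF n σ₀ θ (Real.sqrt n * y k / σ₀) := by
  have hn0 : (0 : ℝ) < n := by exact_mod_cast hn
  have hc : Real.sqrt n / σ₀ ≠ 0 := by positivity
  have hd : HasDerivAt (fun t => ∑ k, Real.log (Real.sqrt n / σ₀ *
      PF n σ₀ (Function.update θ j t) (Real.sqrt n * y k / σ₀)))
      (∑ k, PF1 n σ₀ θ j (Real.sqrt n * y k / σ₀)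
      / PF n σ₀ θ (Real.sqrt n * y k / σ₀)) (θ j) := by
    refine HasDerivAt.fun_sum fun k _ => ?_
    have h := ((PF_deriv θ hσ hδ hα hn hθ j (Real.sqrt n * y k / σ₀)).const_mul
      (Real.sqrt n / σ₀)).log ?_
    · refine h.congr_deriv ?_
      simp only [Function.update_eq_self]
      rw [mul_div_mul_left _ _ hc]
    · simp only [Function.update_eq_self]
      exact mul_ne_zero hc (hpos k).ne'
  unfold pderiv
  refine (hd.congr_of_eventuallyEq (f₁ := fun t => logLik n (Function.update θ j t) y) ?_).deriv
  filter_upwards [Box_update hθ j] with t ht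
  unfold logLik
  obtain ⟨h0, h1, h2⟩ := Box_pos hσ hδ hα ht
  simp only [pdens_eq hn hσ h0 h1 h2]

lemma hess_eq (θ : Fin 3 → ℝ) (hσ : 0 < σ₀) (hδ : 0 < δ₀) (hα : α₀ ∈ Ioo (0 : ℝ) 2)
    (hn : 1 ≤ n) (hθ : θ ∈ Box σ₀ δ₀ α₀) (y : Fin n → ℝ)
    (hpos : ∀ x, 0 < PF n σ₀ θ x) (i j : Fin 3) :
    hessMat n θ y i j = ∑ k, (fun x => PF2 n σ₀ θ i j x / PF n σ₀ θ x
      - PF1 n σ₀ θ i x / PF n σ₀ θ x * (PF1 n σ₀ θ j x / PF n σ₀ θ x))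
        (Real.sqrt n * y k / σ₀) := by
  have hd : HasDerivAt (fun t => ∑ k, PF1 n σ₀ (Function.update θ i t) j (Real.sqrt n * y k / σ₀)
      / PF n σ₀ (Function.update θ i t) (Real.sqrt n * y k / σ₀))
      (∑ k, (fun x => PF2 n σ₀ θ i j x / PF n σ₀ θ x
      - PF1 n σ₀ θ i x / PF n σ₀ θ x * (PF1 n σ₀ θ j x / PF n σ₀ θ x))
        (Real.sqrt n * y k / σ₀)) (θ i) := by
    refine HasDerivAt.fun_sum fun k _ => ?_
    have hp := (hpos (Real.sqrt n * y k / σ₀)).ne'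
    have h := (PF1_deriv θ hσ hδ hα hn hθ i j (Real.sqrt n * y k / σ₀)).div
      (PF_deriv θ hσ hδ hα hn hθ i (Real.sqrt n * y k / σ₀)) (by simpa using hp)
    refine h.congr_deriv ?_
    simp only [Function.update_eq_self]
    field_simp
  have hev : ∀ᶠ t in 𝓝 (θ i), ∀ k, 0 < PF n σ₀ (Function.update θ i t) (Real.sqrt n * y k / σ₀) := by
    rw [eventually_all]
    intro k
    have := (PF_deriv θ hσ hδ hα hn hθ i (Real.sqrt n * y k / σ₀)).continuousAt
    refine this.eventually_const_lt ?_
    simpa using hpos _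
  simp only [hessMat, Matrix.of_apply]
  rw [pderiv]
  refine (hd.congr_of_eventuallyEq (f₁ := fun t =>
    pderiv j (fun θ'' => logLik n θ'' y) (Function.update θ i t)) ?_).deriv
  filter_upwards [Box_update hθ i, hev] with t ht hp
  exact logLik_deriv _ hσ hδ hα hn ht j y hp

end hess

end


section

def vn (n : ℕ) (σ δ α : ℝ) : ℝ := (n : ℝ) ^ (α / 2 - 1) * (δ / σ) ^ α

def lam (n : ℕ) (σ δ : ℝ) : ℝ := Real.log δ + (Real.log n / 2 - Real.log σ)

lemma FT_congr {G H : ℝ → ℝ} (h : ∀ τ > 0, G τ = H τ) (x : ℝ) : FT G x = FT H x := by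
  unfold FT
  congr 1
  refine setIntegral_congr_fun measurableSet_Ioi fun τ hτ => ?_
  simp only [h τ hτ]

lemma FT_lc {α : ℝ} (hα : α ∈ Ioo (0 : ℝ) 2) {v : ℝ} (hv : 0 ≤ v) {m : ℕ} (c a : Fin m → ℝ)
    (b : Fin m → ℕ) (ha : ∀ i, 0 ≤ a i) {G : ℝ → ℝ}
    (h : ∀ τ > 0, G τ = ∑ i, c i * Gq α v (a i) (b i) τ) (x : ℝ) :
    FT G x = ∑ i, c i * T α v (a i) (b i) x := by
  rw [FT_congr h]
  unfold T FT
  have : ∀ τ, Real.cos (x * τ) * ∑ i, c i * Gq α v (a i) (b i) τ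
      = ∑ i, c i * (Real.cos (x * τ) * Gq α v (a i) (b i) τ) := by
    intro τ; rw [Finset.mul_sum]; refine Finset.sum_congr rfl fun i _ => by ring
  simp_rw [this]
  rw [integral_finset_sum _ fun i _ =>
    (integrableOn_cos_mul (Gq_integrableOn hα (ha i) (b i) hv) x).const_mul _, Finset.mul_sum]
  refine Finset.sum_congr rfl fun i _ => ?_
  rw [integral_const_mul]; ring

lemma FT_continuous {G : ℝ → ℝ} (hG : IntegrableOn G (Ioi 0)) : Continuous (FT G) := by
  unfold FT
  refine continuous_const.mul ?_
  refine continuous_of_dominated (bound := fun τ => |G τ|) (fun x => ?_) (fun x => ?_) hG.norm ?_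
  · exact (integrableOn_cos_mul hG x).aestronglyMeasurable
  · refine ae_of_all _ fun τ => ?_
    rw [norm_mul, Real.norm_eq_abs, Real.norm_eq_abs]
    exact mul_le_of_le_one_left (abs_nonneg _) (Real.abs_cos_le_one _)
  · exact ae_of_all _ fun τ => by fun_prop

lemma T_continuous {α : ℝ} (hα : α ∈ Ioo (0 : ℝ) 2) {a : ℝ} (ha : 0 ≤ a) (b : ℕ) {v : ℝ}
    (hv : 0 ≤ v) : Continuous (T α v a b) := FT_continuous (Gq_integrableOn hα ha b hv)

section forms
variable {σ δ α : ℝ} {n : ℕ}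

lemma vn_pos (hσ : 0 < σ) (hδ : 0 < δ) (hn : 1 ≤ n) : 0 < vn n σ δ α := by
  have : (0 : ℝ) < n := by exact_mod_cast hn
  unfold vn; positivity

lemma ell_at (τ : ℝ) : ell n σ ![σ, δ, α] τ = lam n σ δ + Real.log τ := by
  simp [ell, lam]

lemma Efun_at (hσ : 0 < σ) (hδ : 0 < δ) (hn : 1 ≤ n) {τ : ℝ} (hτ : 0 < τ) :
    Efun n σ ![σ, δ, α] τ = vn n σ δ α * τ ^ α := by
  have hn0 : (0 : ℝ) < n := by exact_mod_cast hn
  rw [Efun, ell_at, vn, lam]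
  simp only [Matrix.cons_val]
  rw [Real.rpow_def_of_pos hn0, Real.rpow_def_of_pos (by positivity : 0 < δ / σ),
    Real.rpow_def_of_pos hτ, Real.log_div hδ.ne' hσ.ne']
  nth_rewrite 2 [← Real.exp_log hn0]
  rw [← Real.exp_sub, ← Real.exp_add, ← Real.exp_add]
  congr 1; ring

lemma exp_psi_at (hσ : 0 < σ) (hδ : 0 < δ) (hn : 1 ≤ n) {τ : ℝ} (hτ : 0 < τ) :
    Real.exp (-psi n σ ![σ, δ, α] τ) = Real.exp (-(τ ^ 2 / 2) - vn n σ δ α * τ ^ α) := by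
  rw [psi, Efun_at hσ hδ hn hτ]
  congr 1
  simp only [Matrix.cons_val_zero]
  field_simp
  ring

lemma PF_at (hσ : 0 < σ) (hδ : 0 < δ) (hn : 1 ≤ n) (x : ℝ) :
    PF n σ ![σ, δ, α] x = T α (vn n σ δ α) 0 0 x := by
  refine FT_congr (fun τ hτ => ?_) x
  rw [exp_psi_at hσ hδ hn hτ]; simp [Gq]

lemma PF1_at0 (hσ : 0 < σ) (hδ : 0 < δ) (hα : α ∈ Ioo (0 : ℝ) 2) (hn : 1 ≤ n) (x : ℝ) :
    PF1 n σ ![σ, δ, α] 0 x = -(1 / σ) * T α (vn n σ δ α) 2 0 x := by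
  have h := FT_lc hα (vn_pos (α := α) hσ hδ hn).le (c := ![-(1 / σ)]) (a := ![2]) (b := ![0])
    (by intro i; fin_cases i; norm_num) (G := fun τ => -psi1 n σ ![σ, δ, α] τ 0 * Real.exp (-psi n σ ![σ, δ, α] τ)) ?_ x
  · simpa [PF1] using h
  · intro τ hτ
    rw [exp_psi_at hσ hδ hn hτ]
    simp [Gq, psi1]
    field_simp

lemma PF1_at1 (hσ : 0 < σ) (hδ : 0 < δ) (hα : α ∈ Ioo (0 : ℝ) 2) (hn : 1 ≤ n) (x : ℝ) :
    PF1 n σ ![σ, δ, α] 1 x = -(α / δ) * vn n σ δ α * T α (vn n σ δ α) α 0 x := by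
  have hα0 := hα.1.le
  have h := FT_lc hα (vn_pos (α := α) hσ hδ hn).le (c := ![-(α / δ) * vn n σ δ α]) (a := ![α]) (b := ![0])
    (by intro i; fin_cases i; simpa) (G := fun τ => -psi1 n σ ![σ, δ, α] τ 1 * Real.exp (-psi n σ ![σ, δ, α] τ)) ?_ x
  · simpa [PF1] using h
  · intro τ hτ
    rw [exp_psi_at hσ hδ hn hτ]
    simp [Gq, psi1, Efun_at hσ hδ hn hτ]
    ring

lemma PF1_at2 (hσ : 0 < σ) (hδ : 0 < δ) (hα : α ∈ Ioo (0 : ℝ) 2) (hn : 1 ≤ n) (x : ℝ) :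
    PF1 n σ ![σ, δ, α] 2 x = -vn n σ δ α * (lam n σ δ * T α (vn n σ δ α) α 0 x
      + T α (vn n σ δ α) α 1 x) := by
  have hα0 := hα.1.le
  have h := FT_lc hα (vn_pos (α := α) hσ hδ hn).le (c := ![-vn n σ δ α * lam n σ δ, -vn n σ δ α])
    (a := ![α, α]) (b := ![0, 1])
    (by intro i; fin_cases i <;> simpa) (G := fun τ => -psi1 n σ ![σ, δ, α] τ 2 * Real.exp (-psi n σ ![σ, δ, α] τ)) ?_ x
  · simp only [PF1]; rw [h]; simp [Fin.sum_univ_two]; ring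
  · intro τ hτ
    rw [exp_psi_at hσ hδ hn hτ]
    simp [Gq, psi1, Efun_at hσ hδ hn hτ, ell_at, Fin.sum_univ_two]
    ring

lemma PF2_at00 (hσ : 0 < σ) (hδ : 0 < δ) (hα : α ∈ Ioo (0 : ℝ) 2) (hn : 1 ≤ n) (x : ℝ) :
    PF2 n σ ![σ, δ, α] 0 0 x = 1 / σ ^ 2 * (T α (vn n σ δ α) 4 0 x - T α (vn n σ δ α) 2 0 x) := by
  have h := FT_lc hα (vn_pos (α := α) hσ hδ hn).le (c := ![1 / σ ^ 2, -(1 / σ ^ 2)])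
    (a := ![4, 2]) (b := ![0, 0])
    (by intro i; fin_cases i <;> simp) (G := fun τ => (psi1 n σ ![σ, δ, α] τ 0 * psi1 n σ ![σ, δ, α] τ 0
      - psi2 n σ ![σ, δ, α] τ 0 0) * Real.exp (-psi n σ ![σ, δ, α] τ)) ?_ x
  · simp only [PF2]; rw [h]; simp [Fin.sum_univ_two]; ring
  · intro τ hτ
    rw [exp_psi_at hσ hδ hn hτ]
    have e4 : τ ^ (4 : ℝ) = τ ^ 4 := by norm_cast
    simp [Gq, psi1, psi2, Fin.sum_univ_two, e4]
    field_simp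
    ring

lemma PF2_at01 (hσ : 0 < σ) (hδ : 0 < δ) (hα : α ∈ Ioo (0 : ℝ) 2) (hn : 1 ≤ n) (x : ℝ) :
    PF2 n σ ![σ, δ, α] 0 1 x = α / (σ * δ) * vn n σ δ α * T α (vn n σ δ α) (2 + α) 0 x := by
  have hα0 := hα.1.le
  have h := FT_lc hα (vn_pos (α := α) hσ hδ hn).le (c := ![α / (σ * δ) * vn n σ δ α])
    (a := ![2 + α]) (b := ![0])
    (by intro i; fin_cases i; simp; linarith) (G := fun τ => (psi1 n σ ![σ, δ, α] τ 0 * psi1 n σ ![σ, δ, α] τ 1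
      - psi2 n σ ![σ, δ, α] τ 0 1) * Real.exp (-psi n σ ![σ, δ, α] τ)) ?_ x
  · simp only [PF2]; rw [h]; simp
  · intro τ hτ
    rw [exp_psi_at hσ hδ hn hτ]
    simp [Gq, psi1, psi2, Efun_at hσ hδ hn hτ, Real.rpow_add hτ]
    field_simp

lemma PF2_at02 (hσ : 0 < σ) (hδ : 0 < δ) (hα : α ∈ Ioo (0 : ℝ) 2) (hn : 1 ≤ n) (x : ℝ) :
    PF2 n σ ![σ, δ, α] 0 2 x = vn n σ δ α / σ * (lam n σ δ * T α (vn n σ δ α) (2 + α) 0 x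
      + T α (vn n σ δ α) (2 + α) 1 x) := by
  have hα0 := hα.1.le
  have h := FT_lc hα (vn_pos (α := α) hσ hδ hn).le (c := ![vn n σ δ α / σ * lam n σ δ, vn n σ δ α / σ])
    (a := ![2 + α, 2 + α]) (b := ![0, 1])
    (by intro i; fin_cases i <;> simp <;> linarith) (G := fun τ => (psi1 n σ ![σ, δ, α] τ 0 * psi1 n σ ![σ, δ, α] τ 2
      - psi2 n σ ![σ, δ, α] τ 0 2) * Real.exp (-psi n σ ![σ, δ, α] τ)) ?_ x
  · simp only [PF2]; rw [h]; simp [Fin.sum_univ_two]; ring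
  · intro τ hτ
    rw [exp_psi_at hσ hδ hn hτ]
    simp [Gq, psi1, psi2, Efun_at hσ hδ hn hτ, Real.rpow_add hτ, ell_at, Fin.sum_univ_two]
    field_simp

lemma PF2_at11 (hσ : 0 < σ) (hδ : 0 < δ) (hα : α ∈ Ioo (0 : ℝ) 2) (hn : 1 ≤ n) (x : ℝ) :
    PF2 n σ ![σ, δ, α] 1 1 x = vn n σ δ α * (α ^ 2 / δ ^ 2 * vn n σ δ α * T α (vn n σ δ α) (α + α) 0 x
      - (α ^ 2 - α) / δ ^ 2 * T α (vn n σ δ α) α 0 x) := by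
  have hα0 := hα.1.le
  have h := FT_lc hα (vn_pos (α := α) hσ hδ hn).le (c := ![vn n σ δ α * (α ^ 2 / δ ^ 2 * vn n σ δ α),
      -(vn n σ δ α * ((α ^ 2 - α) / δ ^ 2))])
    (a := ![α + α, α]) (b := ![0, 0])
    (by intro i; fin_cases i <;> simp <;> linarith) (G := fun τ => (psi1 n σ ![σ, δ, α] τ 1 * psi1 n σ ![σ, δ, α] τ 1
      - psi2 n σ ![σ, δ, α] τ 1 1) * Real.exp (-psi n σ ![σ, δ, α] τ)) ?_ x
  · simp only [PF2]; rw [h]; simp [Fin.sum_univ_two]; ring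
  · intro τ hτ
    rw [exp_psi_at hσ hδ hn hτ]
    simp [Gq, psi1, psi2, Efun_at hσ hδ hn hτ, Real.rpow_add hτ, Fin.sum_univ_two]
    field_simp
    ring

lemma PF2_at12 (hσ : 0 < σ) (hδ : 0 < δ) (hα : α ∈ Ioo (0 : ℝ) 2) (hn : 1 ≤ n) (x : ℝ) :
    PF2 n σ ![σ, δ, α] 1 2 x = vn n σ δ α * (α / δ * vn n σ δ α * (lam n σ δ * T α (vn n σ δ α) (α + α) 0 x
        + T α (vn n σ δ α) (α + α) 1 x)
      - ((1 / δ + α / δ * lam n σ δ) * T α (vn n σ δ α) α 0 x + α / δ * T α (vn n σ δ α) α 1 x)) := by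
  have hα0 := hα.1.le
  have h := FT_lc hα (vn_pos (α := α) hσ hδ hn).le (c := ![vn n σ δ α * (α / δ * vn n σ δ α) * lam n σ δ,
      vn n σ δ α * (α / δ * vn n σ δ α), -(vn n σ δ α * (1 / δ + α / δ * lam n σ δ)),
      -(vn n σ δ α * (α / δ))])
    (a := ![α + α, α + α, α, α]) (b := ![0, 1, 0, 1])
    (by intro i; fin_cases i <;> simp <;> linarith) (G := fun τ => (psi1 n σ ![σ, δ, α] τ 1 * psi1 n σ ![σ, δ, α] τ 2
      - psi2 n σ ![σ, δ, α] τ 1 2) * Real.exp (-psi n σ ![σ, δ, α] τ)) ?_ x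
  · simp only [PF2]; rw [h]; simp [Fin.sum_univ_four]; ring
  · intro τ hτ
    rw [exp_psi_at hσ hδ hn hτ]
    simp [Gq, psi1, psi2, Efun_at hσ hδ hn hτ, Real.rpow_add hτ, ell_at, Fin.sum_univ_four]
    ring

lemma PF2_at22 (hσ : 0 < σ) (hδ : 0 < δ) (hα : α ∈ Ioo (0 : ℝ) 2) (hn : 1 ≤ n) (x : ℝ) :
    PF2 n σ ![σ, δ, α] 2 2 x = vn n σ δ α * (vn n σ δ α * (lam n σ δ ^ 2 * T α (vn n σ δ α) (α + α) 0 x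
        + 2 * lam n σ δ * T α (vn n σ δ α) (α + α) 1 x + T α (vn n σ δ α) (α + α) 2 x)
      - (lam n σ δ ^ 2 * T α (vn n σ δ α) α 0 x + 2 * lam n σ δ * T α (vn n σ δ α) α 1 x
        + T α (vn n σ δ α) α 2 x)) := by
  have hα0 := hα.1.le
  have h := FT_lc hα (vn_pos (α := α) hσ hδ hn).le (c := ![vn n σ δ α ^ 2 * lam n σ δ ^ 2,
      vn n σ δ α ^ 2 * (2 * lam n σ δ), vn n σ δ α ^ 2, -(vn n σ δ α * lam n σ δ ^ 2),
      -(vn n σ δ α * (2 * lam n σ δ)), -vn n σ δ α])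
    (a := ![α + α, α + α, α + α, α, α, α]) (b := ![0, 1, 2, 0, 1, 2])
    (by intro i; fin_cases i <;> simp <;> linarith) (G := fun τ => (psi1 n σ ![σ, δ, α] τ 2 * psi1 n σ ![σ, δ, α] τ 2
      - psi2 n σ ![σ, δ, α] τ 2 2) * Real.exp (-psi n σ ![σ, δ, α] τ)) ?_ x
  · simp only [PF2]; rw [h]; simp [Fin.sum_univ_six]; ring
  · intro τ hτ
    rw [exp_psi_at hσ hδ hn hτ]
    simp [Gq, psi1, psi2, Efun_at hσ hδ hn hτ, Real.rpow_add hτ, ell_at, Fin.sum_univ_six]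
    ring

lemma PF2_symm (θ : Fin 3 → ℝ) (i j : Fin 3) (x : ℝ) : PF2 n σ θ i j x = PF2 n σ θ j i x := by
  unfold PF2
  have : ∀ τ, psi2 n σ θ τ i j = psi2 n σ θ τ j i := by
    intro τ
    fin_cases i <;> fin_cases j <;> simp [psi2]
  simp only [this, mul_comm (psi1 n σ θ _ i)]

end forms

end


section

lemma fourier_FT {G : ℝ → ℝ} (hG : IntegrableOn G (Ioi 0)) (w : ℝ) :
    FourierTransform.fourier (fun t : ℝ => ((G |t| : ℝ) : ℂ)) w
      = ((2 * Real.pi * FT G (2 * Real.pi * w) : ℝ) : ℂ) := by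
  rw [Real.fourier_real_eq_integral_exp_smul]
  set y := 2 * Real.pi * w with hy
  have hi := integrable_comp_abs' hG
  have i1 : Integrable (fun t : ℝ => Real.cos (y * t) * G |t|) := by
    refine hi.bdd_mul (c := 1) (by fun_prop : Continuous _).aestronglyMeasurable ?_
    exact ae_of_all _ fun τ => by simpa using Real.abs_cos_le_one _
  have i2 : Integrable (fun t : ℝ => Real.sin (y * t) * G |t|) := by
    refine hi.bdd_mul (c := 1) (by fun_prop : Continuous _).aestronglyMeasurable ?_
    exact ae_of_all _ fun τ => by simpa using Real.abs_sin_le_one _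
  have e : ∀ t : ℝ, Complex.exp (((-2 * Real.pi * t * w : ℝ) : ℂ) * Complex.I) • ((G |t| : ℝ) : ℂ)
      = ((Real.cos (y * t) * G |t| : ℝ) : ℂ) - Complex.I * ((Real.sin (y * t) * G |t| : ℝ) : ℂ) := by
    intro t
    rw [show -2 * Real.pi * t * w = -(y * t) by rw [hy]; ring, Complex.exp_mul_I,
      ← Complex.ofReal_cos, ← Complex.ofReal_sin, Real.cos_neg, Real.sin_neg]
    push_cast
    rw [smul_eq_mul]; ring
  simp_rw [e]
  rw [integral_sub i1.ofReal (i2.ofReal.const_mul _), integral_const_mul, integral_complex_ofReal, integral_complex_ofReal]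
  have h2 : ∫ t : ℝ, Real.sin (y * t) * G |t| = 0 := by
    have := integral_neg_eq_self (fun t : ℝ => Real.sin (y * t) * G |t|) volume
    simp only [abs_neg, mul_neg, Real.sin_neg, neg_mul, integral_neg] at this
    linarith
  have h1 : ∫ t : ℝ, Real.cos (y * t) * G |t| = 2 * Real.pi * FT G y := by
    have : ∀ t : ℝ, Real.cos (y * t) * G |t| = (fun s => Real.cos (y * s) * G s) |t| := by
      intro t
      simp only
      congr 1
      rcases abs_choice t with h | h <;> rw [h]
      rw [mul_neg, Real.cos_neg]
    simp_rw [this]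
    rw [integral_comp_abs (f := fun s => Real.cos (y * s) * G s), FT]
    have := Real.pi_pos
    field_simp
  rw [h1, h2]
  simp

lemma FT_integral {G : ℝ → ℝ} (hG : IntegrableOn G (Ioi 0))
    (hc : ContinuousAt (fun t => G |t|) 0) (hi : Integrable (FT G)) : ∫ x, FT G x = G 0 := by
  have hpi := Real.pi_pos
  have h2 : (0 : ℝ) < 2 * Real.pi := by positivity
  set g : ℝ → ℂ := fun t : ℝ => ((G |t| : ℝ) : ℂ) with hg
  have i1 : Integrable g := (integrable_comp_abs' hG).ofReal
  have hf : FourierTransform.fourier g = fun w => ((2 * Real.pi * FT G (2 * Real.pi * w) : ℝ) : ℂ) :=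
    funext fun w => fourier_FT hG w
  have i2 : Integrable (FourierTransform.fourier g) := by
    rw [hf]
    exact ((hi.comp_mul_left' h2.ne').const_mul _).ofReal
  have hgc : ContinuousAt g 0 := Complex.continuous_ofReal.continuousAt.comp hc
  have key := i1.fourierInv_fourier_eq i2 hgc
  rw [Real.fourierInv_eq, hf] at key
  simp only [inner_zero_right, AddChar.map_zero_eq_one, one_smul] at key
  rw [integral_complex_ofReal, hg, integral_const_mul,
    Measure.integral_comp_mul_left (fun u => FT G u) (2 * Real.pi)] at key
  rw [abs_of_pos (by positivity), smul_eq_mul, mul_inv_cancel_left₀ h2.ne'] at key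
  simp only [abs_zero] at key
  exact_mod_cast key

lemma cont_log_rpow {r : ℝ} (hr : 0 < r) : ContinuousAt (fun t : ℝ => Real.log |t| * |t| ^ r) 0 := by
  rw [← continuousWithinAt_compl_self]
  have := (tendsto_log_mul_rpow_nhdsGT_zero hr).comp tendsto_abs_nhdsNE_zero
  simpa [ContinuousWithinAt, Function.comp_def] using this

lemma Gq_cont0 {α v a : ℝ} (hα : 0 < α) (ha : 0 < a) (b : ℕ) :
    ContinuousAt (fun t => Gq α v a b |t|) 0 := by
  set s := a / (2 * (b + 1)) with hs
  have hs0 : 0 < s := by positivity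
  have h1 : ContinuousAt (fun t : ℝ => (Real.log |t| * |t| ^ s) ^ b * |t| ^ (a - s * b)
      * Real.exp (-(|t| ^ 2 / 2) - v * |t| ^ α)) 0 := by
    have c1 : ∀ {r : ℝ}, 0 < r → ContinuousAt (fun t : ℝ => |t| ^ r) 0 := fun hr =>
      continuousAt_id.abs.rpow_const (Or.inr hr.le)
    have hp : 0 < a - s * b := by
      rw [hs, div_mul_eq_mul_div, sub_pos, div_lt_iff₀ (by positivity)]
      nlinarith
    refine (((cont_log_rpow hs0).pow b).mul (c1 hp)).mul ?_
    refine ContinuousAt.rexp ?_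
    exact (by fun_prop : ContinuousAt (fun t : ℝ => -(|t| ^ 2 / 2)) 0).sub
      (continuousAt_const.mul (c1 hα))
  refine h1.congr (Eventually.of_forall fun t => ?_)
  simp only [Gq]
  congr 1
  rcases eq_or_ne t 0 with rfl | ht
  · have hp : 0 < a - s * b := by
      rw [hs, div_mul_eq_mul_div, sub_pos, div_lt_iff₀ (by positivity)]
      nlinarith
    simp [Real.zero_rpow ha.ne', Real.zero_rpow hp.ne']
  · have ht' : 0 < |t| := abs_pos.2 ht
    rw [mul_pow, ← Real.rpow_natCast (|t| ^ s), ← Real.rpow_mul ht'.le, mul_assoc, ← Real.rpow_add ht']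
    rw [show s * b + (a - s * b) = a by ring]
    ring

lemma om_integrable {α : ℝ} (hα : 0 < α) : Integrable (om α) := by
  have := integrable_one_add_norm (E := ℝ) (μ := volume) (r := 1 + 7 * α / 8) (by simp; positivity)
  refine this.congr (ae_of_all _ fun x => ?_)
  simp only [om, Real.norm_eq_abs]
  congr 1; ring

lemma T_integrable {α : ℝ} (hα : α ∈ Ioo (0 : ℝ) 2) {a : ℝ} (ha : α ≤ a) (b : ℕ) {v : ℝ}
    (hv : 0 ≤ v) : Integrable (T α v a b) := by
  obtain ⟨C, hC, h⟩ := T_bound hα ha b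
  exact ((om_integrable hα.1).const_mul C).mono'
    (T_continuous hα (hα.1.le.trans ha) b hv).aestronglyMeasurable (ae_of_all _ fun x => h v hv x)

lemma T_int {α : ℝ} (hα : α ∈ Ioo (0 : ℝ) 2) {a : ℝ} (ha : α ≤ a) (b : ℕ) {v : ℝ}
    (hv : 0 ≤ v) : ∫ x, T α v a b x = 0 := by
  have ha0 : 0 < a := hα.1.trans_le ha
  have := FT_integral (Gq_integrableOn hα ha0.le b hv) (Gq_cont0 hα.1 ha0 b) (T_integrable hα ha b hv)
  simp only [T]
  rw [this]
  simp [Gq, Real.zero_rpow ha0.ne']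

lemma T00_integrable {α : ℝ} (hα : α ∈ Ioo (0 : ℝ) 2) {v : ℝ}
    (hv : 0 ≤ v) : Integrable (T α v 0 0) := by
  obtain ⟨C, hC, h⟩ := f_diff hα
  have h1 : Integrable (fun x => T α v 0 0 x - gauss x) :=
    ((om_integrable hα.1).const_mul (C * v)).mono'
    ((T_continuous hα le_rfl 0 hv).sub continuous_gauss).aestronglyMeasurable
    (ae_of_all _ fun x => h v hv x)
  refine (h1.add gauss_integrable).congr (ae_of_all _ fun x => ?_)
  simp

lemma T00_int {α : ℝ} (hα : α ∈ Ioo (0 : ℝ) 2) {v : ℝ}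
    (hv : 0 ≤ v) : ∫ x, T α v 0 0 x = 1 := by
  have hc : ContinuousAt (fun t => Gq α v 0 0 |t|) 0 := by
    simp only [Gq, Real.rpow_zero, pow_zero, one_mul]
    refine ContinuousAt.rexp ?_
    exact (by fun_prop : ContinuousAt (fun t : ℝ => -(|t| ^ 2 / 2)) 0).sub
      (continuousAt_const.mul (continuousAt_id.abs.rpow_const (Or.inr hα.1.le)))
  have := FT_integral (Gq_integrableOn hα le_rfl 0 hv) hc (T00_integrable hα hv)
  simp only [T]
  rw [this]
  simp [Gq, Real.zero_rpow hα.1.ne']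

end


section

lemma cheb_pi {μ : Measure ℝ} [IsProbabilityMeasure μ] {g : ℝ → ℝ} (hg : MemLp g 2 μ) (n : ℕ)
    {ε : ℝ} (hε : 0 < ε) :
    Measure.pi (fun _ : Fin n => μ) {x | ε ≤ |∑ i, g (x i) - n * ∫ y, g y ∂μ|}
      ≤ ENNReal.ofReal (n * (∫ y, g y ^ 2 ∂μ) / ε ^ 2) := by
  have hm : ∀ i : Fin n, MemLp (fun x : Fin n → ℝ => g (x i)) 2 (Measure.pi (fun _ : Fin n => μ)) :=
    fun i => hg.comp_measurePreserving (measurePreserving_eval (fun _ : Fin n => μ) i)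
  have hX : MemLp (∑ i : Fin n, fun x : Fin n → ℝ => g (x i)) 2 (Measure.pi (fun _ : Fin n => μ)) :=
    memLp_finset_sum' _ fun i _ => hm i
  have h := ProbabilityTheory.meas_ge_le_variance_div_sq hX hε
  have e1 : ∫ x, (∑ i : Fin n, fun x : Fin n → ℝ => g (x i)) x ∂(Measure.pi (fun _ : Fin n => μ))
      = n * ∫ y, g y ∂μ := by
    simp only [Finset.sum_apply]
    rw [integral_finset_sum _ fun i _ => (hm i).integrable one_le_two]
    simp_rw [integral_comp_eval (μ := fun _ : Fin n => μ) hg.1]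
    simp
  rw [e1] at h
  simp only [Finset.sum_apply] at h
  refine h.trans (ENNReal.ofReal_le_ofReal ?_)
  gcongr
  rw [ProbabilityTheory.variance_sum_pi (X := fun _ => g) (fun _ => hg)]
  simp only [Finset.sum_const, Finset.card_univ, Fintype.card_fin, nsmul_eq_mul]
  gcongr
  exact ProbabilityTheory.variance_le_expectation_sq hg.1

lemma cheb_dens {f h : ℝ → ℝ} (hfc : Continuous f) (hf0 : ∀ x, 0 ≤ f x) (hfi : Integrable f)
    (hf1 : ∫ x, f x = 1) (hh : Continuous h) (hi : Integrable fun x => h x ^ 2 * f x)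
    {c : ℝ} (hc : 0 < c) (n : ℕ) {ε : ℝ} (hε : 0 < ε) :
    Measure.pi (fun _ : Fin n => volume.withDensity fun y => ENNReal.ofReal (c * f (c * y)))
      {x | ε ≤ |∑ i, h (c * x i) - n * ∫ y, h y * f y|}
      ≤ ENNReal.ofReal (n * (∫ y, h y ^ 2 * f y) / ε ^ 2) := by
  set μ : Measure ℝ := volume.withDensity fun y => ENNReal.ofReal (c * f (c * y)) with hμ
  have hd0 : ∀ y, 0 ≤ c * f (c * y) := fun y => mul_nonneg hc.le (hf0 _)
  have hmeas : Measurable fun y => ENNReal.ofReal (c * f (c * y)) := by fun_prop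
  have hfin : ∀ᵐ y ∂(volume : Measure ℝ), ENNReal.ofReal (c * f (c * y)) < ⊤ :=
    ae_of_all _ fun y => ENNReal.ofReal_lt_top
  have hint : ∀ g : ℝ → ℝ, ∫ y, g (c * y) ∂μ = ∫ y, g y * f y := by
    intro g
    rw [hμ, integral_withDensity_eq_integral_toReal_smul hmeas hfin]
    have : ∀ y, (ENNReal.ofReal (c * f (c * y))).toReal • g (c * y)
        = c * ((fun z => g z * f z) (c * y)) := by
      intro y
      rw [ENNReal.toReal_ofReal (hd0 y), smul_eq_mul]; ring
    simp_rw [this]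
    rw [integral_const_mul, Measure.integral_comp_mul_left (fun z => g z * f z), abs_of_pos (by positivity),
      smul_eq_mul, mul_inv_cancel_left₀ hc.ne']
  have hprob : IsProbabilityMeasure μ := by
    constructor
    rw [hμ, withDensity_apply _ MeasurableSet.univ, Measure.restrict_univ,
      ← ofReal_integral_eq_lintegral_ofReal ((hfi.comp_mul_left' hc.ne').const_mul c) (ae_of_all _ hd0),
      integral_const_mul, Measure.integral_comp_mul_left f, hf1, abs_of_pos (by positivity)]
    simp [hc.ne']
  have hL : MemLp (fun y => h (c * y)) 2 μ := by
    rw [memLp_two_iff_integrable_sq (by fun_prop : Continuous fun y => h (c * y)).aestronglyMeasurable, hμ,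
      integrable_withDensity_iff_integrable_smul' hmeas hfin]
    refine ((hi.comp_mul_left' hc.ne').const_mul c).congr (ae_of_all _ fun y => ?_)
    simp only [ENNReal.toReal_ofReal (hd0 y), smul_eq_mul]; ring
  have := cheb_pi hL n hε
  rw [hint h, hint (fun y => h y ^ 2)] at this
  exact this

end


section

structure Good (f W Z₁ Z₂ : ℝ → ℝ) : Prop where
  fc : Continuous f
  fp : ∀ x, 0 < f x
  fi : Integrable f
  f1 : ∫ x, f x = 1
  Wc : Continuous W
  Zc₁ : Continuous Z₁
  Zc₂ : Continuous Z₂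
  Wi : Integrable W
  W0 : ∫ x, W x = 0
  W2 : Integrable fun x => W x ^ 2 / f x
  Z4₁ : Integrable fun x => Z₁ x ^ 4 / f x ^ 3
  Z4₂ : Integrable fun x => Z₂ x ^ 4 / f x ^ 3

def hfun (f W Z₁ Z₂ : ℝ → ℝ) (x : ℝ) : ℝ := W x / f x - Z₁ x / f x * (Z₂ x / f x)

lemma Good.h_cont {f W Z₁ Z₂ : ℝ → ℝ} (h : Good f W Z₁ Z₂) : Continuous (hfun f W Z₁ Z₂) := by
  have hne : ∀ x, f x ≠ 0 := fun x => (h.fp x).ne'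
  have := h.fc
  have := h.Wc
  have := h.Zc₁
  have := h.Zc₂
  unfold hfun
  fun_prop (disch := assumption)

lemma zz_bound {a b f : ℝ} (hf : 0 < f) : |a * b / f| ≤ a ^ 4 / f ^ 3 + b ^ 4 / f ^ 3 + f := by
  rw [abs_div, abs_of_pos hf, abs_mul]
  have : |a| * |b| / f = (|a| / f) * (|b| / f) * f := by field_simp
  rw [this]
  have e1 : a ^ 4 / f ^ 3 = (|a| / f) ^ 4 * f := by
    rw [div_pow, show |a| ^ 4 = a ^ 4 from Even.pow_abs (by decide) a]; field_simp
  have e2 : b ^ 4 / f ^ 3 = (|b| / f) ^ 4 * f := by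
    rw [div_pow, show |b| ^ 4 = b ^ 4 from Even.pow_abs (by decide) b]; field_simp
  rw [e1, e2]
  set p := |a| / f
  set q := |b| / f
  have : p * q ≤ p ^ 4 + q ^ 4 + 1 := by
    nlinarith [sq_nonneg (p - q), sq_nonneg (p ^ 2 - 1), sq_nonneg (q ^ 2 - 1)]
  nlinarith

lemma Good.zz_int {f W Z₁ Z₂ : ℝ → ℝ} (h : Good f W Z₁ Z₂) :
    Integrable fun x => Z₁ x * Z₂ x / f x := by
  have hne : ∀ x, f x ≠ 0 := fun x => (h.fp x).ne'
  have h0 := h.fc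
  have h1 := h.Zc₁
  have h2 := h.Zc₂
  refine ((h.Z4₁.add h.Z4₂).add h.fi).mono'
    (by fun_prop (disch := assumption) : Continuous _).aestronglyMeasurable (ae_of_all _ fun x => ?_)
  exact zz_bound (h.fp x)

lemma Good.hf_int {f W Z₁ Z₂ : ℝ → ℝ} (h : Good f W Z₁ Z₂) :
    ∫ x, hfun f W Z₁ Z₂ x * f x = -∫ x, Z₁ x * Z₂ x / f x := by
  have : ∀ x, hfun f W Z₁ Z₂ x * f x = W x - Z₁ x * Z₂ x / f x := by
    intro x
    have := (h.fp x).ne'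
    unfold hfun
    field_simp
  simp_rw [this]
  rw [integral_sub h.Wi h.zz_int, h.W0, zero_sub]

lemma h2_bound {w a b f : ℝ} (hf : 0 < f) : (w / f - a / f * (b / f)) ^ 2 * f
    ≤ 2 * (w ^ 2 / f) + (a ^ 4 / f ^ 3 + b ^ 4 / f ^ 3) := by
  have e0 : w ^ 2 / f = (w / f) ^ 2 * f := by field_simp
  have e1 : a ^ 4 / f ^ 3 = (a / f) ^ 4 * f := by field_simp
  have e2 : b ^ 4 / f ^ 3 = (b / f) ^ 4 * f := by field_simp
  rw [e0, e1, e2]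
  set p := a / f
  set q := b / f
  set r := w / f
  have : (r - p * q) ^ 2 ≤ 2 * r ^ 2 + (p ^ 4 + q ^ 4) := by
    nlinarith [sq_nonneg (r + p * q), sq_nonneg (p ^ 2 - q ^ 2)]
  nlinarith

lemma Good.h2_int {f W Z₁ Z₂ : ℝ → ℝ} (h : Good f W Z₁ Z₂) :
    Integrable fun x => hfun f W Z₁ Z₂ x ^ 2 * f x := by
  refine ((h.W2.const_mul 2).add (h.Z4₁.add h.Z4₂)).mono'
    ((h.h_cont.pow 2).mul h.fc).aestronglyMeasurable (ae_of_all _ fun x => ?_)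
  rw [Real.norm_of_nonneg (mul_nonneg (sq_nonneg _) (h.fp x).le)]
  exact h2_bound (h.fp x)

lemma Good.h2_le {f W Z₁ Z₂ : ℝ → ℝ} (h : Good f W Z₁ Z₂) :
    ∫ x, hfun f W Z₁ Z₂ x ^ 2 * f x ≤ 2 * (∫ x, W x ^ 2 / f x) + ((∫ x, Z₁ x ^ 4 / f x ^ 3)
      + ∫ x, Z₂ x ^ 4 / f x ^ 3) := by
  have e := integral_add (h.W2.const_mul 2) (h.Z4₁.add h.Z4₂)
  simp only [Pi.add_apply] at e
  rw [← integral_const_mul, ← integral_add h.Z4₁ h.Z4₂, ← e]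
  exact integral_mono h.h2_int ((h.W2.const_mul 2).add (h.Z4₁.add h.Z4₂)) fun x => h2_bound (h.fp x)

lemma entry_conv {f W Z₁ Z₂ : ℕ → ℝ → ℝ} {c : ℕ → ℝ} {I : ℝ}
    (hg : ∀ᶠ n in atTop, Good (f n) (W n) (Z₁ n) (Z₂ n)) (hc : ∀ᶠ n in atTop, 0 < c n)
    (hW : Tendsto (fun n : ℕ => (n : ℝ) * ∫ x, W n x ^ 2 / f n x) atTop (𝓝 0))
    (hZ₁ : Tendsto (fun n : ℕ => (n : ℝ) * ∫ x, Z₁ n x ^ 4 / f n x ^ 3) atTop (𝓝 0))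
    (hZ₂ : Tendsto (fun n : ℕ => (n : ℝ) * ∫ x, Z₂ n x ^ 4 / f n x ^ 3) atTop (𝓝 0))
    (hI : Tendsto (fun n : ℕ => (n : ℝ) * ∫ x, Z₁ n x * Z₂ n x / f n x) atTop (𝓝 I))
    {ε : ℝ} (hε : 0 < ε) :
    Tendsto (fun n : ℕ => Measure.pi
      (fun _ : Fin n => volume.withDensity fun y => ENNReal.ofReal (c n * f n (c n * y)))
      {x | ε ≤ |∑ i, hfun (f n) (W n) (Z₁ n) (Z₂ n) (c n * x i) + I|}) atTop (𝓝 0) := by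
  have hlim : Tendsto (fun n : ℕ => ENNReal.ofReal ((2 * ((n : ℝ) * ∫ x, W n x ^ 2 / f n x)
      + (((n : ℝ) * ∫ x, Z₁ n x ^ 4 / f n x ^ 3) + ((n : ℝ) * ∫ x, Z₂ n x ^ 4 / f n x ^ 3)))
        / (ε / 2) ^ 2)) atTop (𝓝 0) := by
    have := ENNReal.tendsto_ofReal (((hW.const_mul 2).add (hZ₁.add hZ₂)).div_const ((ε / 2) ^ 2))
    simpa using this
  refine tendsto_of_tendsto_of_tendsto_of_le_of_le' tendsto_const_nhds hlim
    (Eventually.of_forall fun _ => zero_le) ?_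
  have hI' : ∀ᶠ n : ℕ in atTop, |(n : ℝ) * (∫ x, Z₁ n x * Z₂ n x / f n x) - I| < ε / 2 := by
    have := hI.eventually (Metric.ball_mem_nhds I (half_pos hε))
    simpa [Real.dist_eq] using this
  filter_upwards [hg, hc, hI'] with n hg hc hI'
  have key := cheb_dens hg.fc (fun x => (hg.fp x).le) hg.fi hg.f1 hg.h_cont hg.h2_int hc n (half_pos hε)
  refine (measure_mono ?_).trans (key.trans (ENNReal.ofReal_le_ofReal ?_))
  · intro x hx
    simp only [mem_ofPred_eq] at hx ⊢
    rw [hg.hf_int]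
    rw [abs_lt] at hI'
    rcases le_abs.1 hx with h | h
    · exact le_abs.2 (Or.inl (by linarith))
    · exact le_abs.2 (Or.inr (by linarith))
  · gcongr
    have := mul_le_mul_of_nonneg_left hg.h2_le (Nat.cast_nonneg (α := ℝ) n)
    linarith

end


section

lemma poly_gauss (k : ℕ) : Integrable (fun x : ℝ => (1 + x ^ 2) ^ k * gauss x) := by
  have h := (integrable_exp_neg_mul_sq (b := 1 / 4) (by norm_num)).const_mul
    ((Real.sqrt (2 * Real.pi))⁻¹ * (4 ^ k * k.factorial * Real.exp (1 / 4)))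
  refine h.mono' ((by fun_prop : Continuous fun x : ℝ => (1 + x ^ 2) ^ k).mul
    continuous_gauss).aestronglyMeasurable (ae_of_all _ fun x => ?_)
  rw [Real.norm_of_nonneg (mul_nonneg (by positivity) (gauss_pos x).le)]
  have h1 := Real.pow_div_factorial_le_exp ((1 + x ^ 2) / 4) (by positivity) k
  rw [div_le_iff₀ (by positivity), div_pow, div_le_iff₀ (by positivity)] at h1
  have e : Real.exp (1 / 4) * Real.exp (-(1 / 4) * x ^ 2)
      = Real.exp ((1 + x ^ 2) / 4) * Real.exp (-(x ^ 2) / 2) := by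
    rw [← Real.exp_add, ← Real.exp_add]; congr 1; ring
  unfold gauss
  calc (1 + x ^ 2) ^ k * ((Real.sqrt (2 * Real.pi))⁻¹ * Real.exp (-(x ^ 2) / 2))
      ≤ (Real.exp ((1 + x ^ 2) / 4) * k.factorial * 4 ^ k)
        * ((Real.sqrt (2 * Real.pi))⁻¹ * Real.exp (-(x ^ 2) / 2)) := by gcongr
    _ = (Real.sqrt (2 * Real.pi))⁻¹ * (4 ^ k * k.factorial) *
        (Real.exp ((1 + x ^ 2) / 4) * Real.exp (-(x ^ 2) / 2)) := by ring
    _ = _ := by rw [← e]; ring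

lemma pw_integrable {r : ℝ} (hr : 0 < r) : Integrable fun x : ℝ => (1 + |x|) ^ (-1 - r) := by
  have := integrable_one_add_norm (E := ℝ) (μ := volume) (r := 1 + r) (by simp; positivity)
  refine this.congr (ae_of_all _ fun x => ?_)
  simp only [Real.norm_eq_abs]
  congr 1; ring

lemma om_cont (α : ℝ) : Continuous (om α) := by
  unfold om
  exact (by fun_prop : Continuous fun x : ℝ => 1 + |x|).rpow_const
    fun x => Or.inl (by positivity)

lemma om2_rho (α x : ℝ) : om α x ^ 2 / rho α x = (1 + |x|) ^ (-1 - 3 * α / 4) := by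
  have h : 0 < 1 + |x| := by positivity
  unfold om rho
  rw [← Real.rpow_natCast, ← Real.rpow_mul h.le, ← Real.rpow_sub h]
  congr 1; push_cast; ring

lemma om4_rho (α x : ℝ) : om α x ^ 4 / rho α x ^ 3 = (1 + |x|) ^ (-1 - α / 2) := by
  have h : 0 < 1 + |x| := by positivity
  unfold om rho
  rw [← Real.rpow_natCast, ← Real.rpow_natCast, ← Real.rpow_mul h.le, ← Real.rpow_mul h.le,
    ← Real.rpow_sub h]
  congr 1; push_cast; ring

lemma pt2 {H a b f c g w r : ℝ} (hH : |H| ≤ a * g + b * w) (ha : 0 ≤ a) (hb : 0 ≤ b)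
    (hc : 0 < c) (hg : 0 < g) (hw : 0 ≤ w) (hr : 0 < r) (h1 : c * g ≤ f) (h2 : c * r ≤ f) :
    H ^ 2 / f ≤ 2 / c * (a ^ 2 * g + b ^ 2 * (w ^ 2 / r)) := by
  have hf : 0 < f := (by positivity : 0 < c * g).trans_le h1
  have hs : H ^ 2 ≤ 2 * (a * g) ^ 2 + 2 * (b * w) ^ 2 := by
    rw [← sq_abs H]
    have := pow_le_pow_left₀ (abs_nonneg H) hH 2
    nlinarith [sq_nonneg (a * g - b * w)]
  calc H ^ 2 / f ≤ (2 * (a * g) ^ 2 + 2 * (b * w) ^ 2) / f := by gcongr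
    _ = 2 * (a * g) ^ 2 / f + 2 * (b * w) ^ 2 / f := by ring
    _ ≤ 2 * (a * g) ^ 2 / (c * g) + 2 * (b * w) ^ 2 / (c * r) := by gcongr
    _ = _ := by field_simp

lemma pt4 {H a b f c g w r : ℝ} (hH : |H| ≤ a * g + b * w) (ha : 0 ≤ a) (hb : 0 ≤ b)
    (hc : 0 < c) (hg : 0 < g) (hw : 0 ≤ w) (hr : 0 < r) (h1 : c * g ≤ f) (h2 : c * r ≤ f) :
    H ^ 4 / f ^ 3 ≤ 8 / c ^ 3 * (a ^ 4 * g + b ^ 4 * (w ^ 4 / r ^ 3)) := by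
  have hf : 0 < f := (by positivity : 0 < c * g).trans_le h1
  have hs : H ^ 4 ≤ 8 * (a * g) ^ 4 + 8 * (b * w) ^ 4 := by
    rw [show H ^ 4 = |H| ^ 4 from (Even.pow_abs (by decide) H).symm]
    have := pow_le_pow_left₀ (abs_nonneg H) hH 4
    have h3 := add_pow_le (by positivity : 0 ≤ a * g) (by positivity : 0 ≤ b * w) 4
    norm_num at h3
    linarith
  calc H ^ 4 / f ^ 3 ≤ (8 * (a * g) ^ 4 + 8 * (b * w) ^ 4) / f ^ 3 := by gcongr
    _ = 8 * (a * g) ^ 4 / f ^ 3 + 8 * (b * w) ^ 4 / f ^ 3 := by ring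
    _ ≤ 8 * (a * g) ^ 4 / (c * g) ^ 3 + 8 * (b * w) ^ 4 / (c * r) ^ 3 := by gcongr
    _ = _ := by field_simp

lemma generic {α : ℝ} (hα : α ∈ Ioo (0 : ℝ) 2) :
    ∃ C : ℝ, 0 < C ∧ ∃ v₀ : ℝ, 0 < v₀ ∧ v₀ ≤ 1 ∧ ∀ v : ℝ, 0 < v → v ≤ v₀ → ∀ A B : ℝ, 0 ≤ A → 0 ≤ B →
      ∀ H : ℝ → ℝ, Continuous H →
      (∀ x, |H x| ≤ A * (1 + x ^ 2) ^ 2 * gauss x + B * v * om α x) →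
      Integrable (fun x => H x ^ 2 / T α v 0 0 x) ∧
      ∫ x, H x ^ 2 / T α v 0 0 x ≤ C * (A ^ 2 + B ^ 2 * v) ∧
      Integrable (fun x => H x ^ 4 / T α v 0 0 x ^ 3) ∧
      ∫ x, H x ^ 4 / T α v 0 0 x ^ 3 ≤ C * (A ^ 4 + B ^ 4 * v) := by
  obtain ⟨c, hc, v₀, hv0, hv1, hl⟩ := f_lower hα
  have hα0 := hα.1
  set K1 := ∫ x : ℝ, (1 + x ^ 2) ^ 4 * gauss x with hK1
  set K2 := ∫ x : ℝ, (1 + x ^ 2) ^ 8 * gauss x with hK2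
  set K3 := ∫ x : ℝ, (1 + |x|) ^ (-1 - 3 * α / 4) with hK3
  set K4 := ∫ x : ℝ, (1 + |x|) ^ (-1 - α / 2) with hK4
  have i3 : Integrable fun x : ℝ => (1 + |x|) ^ (-1 - 3 * α / 4) := pw_integrable (by positivity)
  have i4 : Integrable fun x : ℝ => (1 + |x|) ^ (-1 - α / 2) := pw_integrable (by positivity)
  have p1 : 0 ≤ K1 := integral_nonneg fun x => mul_nonneg (by positivity) (gauss_pos x).le
  have p2 : 0 ≤ K2 := integral_nonneg fun x => mul_nonneg (by positivity) (gauss_pos x).le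
  have p3 : 0 ≤ K3 := integral_nonneg fun x => by positivity
  have p4 : 0 ≤ K4 := integral_nonneg fun x => by positivity
  set S := K1 + K2 + K3 + K4 + 1 with hS
  refine ⟨(2 / c + 8 / c ^ 3) * S, by positivity, v₀, hv0, hv1, ?_⟩
  intro v hv hvv A B hA hB H hH hb
  have hfc := T_continuous hα le_rfl 0 hv.le
  have l1 : ∀ x, c * gauss x ≤ T α v 0 0 x := fun x => by
    have := hl v hv.le hvv x
    have : 0 ≤ c * (v * rho α x) := by have := rho_pos α x; positivity
    linarith
  have l2 : ∀ x, c * (v * rho α x) ≤ T α v 0 0 x := fun x => by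
    have := hl v hv.le hvv x
    have : 0 ≤ c * gauss x := by have := gauss_pos x; positivity
    linarith
  have fp : ∀ x, 0 < T α v 0 0 x := fun x => (by have := gauss_pos x; positivity : 0 < c * gauss x).trans_le (l1 x)
  have b2 : ∀ x, H x ^ 2 / T α v 0 0 x ≤ 2 / c * (A ^ 2 * ((1 + x ^ 2) ^ 4 * gauss x)
      + B ^ 2 * v * (1 + |x|) ^ (-1 - 3 * α / 4)) := by
    intro x
    have := pt2 (a := A * (1 + x ^ 2) ^ 2) (b := B * v) (hb x) (by positivity) (by positivity) hc
      (gauss_pos x) (om_pos α x).le (mul_pos hv (rho_pos α x)) (l1 x) (l2 x)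
    refine this.trans (le_of_eq ?_)
    rw [← om2_rho]
    have := rho_pos α x
    field_simp
  have b4 : ∀ x, H x ^ 4 / T α v 0 0 x ^ 3 ≤ 8 / c ^ 3 * (A ^ 4 * ((1 + x ^ 2) ^ 8 * gauss x)
      + B ^ 4 * v * (1 + |x|) ^ (-1 - α / 2)) := by
    intro x
    have := pt4 (a := A * (1 + x ^ 2) ^ 2) (b := B * v) (hb x) (by positivity) (by positivity) hc
      (gauss_pos x) (om_pos α x).le (mul_pos hv (rho_pos α x)) (l1 x) (l2 x)
    refine this.trans (le_of_eq ?_)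
    rw [← om4_rho]
    have := rho_pos α x
    field_simp
  have I2 := (((poly_gauss 4).const_mul (A ^ 2)).add (i3.const_mul (B ^ 2 * v))).const_mul (2 / c)
  have I4 := (((poly_gauss 8).const_mul (A ^ 4)).add (i4.const_mul (B ^ 4 * v))).const_mul (8 / c ^ 3)
  simp only [Pi.add_apply] at I2 I4
  have J2 : Integrable (fun x => H x ^ 2 / T α v 0 0 x) := by
    refine I2.mono' ((hH.pow 2).div hfc fun x => (fp x).ne').aestronglyMeasurable (ae_of_all _ fun x => ?_)
    rw [Real.norm_of_nonneg (div_nonneg (by positivity) (fp x).le)]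
    exact b2 x
  have J4 : Integrable (fun x => H x ^ 4 / T α v 0 0 x ^ 3) := by
    refine I4.mono' ((hH.pow 4).div (hfc.pow 3) fun x => (pow_pos (fp x) 3).ne').aestronglyMeasurable
      (ae_of_all _ fun x => ?_)
    have := fp x
    rw [Real.norm_of_nonneg (by positivity)]
    exact b4 x
  refine ⟨J2, ?_, J4, ?_⟩
  · refine (integral_mono J2 I2 b2).trans ?_
    have e := integral_add ((poly_gauss 4).const_mul (A ^ 2)) (i3.const_mul (B ^ 2 * v))
    rw [integral_const_mul, e, integral_const_mul, integral_const_mul, ← hK1, ← hK3]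
    calc 2 / c * (A ^ 2 * K1 + B ^ 2 * v * K3) ≤ (2 / c + 8 / c ^ 3) * (A ^ 2 * S + B ^ 2 * v * S) := by
          gcongr
          · have : 0 ≤ 8 / c ^ 3 := by positivity
            linarith
          · linarith
          · linarith
      _ = _ := by ring
  · refine (integral_mono J4 I4 b4).trans ?_
    have e := integral_add ((poly_gauss 8).const_mul (A ^ 4)) (i4.const_mul (B ^ 4 * v))
    rw [integral_const_mul, e, integral_const_mul, integral_const_mul, ← hK2, ← hK4]
    calc 8 / c ^ 3 * (A ^ 4 * K2 + B ^ 4 * v * K4) ≤ (2 / c + 8 / c ^ 3) * (A ^ 4 * S + B ^ 4 * v * S) := by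
          gcongr
          · have : 0 ≤ 2 / c := by positivity
            linarith
          · linarith
          · linarith
      _ = _ := by ring

end


section

variable {σ δ α : ℝ}

/-- Coefficient bound. -/
def CB (σ δ α : ℝ) (s : ℕ → ℝ) (p : ℕ) (c : ℕ → ℝ) : Prop :=
  ∃ C : ℝ, 0 ≤ C ∧ ∀ n : ℕ, 3 ≤ n → vn n σ δ α ≤ 1 → |c n| ≤ C * (s n * Real.log n ^ p)

/-- Function bound. -/
def OB (σ δ α : ℝ) (s : ℕ → ℝ) (p : ℕ) (F : ℕ → ℝ → ℝ) : Prop :=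
  ∃ C : ℝ, 0 ≤ C ∧ ∀ n : ℕ, 3 ≤ n → vn n σ δ α ≤ 1 →
    Continuous (F n) ∧ Integrable (F n) ∧ ∫ x, F n x = 0 ∧
      ∀ x, |F n x| ≤ C * (s n * Real.log n ^ p) * om α x

lemma log_ge_one {n : ℕ} (hn : 3 ≤ n) : 1 ≤ Real.log n := by
  rw [Real.le_log_iff_exp_le (by positivity)]
  have : (3 : ℝ) ≤ n := by exact_mod_cast hn
  linarith [Real.exp_one_lt_three]

lemma OB.mono {s : ℕ → ℝ} {p q : ℕ} {F : ℕ → ℝ → ℝ} (h : OB σ δ α s p F) (hs : ∀ n, 0 ≤ s n)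
    (hpq : p ≤ q) : OB σ δ α s q F := by
  obtain ⟨C, hC, h⟩ := h
  refine ⟨C, hC, fun n hn hv => ?_⟩
  obtain ⟨h1, h2, h3, h4⟩ := h n hn hv
  refine ⟨h1, h2, h3, fun x => (h4 x).trans ?_⟩
  have := log_ge_one hn
  have := om_pos α x
  have := hs n
  gcongr

lemma OB.add {s : ℕ → ℝ} {p : ℕ} {F G : ℕ → ℝ → ℝ} (hF : OB σ δ α s p F) (hG : OB σ δ α s p G) :
    OB σ δ α s p (fun n x => F n x + G n x) := by
  obtain ⟨C, hC, hF⟩ := hF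
  obtain ⟨D, hD, hG⟩ := hG
  refine ⟨C + D, by positivity, fun n hn hv => ?_⟩
  obtain ⟨f1, f2, f3, f4⟩ := hF n hn hv
  obtain ⟨g1, g2, g3, g4⟩ := hG n hn hv
  refine ⟨f1.add g1, f2.add g2, ?_, fun x => ?_⟩
  · rw [integral_add f2 g2, f3, g3, add_zero]
  · refine (abs_add_le _ _).trans ?_
    linarith [f4 x, g4 x]

lemma OB.cmul {s s' t : ℕ → ℝ} {p p' q : ℕ} {c : ℕ → ℝ} {F : ℕ → ℝ → ℝ} (hc : CB σ δ α s p c)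
    (hF : OB σ δ α s' p' F) (ht : ∀ n, t n = s n * s' n) (ht0 : ∀ n, 0 ≤ t n) (hq : p + p' ≤ q) :
    OB σ δ α t q (fun n x => c n * F n x) := by
  obtain ⟨C, hC, hc⟩ := hc
  obtain ⟨D, hD, hF⟩ := hF
  have : OB σ δ α t (p + p') (fun n x => c n * F n x) := by
    refine ⟨C * D, by positivity, fun n hn hv => ?_⟩
    obtain ⟨f1, f2, f3, f4⟩ := hF n hn hv
    refine ⟨f1.const_mul _, f2.const_mul _, ?_, fun x => ?_⟩
    · rw [integral_const_mul, f3, mul_zero]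
    · rw [abs_mul]
      refine (mul_le_mul (hc n hn hv) (f4 x) (abs_nonneg _) ((abs_nonneg _).trans (hc n hn hv))).trans
        (le_of_eq ?_)
      rw [ht, pow_add]; ring
  exact this.mono ht0 hq

lemma OB.congr {s : ℕ → ℝ} {p : ℕ} {F G : ℕ → ℝ → ℝ} (h : OB σ δ α s p F)
    (e : ∀ n, 3 ≤ n → G n = F n) : OB σ δ α s p G := by
  obtain ⟨C, hC, h⟩ := h
  exact ⟨C, hC, fun n hn hv => by rw [e n hn]; exact h n hn hv⟩

lemma OB_T (hσ : 0 < σ) (hδ : 0 < δ) (hα : α ∈ Ioo (0 : ℝ) 2) {a : ℝ} (ha : α ≤ a) (b : ℕ) :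
    OB σ δ α (fun _ => 1) 0 (fun n => T α (vn n σ δ α) a b) := by
  obtain ⟨C, hC, h⟩ := T_bound hα ha b
  refine ⟨C, hC.le, fun n hn _ => ?_⟩
  have hv := (vn_pos (α := α) hσ hδ (by omega : 1 ≤ n)).le
  refine ⟨T_continuous hα (hα.1.le.trans ha) b hv, T_integrable hα ha b hv, T_int hα ha b hv, fun x => ?_⟩
  simpa using h _ hv x

lemma CB_const (c : ℝ) (p : ℕ) : CB σ δ α (fun _ => 1) p (fun _ => c) := by
  refine ⟨|c|, abs_nonneg _, fun n hn _ => ?_⟩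
  have := one_le_pow₀ (log_ge_one hn) (n := p)
  rw [one_mul]
  nlinarith [abs_nonneg c]

lemma CB_self {s : ℕ → ℝ} (hs : ∀ n, 0 ≤ s n) : CB σ δ α s 0 s :=
  ⟨1, one_pos.le, fun n hn _ => by simp [abs_of_nonneg (hs n)]⟩

lemma CB_v1 (hσ : 0 < σ) (hδ : 0 < δ) : CB σ δ α (fun _ => 1) 0 (fun n => vn n σ δ α) :=
  ⟨1, one_pos.le, fun n hn hv => by
    simpa [abs_of_pos (vn_pos (α := α) hσ hδ (by omega : 1 ≤ n))] using hv⟩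

lemma CB.mul {s s' t : ℕ → ℝ} {p p' q : ℕ} {c d : ℕ → ℝ} (hc : CB σ δ α s p c)
    (hd : CB σ δ α s' p' d) (ht : ∀ n, t n = s n * s' n) (hq : p + p' = q) :
    CB σ δ α t q (fun n => c n * d n) := by
  obtain ⟨C, hC, hc⟩ := hc
  obtain ⟨D, hD, hd⟩ := hd
  refine ⟨C * D, by positivity, fun n hn hv => ?_⟩
  rw [abs_mul]
  refine (mul_le_mul (hc n hn hv) (hd n hn hv) (abs_nonneg _) ((abs_nonneg _).trans (hc n hn hv))).trans
    (le_of_eq ?_)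
  rw [ht, ← hq, pow_add]; ring

lemma CB_lam : CB σ δ α (fun _ => 1) 1 (fun n => lam n σ δ) := by
  refine ⟨|Real.log δ| + |Real.log σ| + 1, by positivity, fun n hn _ => ?_⟩
  have h := log_ge_one hn
  have h1 := abs_nonneg (Real.log δ)
  have h2 := abs_nonneg (Real.log σ)
  unfold lam
  rw [one_mul, pow_one]
  rw [abs_le]
  constructor
  · nlinarith [neg_abs_le (Real.log δ), le_abs_self (Real.log σ)]
  · nlinarith [le_abs_self (Real.log δ), neg_abs_le (Real.log σ)]

lemma vn_nonneg (hσ : 0 < σ) (hδ : 0 < δ) (n : ℕ) : 0 ≤ vn n σ δ α := by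
  unfold vn; positivity

section

lemma OB_F01 (hσ : 0 < σ) (hδ : 0 < δ) (hα : α ∈ Ioo (0 : ℝ) 2) : OB σ δ α (fun n => vn n σ δ α) 2 (fun n x => PF2 n σ ![σ, δ, α] 0 1 x) := by
  have h := OB.cmul (q := 2) (((CB_const (α / (σ * δ)) 0).mul (CB_self (vn_nonneg (α := α) hσ hδ))
    (t := fun n => vn n σ δ α) (by simp) rfl)) (OB_T hσ hδ hα (a := 2 + α) (by linarith) 0)
    (t := fun n => vn n σ δ α) (by simp) (vn_nonneg hσ hδ) (by norm_num)
  exact h.congr fun n hn => funext fun x => PF2_at01 hσ hδ hα (by omega) x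

/-- `lam * T + T'`. -/
lemma OB_lam1 (hσ : 0 < σ) (hδ : 0 < δ) (hα : α ∈ Ioo (0 : ℝ) 2) {a : ℝ} (ha : α ≤ a) : OB σ δ α (fun _ => 1) 1
    (fun n x => lam n σ δ * T α (vn n σ δ α) a 0 x + T α (vn n σ δ α) a 1 x) :=
  (OB.cmul CB_lam (OB_T hσ hδ hα ha 0) (by simp) (by simp) le_rfl).add
    ((OB_T hσ hδ hα ha 1).mono (by simp) (by norm_num))

lemma OB_lam2 (hσ : 0 < σ) (hδ : 0 < δ) (hα : α ∈ Ioo (0 : ℝ) 2) {a : ℝ} (ha : α ≤ a) : OB σ δ α (fun _ => 1) 2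
    (fun n x => lam n σ δ ^ 2 * T α (vn n σ δ α) a 0 x + 2 * lam n σ δ * T α (vn n σ δ α) a 1 x
      + T α (vn n σ δ α) a 2 x) := by
  have hl2 : CB σ δ α (fun _ => 1) 2 (fun n => lam n σ δ ^ 2) := by
    have := (CB_lam (σ := σ) (δ := δ) (α := α)).mul CB_lam (t := fun _ => 1) (q := 2) (by simp) rfl
    simpa [sq] using this
  have hl1 : CB σ δ α (fun _ => 1) 1 (fun n => 2 * lam n σ δ) :=
    (CB_const 2 0).mul CB_lam (by simp) rfl
  exact ((OB.cmul hl2 (OB_T hσ hδ hα ha 0) (by simp) (by simp) le_rfl).add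
    (OB.cmul hl1 (OB_T hσ hδ hα ha 1) (by simp) (by simp) (by norm_num))).add
    ((OB_T hσ hδ hα ha 2).mono (by simp) (by norm_num))

lemma OB_F02 (hσ : 0 < σ) (hδ : 0 < δ) (hα : α ∈ Ioo (0 : ℝ) 2) : OB σ δ α (fun n => vn n σ δ α) 2 (fun n x => PF2 n σ ![σ, δ, α] 0 2 x) := by
  have h := OB.cmul (q := 2) (((CB_const (1 / σ) 0).mul (CB_self (vn_nonneg (α := α) hσ hδ))
    (t := fun n => vn n σ δ α) (by simp) rfl)) (OB_lam1 hσ hδ hα (a := 2 + α) (by linarith))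
    (t := fun n => vn n σ δ α) (by simp) (vn_nonneg hσ hδ) (by norm_num)
  exact h.congr fun n hn => funext fun x => by rw [PF2_at02 hσ hδ hα (by omega) x]; ring

lemma OB_F11 (hσ : 0 < σ) (hδ : 0 < δ) (hα : α ∈ Ioo (0 : ℝ) 2) : OB σ δ α (fun n => vn n σ δ α) 2 (fun n x => PF2 n σ ![σ, δ, α] 1 1 x) := by
  have hα0 := hα.1
  have hc : CB σ δ α (fun _ => 1) 0 (fun n => α ^ 2 / δ ^ 2 * vn n σ δ α) :=
    (CB_const _ 0).mul (CB_v1 hσ hδ) (by simp) rfl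
  have h := (OB.cmul (q := 2) hc (OB_T hσ hδ hα (a := α + α) (by linarith) 0) (t := fun _ => 1)
    (by simp) (by simp) (by norm_num)).add
    (OB.cmul (q := 2) (CB_const (-((α ^ 2 - α) / δ ^ 2)) 0) (OB_T hσ hδ hα (a := α) le_rfl 0)
      (by simp) (by simp) (by norm_num))
  have h := OB.cmul (q := 2) (CB_self (vn_nonneg (α := α) hσ hδ)) h
    (t := fun n => vn n σ δ α) (by simp) (vn_nonneg hσ hδ) (by norm_num)
  exact h.congr fun n hn => funext fun x => by rw [PF2_at11 hσ hδ hα (by omega) x]; ring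

lemma OB_F12 (hσ : 0 < σ) (hδ : 0 < δ) (hα : α ∈ Ioo (0 : ℝ) 2) : OB σ δ α (fun n => vn n σ δ α) 2 (fun n x => PF2 n σ ![σ, δ, α] 1 2 x) := by
  have hα0 := hα.1
  have hc : CB σ δ α (fun _ => 1) 0 (fun n => α / δ * vn n σ δ α) :=
    (CB_const _ 0).mul (CB_v1 hσ hδ) (by simp) rfl
  have h := ((OB.cmul (q := 2) hc (OB_lam1 hσ hδ hα (a := α + α) (by linarith)) (t := fun _ => 1)
    (by simp) (by simp) (by norm_num)).add
    (OB.cmul (q := 2) (CB_const (-(α / δ)) 0) (OB_lam1 hσ hδ hα (a := α) le_rfl)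
      (by simp) (by simp) (by norm_num))).add
    (OB.cmul (q := 2) (CB_const (-(1 / δ)) 0) (OB_T hσ hδ hα (a := α) le_rfl 0)
      (by simp) (by simp) (by norm_num))
  have h := OB.cmul (q := 2) (CB_self (vn_nonneg (α := α) hσ hδ)) h
    (t := fun n => vn n σ δ α) (by simp) (vn_nonneg hσ hδ) (by norm_num)
  exact h.congr fun n hn => funext fun x => by rw [PF2_at12 hσ hδ hα (by omega) x]; ring

lemma OB_F22 (hσ : 0 < σ) (hδ : 0 < δ) (hα : α ∈ Ioo (0 : ℝ) 2) : OB σ δ α (fun n => vn n σ δ α) 2 (fun n x => PF2 n σ ![σ, δ, α] 2 2 x) := by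
  have hα0 := hα.1
  have h := (OB.cmul (q := 2) (CB_v1 (α := α) hσ hδ) (OB_lam2 hσ hδ hα (a := α + α) (by linarith))
    (t := fun _ => 1) (by simp) (by simp) (by norm_num)).add
    (OB.cmul (q := 2) (CB_const (-1) 0) (OB_lam2 hσ hδ hα (a := α) le_rfl)
      (by simp) (by simp) (by norm_num))
  have h := OB.cmul (q := 2) (CB_self (vn_nonneg (α := α) hσ hδ)) h
    (t := fun n => vn n σ δ α) (by simp) (vn_nonneg hσ hδ) (by norm_num)
  exact h.congr fun n hn => funext fun x => by rw [PF2_at22 hσ hδ hα (by omega) x]; ring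

lemma OB_F1 (hσ : 0 < σ) (hδ : 0 < δ) (hα : α ∈ Ioo (0 : ℝ) 2) : OB σ δ α (fun n => vn n σ δ α) 1 (fun n x => PF1 n σ ![σ, δ, α] 1 x) := by
  have h := OB.cmul (q := 1) (((CB_const (-(α / δ)) 0).mul (CB_self (vn_nonneg (α := α) hσ hδ))
    (t := fun n => vn n σ δ α) (by simp) rfl)) (OB_T hσ hδ hα (a := α) le_rfl 0)
    (t := fun n => vn n σ δ α) (by simp) (vn_nonneg hσ hδ) (by norm_num)
  exact h.congr fun n hn => funext fun x => by rw [PF1_at1 hσ hδ hα (by omega) x]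

lemma OB_F2 (hσ : 0 < σ) (hδ : 0 < δ) (hα : α ∈ Ioo (0 : ℝ) 2) : OB σ δ α (fun n => vn n σ δ α) 1 (fun n x => PF1 n σ ![σ, δ, α] 2 x) := by
  have h := OB.cmul (q := 1) (((CB_const (-1) 0).mul (CB_self (vn_nonneg (α := α) hσ hδ))
    (t := fun n => vn n σ δ α) (by simp) rfl)) (OB_lam1 hσ hδ hα (a := α) le_rfl)
    (t := fun n => vn n σ δ α) (by simp) (vn_nonneg hσ hδ) (by norm_num)
  exact h.congr fun n hn => funext fun x => by rw [PF1_at2 hσ hδ hα (by omega) x]; ring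

end

end


section

variable {σ δ α : ℝ}

def Zt (n : ℕ) (σ δ α : ℝ) (i : Fin 3) (x : ℝ) : ℝ :=
  ∑ k, un n ![σ, δ, α] k i * PF1 n σ ![σ, δ, α] k x

def Wt (n : ℕ) (σ δ α : ℝ) (i j : Fin 3) (x : ℝ) : ℝ :=
  ∑ k, ∑ l, un n ![σ, δ, α] k i * un n ![σ, δ, α] l j * PF2 n σ ![σ, δ, α] k l x

/-- off-diagonal element of `un` -/
def uoff (n : ℕ) (δ α : ℝ) : ℝ := -(rate n α * (δ / (2 * α)) * (Real.log n - Real.log (Real.log n)))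

lemma rate_nonneg (n : ℕ) (α : ℝ) : 0 ≤ rate n α := by
  unfold rate
  have : 0 ≤ Real.log (n : ℝ) := Real.log_natCast_nonneg n
  positivity

section
variable (n : ℕ) (σ δ α : ℝ) (x : ℝ)

lemma Zt0 : Zt n σ δ α 0 x = 1 / √(n : ℝ) * PF1 n σ ![σ, δ, α] 0 x := by
  simp [Zt, un, Fin.sum_univ_three]
lemma Zt1 : Zt n σ δ α 1 x = rate n α * PF1 n σ ![σ, δ, α] 1 x := by
  simp [Zt, un, Fin.sum_univ_three]
lemma Zt2 : Zt n σ δ α 2 x = uoff n δ α * PF1 n σ ![σ, δ, α] 1 x + rate n α * PF1 n σ ![σ, δ, α] 2 x := by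
  simp [Zt, un, Fin.sum_univ_three, uoff]
lemma Wt00 : Wt n σ δ α 0 0 x = 1 / √(n : ℝ) * (1 / √(n : ℝ)) * PF2 n σ ![σ, δ, α] 0 0 x := by
  simp [Wt, un, Fin.sum_univ_three]
lemma Wt01 : Wt n σ δ α 0 1 x = 1 / √(n : ℝ) * (rate n α * PF2 n σ ![σ, δ, α] 0 1 x) := by
  simp [Wt, un, Fin.sum_univ_three]; ring
lemma Wt02 : Wt n σ δ α 0 2 x = 1 / √(n : ℝ) * (uoff n δ α * PF2 n σ ![σ, δ, α] 0 1 x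
    + rate n α * PF2 n σ ![σ, δ, α] 0 2 x) := by
  simp [Wt, un, Fin.sum_univ_three, uoff]; ring
lemma Wt11 : Wt n σ δ α 1 1 x = rate n α * (rate n α * PF2 n σ ![σ, δ, α] 1 1 x) := by
  simp [Wt, un, Fin.sum_univ_three]; ring
lemma Wt12 : Wt n σ δ α 1 2 x = rate n α * (uoff n δ α * PF2 n σ ![σ, δ, α] 1 1 x
    + rate n α * PF2 n σ ![σ, δ, α] 1 2 x) := by
  simp [Wt, un, Fin.sum_univ_three, uoff]; ring
lemma Wt22 : Wt n σ δ α 2 2 x = uoff n δ α * (uoff n δ α * PF2 n σ ![σ, δ, α] 1 1 x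
    + rate n α * PF2 n σ ![σ, δ, α] 1 2 x) + rate n α * (uoff n δ α * PF2 n σ ![σ, δ, α] 1 2 x
    + rate n α * PF2 n σ ![σ, δ, α] 2 2 x) := by
  simp [Wt, un, Fin.sum_univ_three, uoff, PF2_symm _ 2 1 x]; ring
lemma Wt_symm (i j : Fin 3) : Wt n σ δ α i j x = Wt n σ δ α j i x := by
  unfold Wt
  rw [Finset.sum_comm]
  refine Finset.sum_congr rfl fun k _ => Finset.sum_congr rfl fun l _ => ?_
  rw [PF2_symm _ l k x]; ring
end

lemma CB_uoff (hδ : 0 < δ) (hα : 0 < α) : CB σ δ α (fun n => rate n α) 1 (fun n => uoff n δ α) := by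
  refine ⟨δ / (2 * α), by positivity, fun n hn _ => ?_⟩
  have h := log_ge_one hn
  have h0 := Real.log_nonneg h
  have h1 := Real.log_le_sub_one_of_pos (by linarith : 0 < Real.log (n : ℝ))
  have hr := rate_nonneg n α
  unfold uoff
  rw [abs_neg, abs_of_nonneg (mul_nonneg (by positivity) (by linarith)), pow_one]
  have : Real.log (n : ℝ) - Real.log (Real.log n) ≤ Real.log n := by linarith
  calc _ ≤ rate n α * (δ / (2 * α)) * Real.log n := by gcongr
    _ = _ := by ring

lemma CB.mono {s : ℕ → ℝ} {p q : ℕ} {c : ℕ → ℝ} (h : CB σ δ α s p c) (hs : ∀ n, 0 ≤ s n)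
    (hpq : p ≤ q) : CB σ δ α s q c := by
  obtain ⟨C, hC, h⟩ := h
  refine ⟨C, hC, fun n hn hv => (h n hn hv).trans ?_⟩
  have := log_ge_one hn
  have := hs n
  gcongr

section

lemma OB_uF (hσ : 0 < σ) (hδ : 0 < δ) (hα : α ∈ Ioo (0 : ℝ) 2) {s : ℕ → ℝ} (hs : ∀ n, 0 ≤ s n) {p q : ℕ} (hpq : p + 1 ≤ q) {F G : ℕ → ℝ → ℝ} (hF : OB σ δ α s p F) (hG : OB σ δ α s p G) :
    OB σ δ α (fun n => rate n α * s n) q (fun n x => uoff n δ α * F n x + rate n α * G n x) := by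
  have h0 : ∀ n, 0 ≤ rate n α * s n := fun n => mul_nonneg (rate_nonneg n α) (hs n)
  exact (OB.cmul (CB_uoff hδ hα.1) hF (fun n => rfl) h0 (by omega)).add
    (OB.cmul (CB_self fun n => rate_nonneg n α) hG (fun n => rfl) h0 (by omega))

lemma OB_rF (hσ : 0 < σ) (hδ : 0 < δ) (hα : α ∈ Ioo (0 : ℝ) 2) {s : ℕ → ℝ} (hs : ∀ n, 0 ≤ s n) {p q : ℕ} (hpq : p + 1 ≤ q) {F : ℕ → ℝ → ℝ} (hF : OB σ δ α s p F) :
    OB σ δ α (fun n => rate n α * s n) q (fun n x => rate n α * F n x) := by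
  have h0 : ∀ n, 0 ≤ rate n α * s n := fun n => mul_nonneg (rate_nonneg n α) (hs n)
  exact (OB.cmul (CB_self fun n => rate_nonneg n α) hF (fun n => rfl) h0 (by omega))

lemma OB_sF (hσ : 0 < σ) (hδ : 0 < δ) (hα : α ∈ Ioo (0 : ℝ) 2) {s : ℕ → ℝ} (hs : ∀ n, 0 ≤ s n) {q : ℕ} {F : ℕ → ℝ → ℝ} (hF : OB σ δ α s q F) :
    OB σ δ α (fun n => 1 / √(n : ℝ) * s n) q (fun n x => 1 / √(n : ℝ) * F n x) := by
  have h0 : ∀ n : ℕ, 0 ≤ 1 / √(n : ℝ) * s n := fun n => mul_nonneg (by positivity) (hs n)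
  exact (OB.cmul (CB_self fun n => by positivity) hF (fun n => rfl) h0 (by omega))

lemma OB_Zt (hσ : 0 < σ) (hδ : 0 < δ) (hα : α ∈ Ioo (0 : ℝ) 2) {j : Fin 3} (hj : j ≠ 0) :
    OB σ δ α (fun n => rate n α * vn n σ δ α) 2 (fun n x => Zt n σ δ α j x) := by
  have hv := vn_nonneg (α := α) hσ hδ
  fin_cases j
  · exact absurd rfl hj
  · exact (OB_rF hσ hδ hα hv (by norm_num) (OB_F1 hσ hδ hα)).congr fun n _ => funext fun x => Zt1 n σ δ α x
  · exact (OB_uF hσ hδ hα hv (by norm_num) (OB_F1 hσ hδ hα) (OB_F2 hσ hδ hα)).congr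
      fun n _ => funext fun x => Zt2 n σ δ α x

lemma OB_Wt0 (hσ : 0 < σ) (hδ : 0 < δ) (hα : α ∈ Ioo (0 : ℝ) 2) {j : Fin 3} (hj : j ≠ 0) :
    OB σ δ α (fun n => 1 / √(n : ℝ) * (rate n α * vn n σ δ α)) 3 (fun n x => Wt n σ δ α 0 j x) := by
  have hv := vn_nonneg (α := α) hσ hδ
  have h0 : ∀ n, 0 ≤ rate n α * vn n σ δ α := fun n => mul_nonneg (rate_nonneg n α) (hv n)
  fin_cases j
  · exact absurd rfl hj
  · exact (OB_sF hσ hδ hα h0 (OB_rF hσ hδ hα hv (by norm_num) (OB_F01 hσ hδ hα))).congr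
      fun n _ => funext fun x => Wt01 n σ δ α x
  · exact (OB_sF hσ hδ hα h0 (OB_uF hσ hδ hα hv (by norm_num) (OB_F01 hσ hδ hα) (OB_F02 hσ hδ hα))).congr
      fun n _ => funext fun x => Wt02 n σ δ α x

lemma OB_Wt11 (hσ : 0 < σ) (hδ : 0 < δ) (hα : α ∈ Ioo (0 : ℝ) 2) {i j : Fin 3} (hi : i ≠ 0) (hj : j ≠ 0) :
    OB σ δ α (fun n => rate n α * (rate n α * vn n σ δ α)) 4 (fun n x => Wt n σ δ α i j x) := by
  have hv := vn_nonneg (α := α) hσ hδ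
  have h0 : ∀ n, 0 ≤ rate n α * vn n σ δ α := fun n => mul_nonneg (rate_nonneg n α) (hv n)
  have h12 : OB σ δ α (fun n => rate n α * (rate n α * vn n σ δ α)) 4 (fun n x => Wt n σ δ α 1 2 x) :=
    (OB_rF hσ hδ hα h0 (by norm_num) (OB_uF (q := 3) hσ hδ hα hv (by norm_num)
      (OB_F11 hσ hδ hα) (OB_F12 hσ hδ hα))).congr fun n _ => funext fun x => Wt12 n σ δ α x
  fin_cases i
  · exact absurd rfl hi
  · fin_cases j
    · exact absurd rfl hj
    · exact (OB_rF hσ hδ hα h0 (by norm_num) (OB_rF (q := 3) hσ hδ hα hv (by norm_num)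
        (OB_F11 hσ hδ hα))).congr fun n _ => funext fun x => Wt11 n σ δ α x
    · exact h12
  · fin_cases j
    · exact absurd rfl hj
    · exact h12.congr fun n _ => funext fun x => Wt_symm n σ δ α x 2 1
    · exact (OB_uF hσ hδ hα h0 (by norm_num) (OB_uF (q := 3) hσ hδ hα hv (by norm_num)
        (OB_F11 hσ hδ hα) (OB_F12 hσ hδ hα)) (OB_uF (q := 3) hσ hδ hα hv (by norm_num)
        (OB_F12 hσ hδ hα) (OB_F22 hσ hδ hα))).congr fun n _ => funext fun x => Wt22 n σ δ α x

lemma Zt0_bound (hσ : 0 < σ) (hδ : 0 < δ) (hα : α ∈ Ioo (0 : ℝ) 2) : ∃ C : ℝ, 0 ≤ C ∧ ∀ n : ℕ, 3 ≤ n → Continuous (Zt n σ δ α 0) ∧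
    ∀ x, |Zt n σ δ α 0 x| ≤ C * (1 / √(n : ℝ)) * (1 + x ^ 2) ^ 2 * gauss x
      + C * (1 / √(n : ℝ)) * vn n σ δ α * om α x := by
  obtain ⟨C, hC, h⟩ := T2_bound hα
  refine ⟨(C + 1) / σ, by positivity, fun n hn => ?_⟩
  have hv := vn_nonneg (α := α) hσ hδ n
  have e : Zt n σ δ α 0 = fun x => 1 / √(n : ℝ) * (-(1 / σ) * T α (vn n σ δ α) 2 0 x) :=
    funext fun x => by rw [Zt0, PF1_at0 hσ hδ hα (by omega)]
  rw [e]
  refine ⟨((T_continuous hα (by norm_num) 0 hv).const_mul _).const_mul _, fun x => ?_⟩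
  have h1 : |T α (vn n σ δ α) 2 0 x| ≤ (C + 1) * ((1 + x ^ 2) ^ 2 * gauss x + vn n σ δ α * om α x) := by
    have h2 := h _ hv x
    have hg := gauss_pos x
    have ho := om_pos α x
    have h3 : |(1 - x ^ 2) * gauss x| ≤ (1 + x ^ 2) ^ 2 * gauss x := by
      rw [abs_mul, abs_of_pos hg]
      gcongr
      rw [abs_le]; constructor <;> nlinarith [sq_nonneg x, sq_nonneg (x ^ 2)]
    have h4 := abs_sub_abs_le_abs_sub (T α (vn n σ δ α) 2 0 x) ((1 - x ^ 2) * gauss x)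
    have h5 : 0 ≤ C * ((1 + x ^ 2) ^ 2 * gauss x) := by positivity
    have h6 : 0 ≤ vn n σ δ α * om α x := by positivity
    nlinarith only [h2, h3, h4, h5, h6]
  rw [abs_mul, abs_mul, abs_of_nonneg (by positivity : 0 ≤ 1 / √(n : ℝ)), abs_neg,
    abs_of_pos (by positivity : 0 < 1 / σ)]
  calc _ ≤ 1 / √(n : ℝ) * (1 / σ * ((C + 1) * ((1 + x ^ 2) ^ 2 * gauss x + vn n σ δ α * om α x))) := by gcongr
    _ = _ := by ring

lemma Wt00_bound (hσ : 0 < σ) (hδ : 0 < δ) (hα : α ∈ Ioo (0 : ℝ) 2) : ∃ C : ℝ, 0 ≤ C ∧ ∀ n : ℕ, 3 ≤ n → Continuous (Wt n σ δ α 0 0) ∧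
    Integrable (Wt n σ δ α 0 0) ∧ ∫ x, Wt n σ δ α 0 0 x = 0 ∧
    ∀ x, |Wt n σ δ α 0 0 x| ≤ C * (1 / n) * (1 + x ^ 2) ^ 2 * gauss x
      + C * (1 / n) * vn n σ δ α * om α x := by
  obtain ⟨C, hC, h⟩ := T2_bound hα
  obtain ⟨D, hD, h'⟩ := T4_bound hα
  refine ⟨(C + D + 10) / σ ^ 2, by positivity, fun n hn => ?_⟩
  have hv := vn_nonneg (α := α) hσ hδ n
  have e : Wt n σ δ α 0 0 = fun x => (1 / (n : ℝ)) * (1 / σ ^ 2 * (T α (vn n σ δ α) 4 0 x - T α (vn n σ δ α) 2 0 x)) :=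
    funext fun x => by
      rw [Wt00, PF2_at00 hσ hδ hα (by omega), div_mul_div_comm, Real.mul_self_sqrt (by positivity), one_mul]
  rw [e]
  have a2 : α ≤ 2 := hα.2.le
  have a4 : α ≤ 4 := by linarith
  refine ⟨(((T_continuous hα (by norm_num) 0 hv).sub (T_continuous hα (by norm_num) 0 hv)).const_mul _).const_mul _,
    (((T_integrable hα a4 0 hv).sub (T_integrable hα a2 0 hv)).const_mul _).const_mul _, ?_, fun x => ?_⟩
  · rw [integral_const_mul, integral_const_mul, integral_sub (T_integrable hα a4 0 hv) (T_integrable hα a2 0 hv),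
      T_int hα a4 0 hv, T_int hα a2 0 hv]; simp
  have h1 : |T α (vn n σ δ α) 4 0 x - T α (vn n σ δ α) 2 0 x| ≤ (C + D + 10) * ((1 + x ^ 2) ^ 2 * gauss x + vn n σ δ α * om α x) := by
    have h2 := h _ hv x
    have h2' := h' _ hv x
    have hg := gauss_pos x
    have ho := om_pos α x
    have h3 : |(x ^ 4 - 6 * x ^ 2 + 3) * gauss x - (1 - x ^ 2) * gauss x| ≤ 10 * ((1 + x ^ 2) ^ 2 * gauss x) := by
      rw [← sub_mul, abs_mul, abs_of_pos hg, ← mul_assoc]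
      gcongr
      rw [abs_le]; constructor <;> nlinarith [sq_nonneg x, sq_nonneg (x ^ 2)]
    have h5 : 0 ≤ (C + D) * ((1 + x ^ 2) ^ 2 * gauss x) := by positivity
    have h6 : 0 ≤ vn n σ δ α * om α x := by positivity
    rw [abs_le] at *
    constructor <;> nlinarith only [h2, h2', h3, h5, h6]
  rw [abs_mul, abs_mul, abs_of_nonneg (by positivity : 0 ≤ 1 / (n : ℝ)),
    abs_of_pos (by positivity : 0 < 1 / σ ^ 2)]
  calc _ ≤ 1 / (n : ℝ) * (1 / σ ^ 2 * ((C + D + 10) * ((1 + x ^ 2) ^ 2 * gauss x + vn n σ δ α * om α x))) := by gcongr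
    _ = _ := by ring

end

end


section

variable {σ δ α : ℝ}

lemma loglim (a : ℝ) {b : ℝ} (hb : 0 < b) :
    Tendsto (fun n : ℕ => Real.log n ^ a * (n : ℝ) ^ (-b)) atTop (𝓝 0) := by
  have h := (isLittleO_log_rpow_rpow_atTop a hb).tendsto_div_nhds_zero
  have h := h.comp (tendsto_natCast_atTop_atTop (R := ℝ))
  refine h.congr fun n => ?_
  simp only [Function.comp_apply]
  rw [Real.rpow_neg (Nat.cast_nonneg n), div_eq_mul_inv]

lemma vn_lim (hα : α ∈ Ioo (0 : ℝ) 2) : Tendsto (fun n : ℕ => vn n σ δ α) atTop (𝓝 0) := by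
  have h := (loglim 0 (b := 1 - α / 2) (by linarith [hα.2])).mul_const ((δ / σ) ^ α)
  rw [zero_mul] at h
  refine h.congr fun n => ?_
  unfold vn
  rw [Real.rpow_zero, one_mul]; congr 2; ring

lemma rate_pow {n : ℕ} (hn : 3 ≤ n) (k : ℕ) : rate n α ^ k = Real.log n ^ (α / 4 * k) * (n : ℝ) ^ (-(α / 4 * k)) := by
  have h := log_ge_one hn
  unfold rate
  rw [div_pow, ← Real.rpow_natCast, ← Real.rpow_natCast, ← Real.rpow_mul (by linarith), ← Real.rpow_mul (by positivity),
    Real.rpow_neg (by positivity), div_eq_mul_inv]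

lemma lim1 (hα : α ∈ Ioo (0 : ℝ) 2) :
    Tendsto (fun n : ℕ => (n : ℝ) * (rate n α ^ 4 * Real.log n ^ 8) * vn n σ δ α) atTop (𝓝 0) := by
  have h := (loglim (α + 8) (b := α / 2) (by linarith [hα.1])).mul_const ((δ / σ) ^ α)
  rw [zero_mul] at h
  refine h.congr' ?_
  filter_upwards [eventually_ge_atTop 3] with n hn
  have hl := log_ge_one hn
  have hn0 : (0 : ℝ) < n := by positivity
  rw [rate_pow hn, vn]
  rw [Real.rpow_add (by linarith), show -(α / 2) = 1 + (-(α / 4 * (4 : ℕ)) + (α / 2 - 1)) by push_cast; ring, Real.rpow_add hn0,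
    Real.rpow_add hn0, Real.rpow_one, show α / 4 * ((4 : ℕ) : ℝ) = α by push_cast; ring,
    show (8 : ℝ) = ((8 : ℕ) : ℝ) by norm_num, Real.rpow_natCast]
  ring

lemma lim2 (hα : α ∈ Ioo (0 : ℝ) 2) :
    Tendsto (fun n : ℕ => (n : ℝ) * (1 / √(n : ℝ) * rate n α * Real.log n ^ 3) ^ 2 * vn n σ δ α) atTop (𝓝 0) := by
  have h := (loglim (α / 2 + 6) (b := 1) (by norm_num)).mul_const ((δ / σ) ^ α)
  rw [zero_mul] at h
  refine h.congr' ?_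
  filter_upwards [eventually_ge_atTop 3] with n hn
  have hl := log_ge_one hn
  have hn0 : (0 : ℝ) < n := by positivity
  rw [mul_pow, mul_pow, rate_pow hn, vn, div_pow, Real.sq_sqrt hn0.le]
  rw [Real.rpow_add (by linarith), show (-1 : ℝ) = (-(α / 4 * (2 : ℕ)) + (α / 2 - 1)) by push_cast; ring, Real.rpow_add hn0,
    show α / 4 * ((2 : ℕ) : ℝ) = α / 2 by push_cast; ring,
    show (6 : ℝ) = ((6 : ℕ) : ℝ) by norm_num, Real.rpow_natCast]
  field_simp

lemma ev_v (hα : α ∈ Ioo (0 : ℝ) 2) {v₀ : ℝ} (h : 0 < v₀) : ∀ᶠ n : ℕ in atTop, 3 ≤ n ∧ vn n σ δ α ≤ v₀ := by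
  filter_upwards [eventually_ge_atTop 3, (vn_lim (σ := σ) (δ := δ) hα).eventually (gt_mem_nhds h)] with n h1 h2
  exact ⟨h1, h2.le⟩

section

/-- second-moment statement -/
def AA (σ δ α : ℝ) (F : ℕ → ℝ → ℝ) : Prop :=
  (∀ᶠ n in atTop, Continuous (F n) ∧ Integrable (F n) ∧ ∫ x, F n x = 0 ∧
    Integrable fun x => F n x ^ 2 / T α (vn n σ δ α) 0 0 x) ∧
  Tendsto (fun n : ℕ => (n : ℝ) * ∫ x, F n x ^ 2 / T α (vn n σ δ α) 0 0 x) atTop (𝓝 0)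

def BB (σ δ α : ℝ) (F : ℕ → ℝ → ℝ) : Prop :=
  (∀ᶠ n in atTop, Continuous (F n) ∧
    Integrable fun x => F n x ^ 4 / T α (vn n σ δ α) 0 0 x ^ 3) ∧
  Tendsto (fun n : ℕ => (n : ℝ) * ∫ x, F n x ^ 4 / T α (vn n σ δ α) 0 0 x ^ 3) atTop (𝓝 0)

lemma f_pos_ev (hσ : 0 < σ) (hδ : 0 < δ) (hα : α ∈ Ioo (0 : ℝ) 2) : ∀ᶠ n : ℕ in atTop, ∀ x, 0 < T α (vn n σ δ α) 0 0 x := by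
  obtain ⟨c, hc, v₀, h0, h1, h⟩ := f_lower hα
  filter_upwards [ev_v hα h0] with n hn x
  have hv := vn_nonneg (α := α) hσ hδ n
  have := h _ hv hn.2 x
  have h1 := gauss_pos x
  have h2 := rho_pos α x
  exact lt_of_lt_of_le (by positivity) this

lemma AA_of (hσ : 0 < σ) (hδ : 0 < δ) (hα : α ∈ Ioo (0 : ℝ) 2) {F : ℕ → ℝ → ℝ} {A B : ℕ → ℝ} (hA : ∀ n, 0 ≤ A n) (hB : ∀ n, 0 ≤ B n)
    (hF : ∀ᶠ n in atTop, Continuous (F n) ∧ Integrable (F n) ∧ ∫ x, F n x = 0 ∧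
      ∀ x, |F n x| ≤ A n * (1 + x ^ 2) ^ 2 * gauss x + B n * vn n σ δ α * om α x)
    (h1 : Tendsto (fun n : ℕ => (n : ℝ) * A n ^ 2) atTop (𝓝 0))
    (h2 : Tendsto (fun n : ℕ => (n : ℝ) * B n ^ 2 * vn n σ δ α) atTop (𝓝 0)) : AA σ δ α F := by
  obtain ⟨C, hC, v₀, hv0, hv1, h⟩ := generic hα
  have key : ∀ᶠ n : ℕ in atTop, (Continuous (F n) ∧ Integrable (F n) ∧ ∫ x, F n x = 0 ∧
    Integrable fun x => F n x ^ 2 / T α (vn n σ δ α) 0 0 x) ∧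
    (0 ≤ (n : ℝ) * ∫ x, F n x ^ 2 / T α (vn n σ δ α) 0 0 x) ∧
    (n : ℝ) * ∫ x, F n x ^ 2 / T α (vn n σ δ α) 0 0 x ≤
      C * ((n : ℝ) * A n ^ 2 + (n : ℝ) * B n ^ 2 * vn n σ δ α) := by
    filter_upwards [hF, ev_v hα hv0, f_pos_ev hσ hδ hα] with n hF hn fp
    obtain ⟨k1, k2, -, -⟩ := h _ (vn_pos (α := α) hσ hδ (by omega)) hn.2 (A n) (B n) (hA n) (hB n) (F n) hF.1 hF.2.2.2
    refine ⟨⟨hF.1, hF.2.1, hF.2.2.1, k1⟩, mul_nonneg (by positivity) (integral_nonneg fun x => ?_), ?_⟩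
    · have := fp x
      positivity
    · refine (mul_le_mul_of_nonneg_left k2 (by positivity)).trans (le_of_eq ?_)
      ring
  refine ⟨key.mono fun n h => h.1, ?_⟩
  refine squeeze_zero' (key.mono fun n h => h.2.1) (key.mono fun n h => h.2.2) ?_
  simpa using (h1.add h2).const_mul C

lemma BB_of (hσ : 0 < σ) (hδ : 0 < δ) (hα : α ∈ Ioo (0 : ℝ) 2) {F : ℕ → ℝ → ℝ} {A B : ℕ → ℝ} (hA : ∀ n, 0 ≤ A n) (hB : ∀ n, 0 ≤ B n)
    (hF : ∀ᶠ n in atTop, Continuous (F n) ∧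
      ∀ x, |F n x| ≤ A n * (1 + x ^ 2) ^ 2 * gauss x + B n * vn n σ δ α * om α x)
    (h1 : Tendsto (fun n : ℕ => (n : ℝ) * A n ^ 4) atTop (𝓝 0))
    (h2 : Tendsto (fun n : ℕ => (n : ℝ) * B n ^ 4 * vn n σ δ α) atTop (𝓝 0)) : BB σ δ α F := by
  obtain ⟨C, hC, v₀, hv0, hv1, h⟩ := generic hα
  have key : ∀ᶠ n : ℕ in atTop, (Continuous (F n) ∧
    Integrable fun x => F n x ^ 4 / T α (vn n σ δ α) 0 0 x ^ 3) ∧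
    (0 ≤ (n : ℝ) * ∫ x, F n x ^ 4 / T α (vn n σ δ α) 0 0 x ^ 3) ∧
    (n : ℝ) * ∫ x, F n x ^ 4 / T α (vn n σ δ α) 0 0 x ^ 3 ≤
      C * ((n : ℝ) * A n ^ 4 + (n : ℝ) * B n ^ 4 * vn n σ δ α) := by
    filter_upwards [hF, ev_v hα hv0, f_pos_ev hσ hδ hα] with n hF hn fp
    obtain ⟨-, -, k1, k2⟩ := h _ (vn_pos (α := α) hσ hδ (by omega)) hn.2 (A n) (B n) (hA n) (hB n) (F n) hF.1 hF.2
    refine ⟨⟨hF.1, k1⟩, mul_nonneg (by positivity) (integral_nonneg fun x => ?_), ?_⟩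
    · have := fp x
      positivity
    · refine (mul_le_mul_of_nonneg_left k2 (by positivity)).trans (le_of_eq ?_)
      ring
  refine ⟨key.mono fun n h => h.1, ?_⟩
  refine squeeze_zero' (key.mono fun n h => h.2.1) (key.mono fun n h => h.2.2) ?_
  simpa using (h1.add h2).const_mul C

lemma inv_lim (hσ : 0 < σ) (hδ : 0 < δ) (hα : α ∈ Ioo (0 : ℝ) 2) : Tendsto (fun n : ℕ => (1 : ℝ) / n) atTop (𝓝 0) := tendsto_const_div_atTop_nhds_zero_nat 1

lemma BB_Zt (hσ : 0 < σ) (hδ : 0 < δ) (hα : α ∈ Ioo (0 : ℝ) 2) (i : Fin 3) : BB σ δ α (fun n => Zt n σ δ α i) := by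
  by_cases hi : i = 0
  · subst hi
    obtain ⟨C, hC, h⟩ := Zt0_bound hσ hδ hα
    have e : ∀ n : ℕ, 3 ≤ n → C ^ 4 * (1 / (n : ℝ)) = (n : ℝ) * (C * (1 / √(n : ℝ))) ^ 4 := by
      intro n hn
      have hn0 : (0 : ℝ) < n := by positivity
      rw [mul_pow, div_pow, show √(n : ℝ) ^ 4 = (√(n : ℝ) ^ 2) ^ 2 by ring, Real.sq_sqrt hn0.le]
      field_simp
    have l1 : Tendsto (fun n : ℕ => (n : ℝ) * (C * (1 / √(n : ℝ))) ^ 4) atTop (𝓝 0) := by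
      have := (inv_lim hσ hδ hα).const_mul (C ^ 4)
      rw [mul_zero] at this
      refine this.congr' ?_
      filter_upwards [eventually_ge_atTop 3] with n hn using e n hn
    refine BB_of hσ hδ hα (A := fun n : ℕ => C * (1 / √(n : ℝ))) (B := fun n : ℕ => C * (1 / √(n : ℝ)))
      (fun n => by positivity) (fun n => by positivity) ?_ l1 ?_
    · filter_upwards [eventually_ge_atTop 3] with n hn using h n hn
    · simpa using l1.mul (vn_lim (σ := σ) (δ := δ) hα)
  · obtain ⟨C, hC, h⟩ := OB_Zt hσ hδ hα hi
    refine BB_of hσ hδ hα (A := fun n : ℕ => 0) (B := fun n : ℕ => C * (rate n α * Real.log n ^ 2))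
      (fun n => le_rfl) (fun n => by have := rate_nonneg n α; positivity) ?_ (by simp) ?_
    · filter_upwards [ev_v hα one_pos] with n hn
      obtain ⟨k1, -, -, k2⟩ := h n hn.1 hn.2
      refine ⟨k1, fun x => (k2 x).trans (le_of_eq ?_)⟩
      ring
    · have := (lim1 (σ := σ) (δ := δ) hα).const_mul (C ^ 4)
      rw [mul_zero] at this
      refine this.congr fun n => ?_
      ring

lemma AA_Wt (hσ : 0 < σ) (hδ : 0 < δ) (hα : α ∈ Ioo (0 : ℝ) 2) (i j : Fin 3) : AA σ δ α (fun n => Wt n σ δ α i j) := by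
  have h0 : ∀ j : Fin 3, j ≠ 0 → AA σ δ α (fun n => Wt n σ δ α 0 j) := by
    intro j hj
    obtain ⟨C, hC, h⟩ := OB_Wt0 hσ hδ hα hj
    refine AA_of hσ hδ hα (A := fun n : ℕ => 0) (B := fun n : ℕ => C * (1 / √(n : ℝ) * rate n α * Real.log n ^ 3))
      (fun n => le_rfl) (fun n => ?_) ?_ (by simp) ?_
    · have := rate_nonneg n α
      have : 0 ≤ Real.log (n : ℝ) := Real.log_natCast_nonneg n
      positivity
    · filter_upwards [ev_v hα one_pos] with n hn
      obtain ⟨k1, k3, k4, k2⟩ := h n hn.1 hn.2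
      refine ⟨k1, k3, k4, fun x => (k2 x).trans (le_of_eq ?_)⟩
      ring
    · have := (lim2 (σ := σ) (δ := δ) hα).const_mul (C ^ 2)
      rw [mul_zero] at this
      refine this.congr fun n => ?_
      ring
  by_cases hi : i = 0
  · subst hi
    by_cases hj : j = 0
    · subst hj
      obtain ⟨C, hC, h⟩ := Wt00_bound hσ hδ hα
      have l1 : Tendsto (fun n : ℕ => (n : ℝ) * (C * (1 / (n : ℝ))) ^ 2) atTop (𝓝 0) := by
        have := (inv_lim hσ hδ hα).const_mul (C ^ 2)
        rw [mul_zero] at this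
        refine this.congr' ?_
        filter_upwards [eventually_ge_atTop 3] with n hn
        field_simp
      refine AA_of hσ hδ hα (A := fun n : ℕ => C * (1 / (n : ℝ))) (B := fun n : ℕ => C * (1 / (n : ℝ)))
        (fun n => by positivity) (fun n => by positivity) ?_ l1 ?_
      · filter_upwards [eventually_ge_atTop 3] with n hn using h n hn
      · simpa using l1.mul (vn_lim (σ := σ) (δ := δ) hα)
    · exact h0 j hj
  · by_cases hj : j = 0
    · subst hj
      have := h0 i hi
      have e : (fun n => Wt n σ δ α i 0) = (fun n => Wt n σ δ α 0 i) :=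
        funext fun n => funext fun x => Wt_symm n σ δ α x i 0
      rwa [e]
    · obtain ⟨C, hC, h⟩ := OB_Wt11 hσ hδ hα hi hj
      refine AA_of hσ hδ hα (A := fun n : ℕ => 0) (B := fun n : ℕ => C * (rate n α * rate n α * Real.log n ^ 4))
        (fun n => le_rfl) (fun n => by have := rate_nonneg n α; positivity) ?_ (by simp) ?_
      · filter_upwards [ev_v hα one_pos] with n hn
        obtain ⟨k1, k3, k4, k2⟩ := h n hn.1 hn.2
        refine ⟨k1, k3, k4, fun x => (k2 x).trans (le_of_eq ?_)⟩
        ring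
      · have := (lim1 (σ := σ) (δ := δ) hα).const_mul (C ^ 2)
        rw [mul_zero] at this
        refine this.congr fun n => ?_
        ring

end

end


section

variable {σ δ α : ℝ}

section

lemma good_ev (hσ : 0 < σ) (hδ : 0 < δ) (hα : α ∈ Ioo (0 : ℝ) 2) (i j : Fin 3) : ∀ᶠ n : ℕ in atTop, Good (T α (vn n σ δ α) 0 0) (Wt n σ δ α i j)
    (Zt n σ δ α i) (Zt n σ δ α j) := by
  filter_upwards [f_pos_ev hσ hδ hα, (AA_Wt hσ hδ hα i j).1, (BB_Zt hσ hδ hα i).1, (BB_Zt hσ hδ hα j).1] with n h1 h2 h3 h4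
  have hv := vn_nonneg (α := α) hσ hδ n
  exact ⟨T_continuous hα le_rfl 0 hv, h1, T00_integrable hα hv, T00_int hα hv, h2.1, h3.1, h4.1, h2.2.1, h2.2.2.1,
    h2.2.2.2, h3.2, h4.2⟩

lemma uJu_eq (hσ : 0 < σ) (hδ : 0 < δ) (hα : α ∈ Ioo (0 : ℝ) 2) {n : ℕ} (hn : 1 ≤ n) (hpos : ∀ x, 0 < T α (vn n σ δ α) 0 0 x) (y : Fin n → ℝ) (i j : Fin 3) :
    ((un n ![σ, δ, α])ᵀ * hessMat n ![σ, δ, α] y * un n ![σ, δ, α]) i j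
      = ∑ k, hfun (T α (vn n σ δ α) 0 0) (Wt n σ δ α i j) (Zt n σ δ α i) (Zt n σ δ α j)
        (√(n : ℝ) / σ * y k) := by
  have hB : ![σ, δ, α] ∈ Box σ δ α := by
    have h1 := hα.1
    have h2 := hα.2
    simp only [Box, mem_ofPred_eq]
    simp
    refine ⟨?_, ?_, ?_, ?_, ?_, ?_⟩ <;> linarith
  have hp : ∀ x, 0 < PF n σ ![σ, δ, α] x := fun x => by rw [PF_at hσ hδ hn]; exact hpos x
  simp only [Matrix.mul_apply, Matrix.transpose_apply]
  simp_rw [hess_eq _ hσ hδ hα hn hB y hp]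
  simp_rw [PF_at hσ hδ hn]
  simp only [Finset.sum_mul, Finset.mul_sum]
  rw [Finset.sum_congr rfl fun l _ => Finset.sum_comm, Finset.sum_comm]
  refine Finset.sum_congr rfl fun k _ => ?_
  rw [show √(n : ℝ) * y k / σ = √(n : ℝ) / σ * y k by ring]
  set x := √(n : ℝ) / σ * y k
  unfold hfun Wt Zt
  simp only [Fin.sum_univ_three]
  ring

lemma final_of (hσ : 0 < σ) (hδ : 0 < δ) (hα : α ∈ Ioo (0 : ℝ) 2)
    (hC : ∀ i j, Tendsto (fun n : ℕ => (n : ℝ) * ∫ x, Zt n σ δ α i x * Zt n σ δ α j x / T α (vn n σ δ α) 0 0 x)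
      atTop (𝓝 (Imat ![σ, δ, α] i j))) {ε : ℝ} (hε : 0 < ε) :
      Tendsto
        (fun n : ℕ => Pn n ![σ, δ, α]
          {x | ε < frobNorm
            ((un n ![σ, δ, α])ᵀ * hessMat n ![σ, δ, α] x * un n ![σ, δ, α]
              + Imat ![σ, δ, α])})
        atTop (𝓝 0) := by
  set M : ∀ n : ℕ, Fin 3 → Fin 3 → Set (Fin n → ℝ) := fun n i j =>
    {x | ε / 3 ≤ |∑ k, hfun (T α (vn n σ δ α) 0 0) (Wt n σ δ α i j) (Zt n σ δ α i) (Zt n σ δ α j)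
        (√(n : ℝ) / σ * x k) + Imat ![σ, δ, α] i j|} with hM
  set Q : ∀ n : ℕ, Measure (Fin n → ℝ) := fun n => Measure.pi
      (fun _ : Fin n => volume.withDensity fun y => ENNReal.ofReal (√(n : ℝ) / σ * T α (vn n σ δ α) 0 0 (√(n : ℝ) / σ * y)))
    with hQ
  have hent : ∀ i j, Tendsto (fun n => Q n (M n i j)) atTop (𝓝 0) := by
    intro i j
    refine entry_conv (good_ev hσ hδ hα i j) (c := fun n : ℕ => √(n : ℝ) / σ) ?_ (AA_Wt hσ hδ hα i j).2
      (BB_Zt hσ hδ hα i).2 (BB_Zt hσ hδ hα j).2 (hC i j) (by positivity)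
    filter_upwards [eventually_ge_atTop 1] with n hn
    have : (0 : ℝ) < n := by exact_mod_cast hn
    positivity
  have hsum : Tendsto (fun n => ∑ i, ∑ j, Q n (M n i j)) atTop (𝓝 0) := by
    have := tendsto_finsetSum Finset.univ fun i (_ : i ∈ Finset.univ) =>
      tendsto_finsetSum Finset.univ fun j (_ : j ∈ Finset.univ) => hent i j
    simpa using this
  refine tendsto_of_tendsto_of_tendsto_of_le_of_le' tendsto_const_nhds hsum
    (Eventually.of_forall fun _ => zero_le) ?_
  filter_upwards [eventually_ge_atTop 1, f_pos_ev hσ hδ hα] with n hn hpos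
  have hPQ : Pn n ![σ, δ, α] = Q n := by
    rw [hQ, Pn]
    congr 1
    funext _
    congr 1
    funext y
    rw [pdens_eq hn hσ (by simpa using hσ) (by simpa using hδ) (by simpa using hα.1), PF_at hσ hδ hn,
      show √(n : ℝ) * y / σ = √(n : ℝ) / σ * y by ring]
  rw [hPQ]
  refine le_trans (measure_mono (t := ⋃ i, ⋃ j, M n i j) ?_) ?_
  · intro x hx
    simp only [mem_ofPred_eq] at hx
    by_contra hcon
    simp only [mem_iUnion, not_exists, hM, mem_ofPred_eq, not_le] at hcon
    have hle : frobNorm ((un n ![σ, δ, α])ᵀ * hessMat n ![σ, δ, α] x * un n ![σ, δ, α]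
              + Imat ![σ, δ, α]) ≤ ε := by
      unfold frobNorm
      refine Real.sqrt_le_iff.2 ⟨hε.le, ?_⟩
      have : ∀ i j, ((un n ![σ, δ, α])ᵀ * hessMat n ![σ, δ, α] x * un n ![σ, δ, α]
              + Imat ![σ, δ, α]) i j ^ 2 ≤ (ε / 3) ^ 2 := by
        intro i j
        rw [Matrix.add_apply, uJu_eq hσ hδ hα hn hpos, ← sq_abs]
        exact pow_le_pow_left₀ (abs_nonneg _) (hcon i j).le 2
      calc _ ≤ ∑ i : Fin 3, ∑ j : Fin 3, (ε / 3) ^ 2 :=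
            Finset.sum_le_sum fun i _ => Finset.sum_le_sum fun j _ => this i j
        _ = ε ^ 2 := by simp; ring
    linarith
  · refine (measure_iUnion_fintype_le _ _).trans (Finset.sum_le_sum fun i _ => ?_)
    exact measure_iUnion_fintype_le _ _

end

end


section

lemma gauss_quarter (x : ℝ) : gauss x ^ (1 / 4 : ℝ) = (√(2 * Real.pi))⁻¹ ^ (1 / 4 : ℝ) * Real.exp (-(x ^ 2) / 8) := by
  unfold gauss
  rw [Real.mul_rpow (by positivity) (by positivity), ← Real.exp_mul]
  congr 2; ring

lemma quarter_integrable : Integrable fun x : ℝ => (1 + x ^ 2) ^ 3 * Real.exp (-(x ^ 2) / 8) := by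
  have h := ((poly_gauss 3).comp_div (R := (2 : ℝ)) (by norm_num)).const_mul (64 * √(2 * Real.pi))
  refine h.mono' (by fun_prop) (ae_of_all _ fun x => ?_)
  rw [Real.norm_of_nonneg (by positivity)]
  have e : gauss (x / 2) = (√(2 * Real.pi))⁻¹ * Real.exp (-(x ^ 2) / 8) := by
    unfold gauss; congr 2; ring
  rw [e]
  have hp : √(2 * Real.pi) ≠ 0 := by positivity
  have e2 : 64 * √(2 * Real.pi) * ((1 + (x / 2) ^ 2) ^ 3 * ((√(2 * Real.pi))⁻¹ * Real.exp (-(x ^ 2) / 8)))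
      = (4 * (1 + (x / 2) ^ 2)) ^ 3 * Real.exp (-(x ^ 2) / 8) := by field_simp; ring
  rw [e2]
  gcongr
  nlinarith [sq_nonneg x]

lemma core01 {α : ℝ} (hα : α ∈ Ioo (0 : ℝ) 2) :
    ∃ K : ℝ, 0 ≤ K ∧ ∃ v₀ : ℝ, 0 < v₀ ∧ v₀ ≤ 1 ∧ ∀ v : ℝ, 0 < v → v ≤ v₀ → ∀ A B : ℝ, 0 ≤ A → 0 ≤ B →
      ∀ H G : ℝ → ℝ, 
      (∀ x, |H x| ≤ A * (1 + x ^ 2) ^ 2 * gauss x + A * v * om α x) → (∀ x, |G x| ≤ B * v * om α x) →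
      |∫ x, H x * G x / T α v 0 0 x| ≤ K * A * B * v ^ (3 / 4 : ℝ) := by
  obtain ⟨c, hc, v₀, hv0, hv1, hl⟩ := f_lower hα
  have hα0 := hα.1
  have hα2 := hα.2
  have i3 : Integrable fun x : ℝ => (1 + |x|) ^ (-1 - 3 * α / 4) := pw_integrable (by positivity)
  set q := (√(2 * Real.pi))⁻¹ ^ (1 / 4 : ℝ) with hq
  have hq0 : 0 ≤ q := by positivity
  set g : ℝ → ℝ := fun x => 2 * q * ((1 + x ^ 2) ^ 3 * Real.exp (-(x ^ 2) / 8)) + (1 + |x|) ^ (-1 - 3 * α / 4) with hg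
  have ig : Integrable g := (quarter_integrable.const_mul (2 * q)).add i3
  have g0 : ∀ x, 0 ≤ g x := fun x => by positivity
  refine ⟨(∫ x, g x) / c, div_nonneg (integral_nonneg g0) hc.le, v₀, hv0, hv1, ?_⟩
  intro v hv hvv A B hA hB H G hH hG
  have hbd : ∀ x, ‖H x * G x / T α v 0 0 x‖ ≤ A * B * v ^ (3 / 4 : ℝ) / c * g x := by
    intro x
    have hgp := gauss_pos x
    have hr := rho_pos α x
    have hw := om_pos α x
    have l0 := hl v hv.le hvv x
    set φ := gauss x
    set r := rho α x
    set w := om α x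
    set f := T α v 0 0 x
    have hvr : 0 < v * r := by positivity
    have l1 : c * (φ ^ (3 / 4 : ℝ) * (v * r) ^ (1 / 4 : ℝ)) ≤ f := by
      have := Real.geom_mean_le_arith_mean2_weighted (w₁ := 3 / 4) (w₂ := 1 / 4) (by norm_num) (by norm_num)
        hgp.le hvr.le (by norm_num)
      refine le_trans ?_ l0
      gcongr
      linarith
    have l2 : c * (v * r) ≤ f := le_trans (by gcongr; linarith) l0
    have hf : 0 < f := lt_of_lt_of_le (by positivity) l2
    have e1 : φ = φ ^ (3 / 4 : ℝ) * φ ^ (1 / 4 : ℝ) := by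
      rw [← Real.rpow_add hgp]; norm_num
    have e2 : v = v ^ (3 / 4 : ℝ) * v ^ (1 / 4 : ℝ) := by
      rw [← Real.rpow_add hv]; norm_num
    have e3 : (v * r) ^ (1 / 4 : ℝ) = v ^ (1 / 4 : ℝ) * r ^ (1 / 4 : ℝ) := Real.mul_rpow hv.le hr.le
    have hv34 : v ≤ v ^ (3 / 4 : ℝ) := by
      have := Real.rpow_le_rpow_of_exponent_ge hv (hvv.trans hv1) (by norm_num : (3 / 4 : ℝ) ≤ 1)
      simpa using this
    have k1 : φ * v / f ≤ v ^ (3 / 4 : ℝ) / c * (φ ^ (1 / 4 : ℝ) / r ^ (1 / 4 : ℝ)) := by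
      have a1 : 0 < φ ^ (3 / 4 : ℝ) := by positivity
      have a2 : 0 < φ ^ (1 / 4 : ℝ) := by positivity
      have a3 : 0 < v ^ (1 / 4 : ℝ) := by positivity
      have a4 : 0 < v ^ (3 / 4 : ℝ) := by positivity
      have a5 : 0 < r ^ (1 / 4 : ℝ) := by positivity
      calc φ * v / f ≤ φ * v / (c * (φ ^ (3 / 4 : ℝ) * (v * r) ^ (1 / 4 : ℝ))) := by gcongr
        _ = (φ ^ (3 / 4 : ℝ) * φ ^ (1 / 4 : ℝ)) * (v ^ (3 / 4 : ℝ) * v ^ (1 / 4 : ℝ)) / (c * (φ ^ (3 / 4 : ℝ) * (v * r) ^ (1 / 4 : ℝ))) := by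
          rw [← e1, ← e2]
        _ = _ := by rw [e3]; field_simp
    have k2 : φ ^ (1 / 4 : ℝ) / r ^ (1 / 4 : ℝ) ≤ q * Real.exp (-(x ^ 2) / 8) * (2 * (1 + x ^ 2)) := by
      have e4 : φ ^ (1 / 4 : ℝ) = q * Real.exp (-(x ^ 2) / 8) := gauss_quarter x
      have hx : 1 ≤ 1 + |x| := by linarith [abs_nonneg x]
      have e5 : (r ^ (1 / 4 : ℝ))⁻¹ ≤ 2 * (1 + x ^ 2) := by
        have : (r ^ (1 / 4 : ℝ))⁻¹ = (1 + |x|) ^ ((1 + α) / 4) := by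
          change (((1 + |x|) ^ (-1 - α)) ^ (1 / 4 : ℝ))⁻¹ = _
          rw [← Real.rpow_mul (by positivity), ← Real.rpow_neg (by positivity)]
          congr 1; ring
        rw [this]
        have := Real.rpow_le_rpow_of_exponent_le hx (by linarith : (1 + α) / 4 ≤ 1)
        rw [Real.rpow_one] at this
        have h2 := sq_abs x
        nlinarith [sq_nonneg (|x| - 1), abs_nonneg x]
      rw [div_eq_mul_inv, e4]
      gcongr
    have k3 : v * v * w ^ 2 / f ≤ v / c * (w ^ 2 / r) := by
      calc v * v * w ^ 2 / f ≤ v * v * w ^ 2 / (c * (v * r)) := by gcongr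
        _ = _ := by field_simp
    have k4 : w ^ 2 / r = (1 + |x|) ^ (-1 - 3 * α / 4) := om2_rho α x
    have hw1 : w ≤ 1 := om_le_one hα0 x
    rw [Real.norm_eq_abs, abs_div, abs_of_pos hf, abs_mul]
    calc |H x| * |G x| / f ≤ (A * (1 + x ^ 2) ^ 2 * φ + A * v * w) * (B * v * w) / f := by
          gcongr
          · exact hH x
          · exact hG x
      _ = A * B * ((1 + x ^ 2) ^ 2 * w * (φ * v / f) + v * v * w ^ 2 / f) := by ring
      _ ≤ A * B * ((1 + x ^ 2) ^ 2 * 1 * (v ^ (3 / 4 : ℝ) / c * (q * Real.exp (-(x ^ 2) / 8) * (2 * (1 + x ^ 2))))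
            + v ^ (3 / 4 : ℝ) / c * (w ^ 2 / r)) := by
          have k5 : φ * v / f ≤ v ^ (3 / 4 : ℝ) / c * (q * Real.exp (-(x ^ 2) / 8) * (2 * (1 + x ^ 2))) :=
            k1.trans (by gcongr)
          have k6 : v * v * w ^ 2 / f ≤ v ^ (3 / 4 : ℝ) / c * (w ^ 2 / r) := k3.trans (by gcongr)
          gcongr
      _ = A * B * v ^ (3 / 4 : ℝ) / c * g x := by rw [k4, hg]; ring
  have := norm_integral_le_of_norm_le (ig.const_mul (A * B * v ^ (3 / 4 : ℝ) / c)) (ae_of_all _ hbd)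
  rw [integral_const_mul] at this
  rw [← Real.norm_eq_abs]
  refine this.trans (le_of_eq ?_)
  ring

section
variable {σ δ α : ℝ} (hσ : 0 < σ) (hδ : 0 < δ) (hα : α ∈ Ioo (0 : ℝ) 2)

lemma lim01 (hσ : 0 < σ) (hδ : 0 < δ) (hα : α ∈ Ioo (0 : ℝ) 2) :
    Tendsto (fun n : ℕ => (n : ℝ) * ((1 / √(n : ℝ)) * (rate n α * Real.log n ^ 2) * vn n σ δ α ^ (3 / 4 : ℝ))) atTop (𝓝 0) := by
  have h := (loglim (α / 4 + 2) (b := 1 / 4 - α / 8) (by linarith [hα.2])).mul_const (((δ / σ) ^ α) ^ (3 / 4 : ℝ))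
  rw [zero_mul] at h
  refine h.congr' ?_
  filter_upwards [eventually_ge_atTop 3] with n hn
  have hl := log_ge_one hn
  have hn0 : (0 : ℝ) < n := by positivity
  have hr := rate_pow (α := α) hn 1
  rw [pow_one] at hr
  rw [hr]
  unfold vn
  rw [Real.mul_rpow (by positivity) (by positivity), ← Real.rpow_mul hn0.le, Real.rpow_add (by linarith),
    Real.sqrt_eq_rpow, one_div ((n : ℝ) ^ _), ← Real.rpow_neg hn0.le]
  have e : (n : ℝ) ^ (-(1 / 4 - α / 8)) = (n : ℝ) * (n : ℝ) ^ (-(1 / 2) : ℝ) * (n : ℝ) ^ (-(α / 4 * ((1 : ℕ) : ℝ)))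
      * (n : ℝ) ^ ((α / 2 - 1) * (3 / 4)) := by
    nth_rewrite 2 [← Real.rpow_one (n : ℝ)]
    rw [← Real.rpow_add hn0, ← Real.rpow_add hn0, ← Real.rpow_add hn0]
    congr 1; push_cast; ring
  rw [e]
  have e2 : Real.log n ^ (2 : ℝ) = Real.log n ^ 2 := by
    rw [← Real.rpow_natCast]; norm_num
  rw [e2]
  push_cast
  rw [mul_one]
  ring

lemma C0j (hσ : 0 < σ) (hδ : 0 < δ) (hα : α ∈ Ioo (0 : ℝ) 2) {j : Fin 3} (hj : j ≠ 0) :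
    Tendsto (fun n : ℕ => (n : ℝ) * ∫ x, Zt n σ δ α 0 x * Zt n σ δ α j x / T α (vn n σ δ α) 0 0 x) atTop (𝓝 0) := by
  obtain ⟨K, hK, v₀, hv0, hv1, hk⟩ := core01 hα
  obtain ⟨C, hC, hc⟩ := Zt0_bound hσ hδ hα
  obtain ⟨D, hD, hd⟩ := OB_Zt hσ hδ hα hj
  have h := (lim01 hσ hδ hα).const_mul (K * C * D)
  rw [mul_zero] at h
  refine squeeze_zero_norm' ?_ h
  filter_upwards [ev_v hα hv0] with n hn
  obtain ⟨hn, hv⟩ := hn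
  have hvp := vn_pos (α := α) hσ hδ (by omega : 0 < n)
  have hl := log_ge_one hn
  have hr := rate_nonneg n α
  have := hk _ hvp hv (C * (1 / √(n : ℝ))) (D * (rate n α * Real.log n ^ 2)) (by positivity) (by positivity) _ _
    (hc n hn).2 (fun x => ((hd n hn (hv.trans hv1)).2.2.2 x).trans (le_of_eq (by ring)))
  rw [norm_mul, Real.norm_eq_abs, Real.norm_eq_abs, abs_of_nonneg (Nat.cast_nonneg n)]
  calc (n : ℝ) * _ ≤ n * _ := mul_le_mul_of_nonneg_left this (Nat.cast_nonneg n)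
    _ = _ := by ring
end

end


section

lemma int_herm {α : ℝ} (hα : α ∈ Ioo (0 : ℝ) 2) : ∫ x : ℝ, ((1 - x ^ 2) * gauss x) ^ 2 / gauss x = 2 := by
  have i0 := T00_integrable hα le_rfl
  have i2 := T_integrable hα hα.2.le 0 le_rfl
  have i4 := T_integrable hα (by linarith [hα.2] : α ≤ 4) 0 le_rfl
  have e0 := T00_int hα le_rfl
  have e2 := T_int hα hα.2.le 0 le_rfl
  have e4 := T_int hα (by linarith [hα.2] : α ≤ 4) 0 le_rfl
  have := integral_sub i4 (i2.const_mul 4)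
  have h2 := integral_add (i4.sub (i2.const_mul 4)) (i0.const_mul 2)
  simp only [Pi.sub_apply] at h2 this
  rw [this, integral_const_mul, integral_const_mul, e0, e2, e4] at h2
  rw [show (2 : ℝ) = 0 - 4 * 0 + 2 * 1 by norm_num, ← h2]
  refine integral_congr_ae (ae_of_all _ fun x => ?_)
  simp only [T_zero0, T_zero2, T_zero4]
  have := gauss_pos x
  field_simp
  ring

section
variable {σ δ α : ℝ} 

lemma lim_of_bd {a : ℝ} {F : ℕ → ℝ} {C w : ℝ} (hα : α ∈ Ioo (0 : ℝ) 2)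
    (h : ∀ᶠ n : ℕ in atTop, |F n - a| ≤ C * vn n σ δ α * w) : Tendsto F atTop (𝓝 a) := by
  rw [tendsto_iff_norm_sub_tendsto_zero]
  have h1 := ((vn_lim (σ := σ) (δ := δ) hα).const_mul C).mul_const w
  rw [mul_zero, zero_mul] at h1
  refine squeeze_zero' (Eventually.of_forall fun n => norm_nonneg _) ?_ h1
  filter_upwards [h] with n hn
  exact hn

lemma C00 (hσ : 0 < σ) (hδ : 0 < δ) (hα : α ∈ Ioo (0 : ℝ) 2) :
    Tendsto (fun n : ℕ => (n : ℝ) * ∫ x, Zt n σ δ α 0 x * Zt n σ δ α 0 x / T α (vn n σ δ α) 0 0 x) atTop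
      (𝓝 (2 / σ ^ 2)) := by
  obtain ⟨c, hc, v₀, hv0, hv1, hl⟩ := f_lower hα
  obtain ⟨C, hC, h2⟩ := T2_bound hα
  obtain ⟨D, hD, h0⟩ := f_diff hα
  have hα0 := hα.1
  have i3 : Integrable fun x : ℝ => (1 + |x|) ^ (-1 - 3 * α / 4) := pw_integrable (by positivity)
  have key : Tendsto (fun n : ℕ => ∫ x, T α (vn n σ δ α) 2 0 x ^ 2 / T α (vn n σ δ α) 0 0 x) atTop
      (𝓝 (∫ x : ℝ, ((1 - x ^ 2) * gauss x) ^ 2 / gauss x)) := by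
    refine tendsto_integral_filter_of_dominated_convergence
      (fun x => 2 / c * ((1 + x ^ 2) ^ 4 * gauss x + C ^ 2 * (1 + |x|) ^ (-1 - 3 * α / 4))) ?_ ?_ ?_ ?_
    · filter_upwards [ev_v (σ := σ) (δ := δ) hα hv0] with n hn
      have hvp := vn_pos (α := α) hσ hδ (by omega : 0 < n)
      have := T_continuous hα le_rfl 0 hvp.le
      have := T_continuous hα (by norm_num : (0 : ℝ) ≤ 2) 0 hvp.le
      exact (by fun_prop : Measurable _).aestronglyMeasurable
    · filter_upwards [ev_v (σ := σ) (δ := δ) hα hv0] with n hn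
      refine ae_of_all _ fun x => ?_
      have hvp := vn_pos (α := α) hσ hδ (by omega : 0 < n)
      have hgp := gauss_pos x
      have hr := rho_pos α x
      have hw := om_pos α x
      have l0 := hl _ hvp.le hn.2 x
      have b2 := h2 _ hvp.le x
      have hvle := hn.2.trans hv1
      set v := vn n σ δ α
      have l1 : c * gauss x ≤ T α v 0 0 x := le_trans (by gcongr; linarith [mul_pos hvp hr]) l0
      have l2 : c * (v * rho α x) ≤ T α v 0 0 x := le_trans (by gcongr; linarith) l0
      have hf : 0 < T α v 0 0 x := lt_of_lt_of_le (by positivity) l1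
      rw [Real.norm_of_nonneg (by positivity)]
      have hb : |T α v 2 0 x| ≤ (1 + x ^ 2) ^ 2 * gauss x + C * v * om α x := by
        have h3 : |(1 - x ^ 2) * gauss x| ≤ (1 + x ^ 2) ^ 2 * gauss x := by
          rw [abs_mul, abs_of_pos hgp]
          gcongr
          rw [abs_le]
          constructor <;> nlinarith [sq_nonneg x, sq_nonneg (x ^ 2)]
        have := abs_add_le (T α v 2 0 x - (1 - x ^ 2) * gauss x) ((1 - x ^ 2) * gauss x)
        rw [sub_add_cancel] at this
        linarith
      refine (pt2 hb (by positivity) (by positivity) hc hgp hw.le (mul_pos hvp hr) l1 l2).trans ?_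
      have e : (C * v) ^ 2 * (om α x ^ 2 / (v * rho α x)) = v * (C ^ 2 * (1 + |x|) ^ (-1 - 3 * α / 4)) := by
        rw [← om2_rho]; field_simp
      rw [e]
      have : v * (C ^ 2 * (1 + |x|) ^ (-1 - 3 * α / 4)) ≤ 1 * (C ^ 2 * (1 + |x|) ^ (-1 - 3 * α / 4)) := by
        gcongr
      rw [one_mul] at this
      have e2 : ((1 + x ^ 2) ^ 2) ^ 2 * gauss x = (1 + x ^ 2) ^ 4 * gauss x := by ring
      rw [e2]
      gcongr
    · exact ((poly_gauss 4).add (i3.const_mul (C ^ 2))).const_mul (2 / c)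
    · refine ae_of_all _ fun x => ?_
      have a1 : Tendsto (fun n : ℕ => T α (vn n σ δ α) 2 0 x) atTop (𝓝 ((1 - x ^ 2) * gauss x)) := by
        refine lim_of_bd (σ := σ) (δ := δ) (C := C) (w := om α x) hα ?_
        filter_upwards [ev_v (σ := σ) (δ := δ) hα hv0] with n hn
        exact h2 _ (vn_pos (α := α) hσ hδ (by omega : 0 < n)).le x
      have a2 : Tendsto (fun n : ℕ => T α (vn n σ δ α) 0 0 x) atTop (𝓝 (gauss x)) := by
        refine lim_of_bd (σ := σ) (δ := δ) (C := D) (w := om α x) hα ?_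
        filter_upwards [ev_v (σ := σ) (δ := δ) hα hv0] with n hn
        exact h0 _ (vn_pos (α := α) hσ hδ (by omega : 0 < n)).le x
      exact (a1.pow 2).div a2 (gauss_pos x).ne'
  rw [int_herm hα] at key
  have := key.const_mul (1 / σ ^ 2)
  rw [show 1 / σ ^ 2 * 2 = 2 / σ ^ 2 by ring] at this
  refine this.congr' ?_
  filter_upwards [eventually_ge_atTop 3] with n hn
  have hn0 : (0 : ℝ) < n := by positivity
  rw [← integral_const_mul, ← integral_const_mul]
  refine integral_congr_ae (ae_of_all _ fun x => ?_)
  simp only [Zt0, PF1_at0 hσ hδ hα (by omega : 0 < n) x]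
  have hs : √(n : ℝ) ^ 2 = n := Real.sq_sqrt hn0.le
  have e : (n : ℝ) * (1 / √(n : ℝ)) ^ 2 = 1 := by rw [div_pow, hs]; field_simp
  calc 1 / σ ^ 2 * (T α (vn n σ δ α) 2 0 x ^ 2 / T α (vn n σ δ α) 0 0 x)
      = ((n : ℝ) * (1 / √(n : ℝ)) ^ 2) * (1 / σ ^ 2 * (T α (vn n σ δ α) 2 0 x ^ 2 / T α (vn n σ δ α) 0 0 x)) := by
        rw [e, one_mul]
    _ = _ := by ring
end

end


section

def AT (α v p e s x : ℝ) : ℝ := (p + e * Real.log s) * T α v α 0 x + e * T α v α 1 x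

def PP (α p e : ℝ) : ℝ := p + e * (deriv cAlpha α / cAlpha α)

section
variable {α : ℝ}

lemma AT_asym (hα : α ∈ Ioo (0 : ℝ) 2) (p e : ℝ) :
    ∃ C : ℝ, 0 ≤ C ∧ ∀ v : ℝ, 0 ≤ v → v ≤ 1 → ∀ s : ℝ, 1 ≤ s → ∀ ξ : ℝ, 0 < ξ → 1 ≤ s * ξ →
      |s ^ (1 + α) * AT α v p e s (s * ξ) - -(cAlpha α * ξ ^ (-1 - α) * (PP α p e - e * Real.log ξ))|
        ≤ C * ((1 + Real.log s) * s ^ (-(α / 2))) * ξ ^ (-1 - 3 * α / 2) := by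
  obtain ⟨C, hC, h0⟩ := asym_T0 hα
  obtain ⟨D, hD, h1⟩ := asym_T1 hα
  have hc := cAlpha_pos hα
  refine ⟨(|p| + |e|) * C + |e| * D, by positivity, fun v hv hv1 s hs ξ hξ hx => ?_⟩
  have hs0 : 0 < s := by linarith
  have b0 := h0 v hv hv1 _ hx
  have b1 := h1 v hv hv1 _ hx
  have hls := Real.log_nonneg hs
  have e1 : (s * ξ) ^ (-1 - α) = s ^ (-1 - α) * ξ ^ (-1 - α) := Real.mul_rpow hs0.le hξ.le
  have e2 : (s * ξ) ^ (-1 - 3 * α / 2) = s ^ (-1 - 3 * α / 2) * ξ ^ (-1 - 3 * α / 2) := Real.mul_rpow hs0.le hξ.le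
  have e3 : s ^ (1 + α) * s ^ (-1 - α) = 1 := by
    rw [← Real.rpow_add hs0]; norm_num
  have e4 : s ^ (1 + α) * s ^ (-1 - 3 * α / 2) = s ^ (-(α / 2)) := by
    rw [← Real.rpow_add hs0]; congr 1; ring
  have e5 : Real.log (s * ξ) = Real.log s + Real.log ξ := Real.log_mul hs0.ne' hξ.ne'
  rw [e1, e2] at b0 b1
  rw [e5] at b1
  set t0 := T α v α 0 (s * ξ) with ht0
  set t1 := T α v α 1 (s * ξ) with ht1
  set S := s ^ (1 + α) with hS
  have hS0 : 0 < S := by positivity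
  set R := ξ ^ (-1 - 3 * α / 2)
  have hR : 0 < R := by positivity
  have key : S * AT α v p e s (s * ξ) - -(cAlpha α * ξ ^ (-1 - α) * (PP α p e - e * Real.log ξ))
      = S * ((p + e * Real.log s) * (t0 + cAlpha α * (s ^ (-1 - α) * ξ ^ (-1 - α)))
        + e * (t1 + (deriv cAlpha α - cAlpha α * (Real.log s + Real.log ξ)) * (s ^ (-1 - α) * ξ ^ (-1 - α)))) := by
    have e6 : cAlpha α * PP α p e = cAlpha α * p + e * deriv cAlpha α := by
      unfold PP; field_simp
    unfold AT
    rw [← ht0, ← ht1]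
    linear_combination (-ξ ^ (-1 - α) * ((p + e * Real.log s) * cAlpha α + e * (deriv cAlpha α - cAlpha α * (Real.log s + Real.log ξ)))) * e3
      + ξ ^ (-1 - α) * e6
  rw [key, abs_mul, abs_of_pos hS0]
  have hpe : |p + e * Real.log s| ≤ (|p| + |e|) * (1 + Real.log s) := by
    refine (abs_add_le _ _).trans ?_
    rw [abs_mul, abs_of_nonneg hls]
    nlinarith [abs_nonneg p, abs_nonneg e, mul_nonneg (abs_nonneg p) hls]
  calc S * |_| ≤ S * ((|p| + |e|) * (1 + Real.log s) * (C * (s ^ (-1 - 3 * α / 2) * R))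
        + |e| * (1 + Real.log s) * (D * (s ^ (-1 - 3 * α / 2) * R))) := by
        gcongr
        refine (abs_add_le _ _).trans ?_
        rw [abs_mul, abs_mul]
        have : |e| ≤ |e| * (1 + Real.log s) := by nlinarith [abs_nonneg e]
        gcongr
    _ = ((|p| + |e|) * C + |e| * D) * ((1 + Real.log s) * (S * s ^ (-1 - 3 * α / 2))) * R := by ring
    _ = _ := by rw [e4]

lemma log_fac {s : ℝ} (hα : 0 < α) (hs : 1 ≤ s) : (1 + Real.log s) * s ^ (-(α / 2)) ≤ 1 + 2 / α := by
  have hs0 : 0 < s := by linarith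
  have h1 := Real.log_le_rpow_div hs0.le (by positivity : 0 < α / 2)
  have h2 : 1 ≤ s ^ (α / 2) := Real.one_le_rpow hs (by positivity)
  rw [Real.rpow_neg hs0.le, ← div_eq_mul_inv, div_le_iff₀ (by positivity)]
  calc 1 + Real.log s ≤ s ^ (α / 2) + s ^ (α / 2) / (α / 2) := by linarith
    _ = _ := by field_simp

lemma log_fac2 {η : ℝ} (hα : 0 < α) (hη : 0 < η) : ∃ K : ℝ, 0 ≤ K ∧ ∀ ξ, η ≤ ξ → 1 + |Real.log ξ| ≤ K * ξ ^ (α / 4) := by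
  refine ⟨(1 + |Real.log η| + 4 / α) * η ^ (-(α / 4)), by positivity, fun ξ hξ => ?_⟩
  have hξ0 : 0 < ξ := by linarith
  have h1 : 1 ≤ ξ / η := by rwa [le_div_iff₀ hη, one_mul]
  have h2 := Real.log_le_rpow_div (by positivity : 0 ≤ ξ / η) (by positivity : 0 < α / 4)
  have h3 : 1 ≤ (ξ / η) ^ (α / 4) := Real.one_le_rpow h1 (by positivity)
  have e : (ξ / η) ^ (α / 4) = η ^ (-(α / 4)) * ξ ^ (α / 4) := by
    rw [Real.div_rpow hξ0.le hη.le, Real.rpow_neg hη.le]; field_simp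
  have h4 : |Real.log ξ| ≤ |Real.log η| + Real.log (ξ / η) := by
    rw [Real.log_div hξ0.ne' hη.ne']
    have := Real.log_le_log hη hξ
    have := abs_add_le (Real.log η) (Real.log ξ - Real.log η)
    rw [add_sub_cancel, abs_of_nonneg (by linarith : 0 ≤ Real.log ξ - Real.log η)] at this
    exact this
  rw [mul_assoc, ← e]
  have h5 : (ξ / η) ^ (α / 4) / (α / 4) = 4 / α * (ξ / η) ^ (α / 4) := by field_simp
  nlinarith [abs_nonneg (Real.log η)]

lemma AT_dom (hα : α ∈ Ioo (0 : ℝ) 2) (p e : ℝ) {η : ℝ} (hη : 0 < η) :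
    ∃ K : ℝ, 0 ≤ K ∧ ∀ v : ℝ, 0 ≤ v → v ≤ 1 → ∀ s : ℝ, 1 ≤ s → 1 ≤ s * η → ∀ ξ : ℝ, η ≤ ξ →
      |s ^ (1 + α) * AT α v p e s (s * ξ)| ≤ K * ξ ^ (-1 - 3 * α / 4) := by
  obtain ⟨C, hC, h⟩ := AT_asym hα p e
  obtain ⟨D, hD, hd⟩ := log_fac2 hα.1 hη
  have hc := cAlpha_pos hα
  have hα0 := hα.1
  refine ⟨C * (1 + 2 / α) * η ^ (-(3 * α / 4)) + cAlpha α * ((|PP α p e| + |e|) * D), by positivity, ?_⟩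
  intro v hv hv1 s hs hsη ξ hξ
  have hs0 : 0 < s := by linarith
  have hξ0 : 0 < ξ := by linarith
  have b := h v hv hv1 s hs ξ hξ0 (hsη.trans (by gcongr))
  have b2 := log_fac hα0 hs
  have b3 := hd ξ hξ
  have e1 : ξ ^ (-1 - 3 * α / 2) = ξ ^ (-1 - 3 * α / 4) * ξ ^ (-(3 * α / 4)) := by
    rw [← Real.rpow_add hξ0]; congr 1; ring
  have e2 : ξ ^ (-1 - α) * ξ ^ (α / 4) = ξ ^ (-1 - 3 * α / 4) := by
    rw [← Real.rpow_add hξ0]; congr 1; ring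
  have e3 : ξ ^ (-(3 * α / 4)) ≤ η ^ (-(3 * α / 4)) := Real.rpow_le_rpow_of_nonpos hη hξ (by linarith)
  set M := cAlpha α * ξ ^ (-1 - α) * (PP α p e - e * Real.log ξ) with hM
  have b4 : |M| ≤ cAlpha α * ((|PP α p e| + |e|) * D) * ξ ^ (-1 - 3 * α / 4) := by
    have q : |PP α p e - e * Real.log ξ| ≤ (|PP α p e| + |e|) * (D * ξ ^ (α / 4)) := by
      refine (abs_sub _ _).trans ?_
      rw [abs_mul]
      have := abs_nonneg (Real.log ξ)
      have a1 : |PP α p e| * 1 ≤ |PP α p e| * (D * ξ ^ (α / 4)) := by gcongr; linarith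
      have a2 : |e| * |Real.log ξ| ≤ |e| * (D * ξ ^ (α / 4)) := by gcongr; linarith
      linarith
    rw [hM, abs_mul, abs_of_pos (by positivity)]
    calc _ ≤ cAlpha α * ξ ^ (-1 - α) * ((|PP α p e| + |e|) * (D * ξ ^ (α / 4))) := by gcongr
      _ = cAlpha α * ((|PP α p e| + |e|) * D) * (ξ ^ (-1 - α) * ξ ^ (α / 4)) := by ring
      _ = _ := by rw [e2]
  have b5 : C * ((1 + Real.log s) * s ^ (-(α / 2))) * ξ ^ (-1 - 3 * α / 2)
      ≤ C * (1 + 2 / α) * η ^ (-(3 * α / 4)) * ξ ^ (-1 - 3 * α / 4) := by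
    rw [e1]
    calc _ ≤ C * (1 + 2 / α) * (ξ ^ (-1 - 3 * α / 4) * η ^ (-(3 * α / 4))) := by gcongr
      _ = _ := by ring
  have := abs_add_le (s ^ (1 + α) * AT α v p e s (s * ξ) - -M) (-M)
  rw [sub_add_cancel, abs_neg] at this
  linarith

lemma AT_small (hα : α ∈ Ioo (0 : ℝ) 2) (p e : ℝ) :
    ∃ K : ℝ, 0 ≤ K ∧ ∀ v : ℝ, 0 ≤ v → ∀ s : ℝ, 1 ≤ s → ∀ x : ℝ,
      |AT α v p e s x| ≤ K * (1 + Real.log s) := by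
  obtain ⟨C, hC, h0⟩ := T_bound hα le_rfl 0
  obtain ⟨D, hD, h1⟩ := T_bound hα le_rfl 1
  refine ⟨(|p| + |e|) * C + |e| * D, by positivity, fun v hv s hs x => ?_⟩
  have hls := Real.log_nonneg hs
  have w := om_le_one hα.1 x
  have b0 : |T α v α 0 x| ≤ C := (h0 v hv x).trans (by nlinarith)
  have b1 : |T α v α 1 x| ≤ D := (h1 v hv x).trans (by nlinarith)
  have hpe : |p + e * Real.log s| ≤ (|p| + |e|) * (1 + Real.log s) := by
    refine (abs_add_le _ _).trans ?_
    rw [abs_mul, abs_of_nonneg hls]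
    nlinarith [abs_nonneg p, abs_nonneg e, mul_nonneg (abs_nonneg p) hls]
  have he : |e| ≤ |e| * (1 + Real.log s) := by nlinarith [abs_nonneg e]
  unfold AT
  refine (abs_add_le _ _).trans ?_
  rw [abs_mul, abs_mul]
  calc _ ≤ (|p| + |e|) * (1 + Real.log s) * C + |e| * (1 + Real.log s) * D := by gcongr
    _ = _ := by ring

lemma logfac_lim (hα : 0 < α) : Tendsto (fun s : ℝ => (1 + Real.log s) * s ^ (-(α / 2))) atTop (𝓝 0) := by
  have h1 := (isLittleO_log_rpow_atTop (by positivity : 0 < α / 2)).tendsto_div_nhds_zero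
  have h2 := tendsto_rpow_neg_atTop (by positivity : 0 < α / 2)
  have := h2.add h1
  rw [add_zero] at this
  refine this.congr' ?_
  filter_upwards [eventually_gt_atTop 0] with s hs
  rw [Real.rpow_neg hs.le]; field_simp

lemma AT_lim (hα : α ∈ Ioo (0 : ℝ) 2) (p e : ℝ) {v s : ℕ → ℝ} (hs : Tendsto s atTop atTop)
    (hv : ∀ᶠ n in atTop, 0 ≤ v n ∧ v n ≤ 1) {ξ : ℝ} (hξ : 0 < ξ) :
    Tendsto (fun n => s n ^ (1 + α) * AT α (v n) p e (s n) (s n * ξ)) atTop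
      (𝓝 (-(cAlpha α * ξ ^ (-1 - α) * (PP α p e - e * Real.log ξ)))) := by
  obtain ⟨C, hC, h⟩ := AT_asym hα p e
  rw [tendsto_iff_norm_sub_tendsto_zero]
  have h1 := (((logfac_lim hα.1).comp hs).const_mul C).mul_const (ξ ^ (-1 - 3 * α / 2))
  rw [mul_zero, zero_mul] at h1
  refine squeeze_zero' (Eventually.of_forall fun n => norm_nonneg _) ?_ h1
  filter_upwards [hv, hs.eventually_ge_atTop 1, hs.eventually_ge_atTop (1 / ξ)] with n hn h2 h3
  rw [div_le_iff₀ hξ] at h3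
  exact h _ hn.1 hn.2 _ h2 ξ hξ h3

lemma f_lim (hα : α ∈ Ioo (0 : ℝ) 2) {v s : ℕ → ℝ} (hs : Tendsto s atTop atTop)
    (hv : ∀ᶠ n in atTop, 0 < v n ∧ v n ≤ 1) {ξ : ℝ} (hξ : 0 < ξ) :
    Tendsto (fun n => s n ^ (1 + α) * T α (v n) 0 0 (s n * ξ) / v n - s n ^ (1 + α) * gauss (s n * ξ) / v n) atTop
      (𝓝 (cAlpha α * ξ ^ (-1 - α))) := by
  obtain ⟨C, hC, h⟩ := asym_f hα
  rw [tendsto_iff_norm_sub_tendsto_zero]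
  have hh : 0 < α / 2 := by linarith [hα.1]
  have h1 := (((tendsto_rpow_neg_atTop hh).comp hs).const_mul C).mul_const (ξ ^ (-1 - 3 * α / 2))
  rw [mul_zero, zero_mul] at h1
  refine squeeze_zero' (Eventually.of_forall fun n => norm_nonneg _) ?_ h1
  filter_upwards [hv, hs.eventually_ge_atTop 1, hs.eventually_ge_atTop (1 / ξ)] with n hn h2 h3
  rw [div_le_iff₀ hξ] at h3
  have b := h _ hn.1.le hn.2 _ h3
  have hs0 : 0 < s n := by linarith
  have hv0 := hn.1
  have e1 : (s n * ξ) ^ (-1 - α) = s n ^ (-1 - α) * ξ ^ (-1 - α) := Real.mul_rpow hs0.le hξ.le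
  have e2 : (s n * ξ) ^ (-1 - 3 * α / 2) = s n ^ (-1 - 3 * α / 2) * ξ ^ (-1 - 3 * α / 2) := Real.mul_rpow hs0.le hξ.le
  have e3 : s n ^ (1 + α) * s n ^ (-1 - α) = 1 := by
    rw [← Real.rpow_add hs0]; norm_num
  have e4 : s n ^ (1 + α) * s n ^ (-1 - 3 * α / 2) = s n ^ (-(α / 2)) := by
    rw [← Real.rpow_add hs0]; congr 1; ring
  rw [e1, e2] at b
  have hS : 0 < s n ^ (1 + α) := by positivity
  have aux2 : ∀ X V c Y Z : ℝ, V ≠ 0 → X / V * (c * V * (Y * Z)) = c * (X * Y) * Z := by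
    intros; field_simp
  have key : s n ^ (1 + α) * T α (v n) 0 0 (s n * ξ) / v n - s n ^ (1 + α) * gauss (s n * ξ) / v n - cAlpha α * ξ ^ (-1 - α)
     = s n ^ (1 + α) / v n * (T α (v n) 0 0 (s n * ξ) - gauss (s n * ξ) - v n * cAlpha α * (s n ^ (-1 - α) * ξ ^ (-1 - α))) := by
    have aux : ∀ X V c Y Z : ℝ, V ≠ 0 → X / V * (V * c * (Y * Z)) = (X * Y) * (c * Z) := by
      intros; field_simp
    have e5 : s n ^ (1 + α) / v n * (v n * cAlpha α * (s n ^ (-1 - α) * ξ ^ (-1 - α)))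
      = (s n ^ (1 + α) * s n ^ (-1 - α)) * (cAlpha α * ξ ^ (-1 - α)) := aux _ _ _ _ _ hv0.ne'
    rw [mul_sub, e5, e3]; ring
  rw [Real.norm_eq_abs, key, abs_mul, abs_of_pos (by positivity)]
  calc _ ≤ s n ^ (1 + α) / v n * _ := by gcongr
    _ = C * (s n ^ (1 + α) * s n ^ (-1 - 3 * α / 2)) * ξ ^ (-1 - 3 * α / 2) := aux2 _ _ _ _ _ hv0.ne'
    _ = _ := by rw [e4]; rfl
end

end


section

def sn (n : ℕ) : ℝ := √(Real.log n)

lemma sn_ge_one {n : ℕ} (hn : 3 ≤ n) : 1 ≤ sn n := by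
  unfold sn
  rw [Real.one_le_sqrt]
  exact log_ge_one hn

lemma sn_tendsto : Tendsto sn atTop atTop :=
  Real.tendsto_sqrt_atTop.comp (Real.tendsto_log_atTop.comp tendsto_natCast_atTop_atTop)

lemma sn_rpow {n : ℕ} (r : ℝ) : sn n ^ r = Real.log n ^ (r / 2) := by
  unfold sn
  rw [Real.sqrt_eq_rpow, ← Real.rpow_mul (Real.log_natCast_nonneg n)]
  congr 1; ring

lemma gauss_sn {n : ℕ} (hn : 3 ≤ n) (ξ : ℝ) :
    gauss (sn n * ξ) = (√(2 * Real.pi))⁻¹ * (n : ℝ) ^ (-(ξ ^ 2 / 2)) := by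
  have hl := log_ge_one hn
  have hn0 : (0 : ℝ) < n := by positivity
  unfold gauss sn
  rw [mul_pow, Real.sq_sqrt (by linarith), Real.rpow_def_of_pos hn0]
  congr 2; ring

section
variable {σ δ α : ℝ}

lemma Q_eq (hσ : 0 < σ) (hδ : 0 < δ) {n : ℕ} (hn : 3 ≤ n) (ξ : ℝ) :
    sn n ^ (1 + α) * gauss (sn n * ξ) / vn n σ δ α
      = ((√(2 * Real.pi))⁻¹ / (δ / σ) ^ α) * (sn n ^ (1 + α) * (n : ℝ) ^ (-(ξ ^ 2 / 2 - 1 + α / 2))) := by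
  have hn0 : (0 : ℝ) < n := by positivity
  rw [gauss_sn hn]
  unfold vn
  have e : (n : ℝ) ^ (-(ξ ^ 2 / 2)) = (n : ℝ) ^ (-(ξ ^ 2 / 2 - 1 + α / 2)) * (n : ℝ) ^ (α / 2 - 1) := by
    rw [← Real.rpow_add hn0]; congr 1; ring
  rw [e]
  have h1 : (n : ℝ) ^ (α / 2 - 1) ≠ 0 := by positivity
  have h2 : (δ / σ) ^ α ≠ 0 := by positivity
  generalize (n : ℝ) ^ (α / 2 - 1) = a at *
  generalize (δ / σ) ^ α = b at *
  generalize (n : ℝ) ^ (-(ξ ^ 2 / 2 - 1 + α / 2)) = c at *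
  generalize sn n ^ (1 + α) = d at *
  field_simp

lemma Q_hi (hσ : 0 < σ) (hδ : 0 < δ) {ξ : ℝ} (hξ : 2 - α < ξ ^ 2) :
    Tendsto (fun n : ℕ => sn n ^ (1 + α) * gauss (sn n * ξ) / vn n σ δ α) atTop (𝓝 0) := by
  have h := (loglim ((1 + α) / 2) (b := ξ ^ 2 / 2 - 1 + α / 2) (by linarith)).const_mul
    ((√(2 * Real.pi))⁻¹ / (δ / σ) ^ α)
  rw [mul_zero] at h
  refine h.congr' ?_
  filter_upwards [eventually_ge_atTop 3] with n hn
  rw [Q_eq hσ hδ hn, sn_rpow]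

lemma Q_lo (hσ : 0 < σ) (hδ : 0 < δ) (hα : α ∈ Ioo (0 : ℝ) 2) {ξ : ℝ} (hξ : ξ ^ 2 < 2 - α) :
    Tendsto (fun n : ℕ => sn n ^ (1 + α) * gauss (sn n * ξ) / vn n σ δ α) atTop atTop := by
  have h1 := (tendsto_rpow_atTop (by linarith : 0 < -(ξ ^ 2 / 2 - 1 + α / 2))).comp (tendsto_natCast_atTop_atTop (R := ℝ))
  have h := h1.const_mul_atTop (by positivity : 0 < (√(2 * Real.pi))⁻¹ / (δ / σ) ^ α)
  refine tendsto_atTop_mono' _ ?_ h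
  filter_upwards [eventually_ge_atTop 3] with n hn
  rw [Q_eq hσ hδ hn]
  have := Real.one_le_rpow (sn_ge_one hn) (by linarith [hα.1] : 0 ≤ 1 + α)
  simp only [Function.comp_apply]
  gcongr
  exact le_mul_of_one_le_left (by positivity) this

lemma small_lim (hσ : 0 < σ) (hδ : 0 < δ) {η : ℝ} (hη : η ^ 2 < 2 - α) :
    Tendsto (fun n : ℕ => sn n ^ (1 + α) * sn n ^ 2 * (vn n σ δ α / gauss (sn n * η))) atTop (𝓝 0) := by
  have h := (loglim ((3 + α) / 2) (b := 1 - α / 2 - η ^ 2 / 2) (by linarith)).const_mul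
    ((δ / σ) ^ α / (√(2 * Real.pi))⁻¹)
  rw [mul_zero] at h
  refine h.congr' ?_
  filter_upwards [eventually_ge_atTop 3] with n hn
  have hn0 : (0 : ℝ) < n := by positivity
  have hs := sn_ge_one hn
  rw [gauss_sn hn, ← sn_rpow]
  unfold vn
  have e : (n : ℝ) ^ (α / 2 - 1) = (n : ℝ) ^ (-(1 - α / 2 - η ^ 2 / 2)) * (n : ℝ) ^ (-(η ^ 2 / 2)) := by
    rw [← Real.rpow_add hn0]; congr 1; ring
  have e2 : sn n ^ (3 + α) = sn n ^ (1 + α) * sn n ^ 2 := by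
    rw [← Real.rpow_natCast, ← Real.rpow_add (by linarith)]
    congr 1; push_cast; ring
  rw [e, e2]
  have h1 : (n : ℝ) ^ (-(η ^ 2 / 2)) ≠ 0 := by positivity
  have h2 : √(2 * Real.pi) ≠ 0 := by positivity
  generalize (n : ℝ) ^ (-(η ^ 2 / 2)) = a at *
  generalize (δ / σ) ^ α = b at *
  generalize (n : ℝ) ^ (-(1 - α / 2 - η ^ 2 / 2)) = c at *
  generalize sn n ^ (1 + α) = d at *
  generalize √(2 * Real.pi) = f at *
  field_simp

def gg (n : ℕ) (σ δ α p e p' e' ξ : ℝ) : ℝ :=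
  sn n ^ (1 + α) * (vn n σ δ α * (AT α (vn n σ δ α) p e (sn n) (sn n * ξ) * AT α (vn n σ δ α) p' e' (sn n) (sn n * ξ))
    / T α (vn n σ δ α) 0 0 (sn n * ξ))

def glim (α p e p' e' ξ : ℝ) : ℝ :=
  cAlpha α * ξ ^ (-1 - α) * (PP α p e - e * Real.log ξ) * (PP α p' e' - e' * Real.log ξ)

lemma gg_eq {n : ℕ} {p e p' e' ξ : ℝ} (hS : sn n ^ (1 + α) ≠ 0) (hv : vn n σ δ α ≠ 0) :
    gg n σ δ α p e p' e' ξ = (sn n ^ (1 + α) * AT α (vn n σ δ α) p e (sn n) (sn n * ξ)) *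
      (sn n ^ (1 + α) * AT α (vn n σ δ α) p' e' (sn n) (sn n * ξ)) /
      (sn n ^ (1 + α) * T α (vn n σ δ α) 0 0 (sn n * ξ) / vn n σ δ α) := by
  unfold gg
  generalize T α (vn n σ δ α) 0 0 (sn n * ξ) = f
  generalize AT α (vn n σ δ α) p e (sn n) (sn n * ξ) = A
  generalize AT α (vn n σ δ α) p' e' (sn n) (sn n * ξ) = B
  generalize sn n ^ (1 + α) = S at *
  generalize vn n σ δ α = v at *
  by_cases hf : f = 0
  · simp [hf]
  field_simp

lemma gg_ptw (hσ : 0 < σ) (hδ : 0 < δ) (hα : α ∈ Ioo (0 : ℝ) 2) (p e p' e' : ℝ) {ξ : ℝ} (hξ : 0 < ξ)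
    (hne : ξ ≠ √(2 - α)) :
    Tendsto (fun n : ℕ => gg n σ δ α p e p' e' ξ) atTop
      (𝓝 ((Ioi √(2 - α)).indicator (glim α p e p' e') ξ)) := by
  have hv : ∀ᶠ n : ℕ in atTop, 0 < vn n σ δ α ∧ vn n σ δ α ≤ 1 := by
    filter_upwards [ev_v (σ := σ) (δ := δ) hα one_pos] with n hn
    exact ⟨vn_pos (α := α) hσ hδ (by omega : 0 < n), hn.2⟩
  have a1 := AT_lim hα p e sn_tendsto (hv.mono fun n h => ⟨h.1.le, h.2⟩) hξ
  have a2 := AT_lim hα p' e' sn_tendsto (hv.mono fun n h => ⟨h.1.le, h.2⟩) hξ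
  have a3 := f_lim hα sn_tendsto hv hξ
  have a4 := a1.mul a2
  have hc := cAlpha_pos hα
  have hR : 0 < ξ ^ (-1 - α) := by positivity
  have ev : ∀ᶠ n : ℕ in atTop, (sn n ^ (1 + α) * AT α (vn n σ δ α) p e (sn n) (sn n * ξ)) *
      (sn n ^ (1 + α) * AT α (vn n σ δ α) p' e' (sn n) (sn n * ξ)) /
      (sn n ^ (1 + α) * T α (vn n σ δ α) 0 0 (sn n * ξ) / vn n σ δ α) = gg n σ δ α p e p' e' ξ := by
    filter_upwards [hv, eventually_ge_atTop 3] with n h1 h2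
    have := sn_ge_one h2
    exact (gg_eq (by positivity) h1.1.ne').symm
  rcases lt_or_gt_of_ne hne with hlt | hgt
  · rw [indicator_of_notMem (by simp [hlt.le])]
    have hq : ξ ^ 2 < 2 - α := by rwa [Real.lt_sqrt hξ.le] at hlt
    have a5 := a3.add_atTop (Q_lo hσ hδ hα hq)
    simp only [sub_add_cancel] at a5
    exact (a4.div_atTop a5).congr' ev
  · rw [indicator_of_mem (by exact hgt)]
    have hq : 2 - α < ξ ^ 2 := by rwa [Real.sqrt_lt' hξ] at hgt
    have a5 := a3.add (Q_hi hσ hδ hq)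
    simp only [sub_add_cancel, add_zero] at a5
    have := (a4.div a5 (by positivity)).congr' ev
    convert this using 2
    unfold glim
    field_simp

lemma gg_dom (hσ : 0 < σ) (hδ : 0 < δ) (hα : α ∈ Ioo (0 : ℝ) 2) (p e p' e' : ℝ) {η : ℝ} (hη : 0 < η)
    (hη2 : η ^ 2 < 2 - α) :
    ∃ K : ℝ, ∀ᶠ n : ℕ in atTop, ∀ ξ : ℝ, 0 < ξ → (ξ ≤ η → |gg n σ δ α p e p' e' ξ| ≤ 1) ∧
      (η < ξ → |gg n σ δ α p e p' e' ξ| ≤ K * ξ ^ (-1 - α / 2)) := by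
  obtain ⟨c, hc, v₀, hv0, hv1, hl⟩ := f_lower hα
  obtain ⟨K1, hK1, k1⟩ := AT_dom hα p e hη
  obtain ⟨K2, hK2, k2⟩ := AT_dom hα p' e' hη
  obtain ⟨M1, hM1, m1⟩ := AT_small hα p e
  obtain ⟨M2, hM2, m2⟩ := AT_small hα p' e'
  have hsm := (small_lim (α := α) hσ hδ hη2).const_mul (M1 * M2 / c)
  rw [mul_zero] at hsm
  refine ⟨K1 * K2 / (c * 2 ^ (-1 - α)), ?_⟩
  filter_upwards [ev_v (σ := σ) (δ := δ) hα hv0, sn_tendsto.eventually_ge_atTop (1 / η),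
    hsm.eventually (gt_mem_nhds one_pos)] with n hn hsη hsm ξ hξ
  have hvp := vn_pos (α := α) hσ hδ (by omega : 0 < n)
  have hvle := hn.2
  have hs := sn_ge_one hn.1
  rw [div_le_iff₀ hη] at hsη
  set v := vn n σ δ α with hvdef
  set s := sn n with hsdef
  have hs0 : 0 < s := by linarith
  have hS : 0 < s ^ (1 + α) := by positivity
  have l0 := hl v hvp.le hvle (s * ξ)
  have hgp := gauss_pos (s * ξ)
  have hr := rho_pos α (s * ξ)
  have l1 : c * gauss (s * ξ) ≤ T α v 0 0 (s * ξ) := le_trans (by gcongr; linarith [mul_pos hvp hr]) l0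
  have l2 : c * (v * rho α (s * ξ)) ≤ T α v 0 0 (s * ξ) := le_trans (by gcongr; linarith) l0
  have hf : 0 < T α v 0 0 (s * ξ) := lt_of_lt_of_le (by positivity) l1
  constructor
  · intro hle
    have g1 : gauss (s * η) ≤ gauss (s * ξ) := gauss_anti (by
      rw [abs_of_pos (by positivity), abs_of_pos (by positivity)]; gcongr)
    have hgη := gauss_pos (s * η)
    have l3 : c * gauss (s * η) ≤ T α v 0 0 (s * ξ) := le_trans (by gcongr) l1
    have lg : 1 + Real.log s ≤ s := by linarith [Real.log_le_sub_one_of_pos hs0]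
    have lg0 := Real.log_nonneg hs
    unfold gg
    rw [← hvdef, ← hsdef, abs_mul, abs_of_pos hS, abs_div, abs_of_pos hf, abs_mul, abs_of_pos hvp, abs_mul]
    calc _ ≤ s ^ (1 + α) * (v * ((M1 * (1 + Real.log s)) * (M2 * (1 + Real.log s))) / (c * gauss (s * η))) := by
          gcongr
          · exact m1 v hvp.le s hs _
          · exact m2 v hvp.le s hs _
      _ ≤ s ^ (1 + α) * (v * ((M1 * s) * (M2 * s)) / (c * gauss (s * η))) := by gcongr
      _ = M1 * M2 / c * (s ^ (1 + α) * s ^ 2 * (v / gauss (s * η))) := by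
          generalize s ^ (1 + α) = S
          field_simp
      _ ≤ 1 := hsm.le
  · intro hlt
    rw [gg_eq hS.ne' hvp.ne', ← hvdef, ← hsdef, abs_div, abs_mul]
    have d1 : c * (2 ^ (-1 - α) * ξ ^ (-1 - α)) ≤ s ^ (1 + α) * T α v 0 0 (s * ξ) / v := by
      rw [le_div_iff₀ hvp]
      have hx : 1 ≤ s * ξ := hsη.trans (by gcongr)
      have e1 : rho α (s * ξ) ≥ (2 * (s * ξ)) ^ (-1 - α) := by
        unfold rho
        rw [abs_of_pos (by positivity)]
        exact Real.rpow_le_rpow_of_nonpos (by positivity) (by linarith) (by linarith [hα.1])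
      rw [Real.mul_rpow (by norm_num) (by positivity), Real.mul_rpow hs0.le hξ.le] at e1
      have e3 : s ^ (1 + α) * s ^ (-1 - α) = 1 := by
        rw [← Real.rpow_add hs0]; norm_num
      calc c * (2 ^ (-1 - α) * ξ ^ (-1 - α)) * v
          = s ^ (1 + α) * s ^ (-1 - α) * (c * (2 ^ (-1 - α) * ξ ^ (-1 - α)) * v) := by rw [e3, one_mul]
        _ = s ^ (1 + α) * (c * (v * (2 ^ (-1 - α) * (s ^ (-1 - α) * ξ ^ (-1 - α))))) := by ring
        _ ≤ s ^ (1 + α) * (c * (v * rho α (s * ξ))) := by gcongr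
        _ ≤ _ := by gcongr
    have e2 : ξ ^ (-1 - 3 * α / 4) * ξ ^ (-1 - 3 * α / 4) = ξ ^ (-1 - α / 2) * ξ ^ (-1 - α) := by
      rw [← Real.rpow_add hξ, ← Real.rpow_add hξ]; congr 1; ring
    rw [abs_of_pos (by positivity : 0 < s ^ (1 + α) * T α v 0 0 (s * ξ) / v)]
    calc _ ≤ (K1 * ξ ^ (-1 - 3 * α / 4)) * (K2 * ξ ^ (-1 - 3 * α / 4)) / (c * (2 ^ (-1 - α) * ξ ^ (-1 - α))) := by
          gcongr
          · exact k1 v hvp.le (hvle.trans hv1) s hs hsη ξ hlt.le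
          · exact k2 v hvp.le (hvle.trans hv1) s hs hsη ξ hlt.le
      _ = K1 * K2 * (ξ ^ (-1 - 3 * α / 4) * ξ ^ (-1 - 3 * α / 4)) / (c * (2 ^ (-1 - α) * ξ ^ (-1 - α))) := by ring
      _ = _ := by
          rw [e2]
          have h1 : ξ ^ (-1 - α) ≠ 0 := by positivity
          have h2 : (2 : ℝ) ^ (-1 - α) ≠ 0 := by positivity
          generalize ξ ^ (-1 - α) = a at *
          generalize (2 : ℝ) ^ (-1 - α) = b at *
          generalize ξ ^ (-1 - α / 2) = d at *
          field_simp

lemma gg_int (hσ : 0 < σ) (hδ : 0 < δ) (hα : α ∈ Ioo (0 : ℝ) 2) (p e p' e' : ℝ) :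
    Tendsto (fun n : ℕ => ∫ ξ in Ioi (0 : ℝ), gg n σ δ α p e p' e' ξ) atTop
      (𝓝 (∫ ξ in Ioi (0 : ℝ), (Ioi √(2 - α)).indicator (glim α p e p' e') ξ)) := by
  have h2 : 0 < 2 - α := by linarith [hα.2]
  have hα0 := hα.1
  set η := √(2 - α) / 2 with hη
  have hη0 : 0 < η := by positivity
  have hη2 : η ^ 2 < 2 - α := by
    rw [hη, div_pow, Real.sq_sqrt h2.le]; linarith
  obtain ⟨K, hK⟩ := gg_dom hσ hδ hα p e p' e' hη0 hη2
  refine tendsto_integral_filter_of_dominated_convergence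
    (fun ξ => (Ioc 0 η).indicator (fun _ => (1 : ℝ)) ξ + (Ioi η).indicator (fun ξ => K * ξ ^ (-1 - α / 2)) ξ) ?_ ?_ ?_ ?_
  · filter_upwards [eventually_ge_atTop 3] with n hn
    have hvp := vn_pos (α := α) hσ hδ (by omega : 0 < n)
    have c0 := T_continuous hα le_rfl 0 hvp.le
    have c1 := T_continuous hα hα0.le 0 hvp.le
    have c2 := T_continuous hα hα0.le 1 hvp.le
    have : Measurable (gg n σ δ α p e p' e') := by
      unfold gg AT
      fun_prop
    exact this.aestronglyMeasurable
  · filter_upwards [hK] with n hn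
    refine (ae_restrict_iff' measurableSet_Ioi).2 (ae_of_all _ fun ξ hξ => ?_)
    have hξ : 0 < ξ := hξ
    rw [Real.norm_eq_abs]
    rcases le_or_gt ξ η with h | h
    · rw [indicator_of_mem (show ξ ∈ Ioc 0 η from ⟨hξ, h⟩), indicator_of_notMem (by simpa using h), add_zero]
      exact (hn ξ hξ).1 h
    · rw [indicator_of_notMem (by simp [h]), indicator_of_mem (by exact h), zero_add]
      exact (hn ξ hξ).2 h
  · refine Integrable.integrableOn (Integrable.add ?_ ?_)
    · exact (integrable_indicator_iff measurableSet_Ioc).2 (by simp)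
    · refine (integrable_indicator_iff measurableSet_Ioi).2 ?_
      exact (integrableOn_Ioi_rpow_of_lt (by linarith) hη0).const_mul K
  · have hne : ∀ᵐ ξ : ℝ ∂volume, ξ ≠ √(2 - α) := by
      simp [ae_iff, measure_singleton]
    refine (ae_restrict_iff' measurableSet_Ioi).2 ?_
    filter_upwards [hne] with ξ h hξ
    exact gg_ptw hσ hδ hα p e p' e' hξ h
end

end


section

lemma log2_rpow_lim {α : ℝ} (hα : 0 < α) (k : ℕ) :
    Tendsto (fun x : ℝ => x ^ (-α) * Real.log x ^ k) atTop (𝓝 0) := by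
  have h := (isLittleO_log_rpow_rpow_atTop (k : ℝ) hα).tendsto_div_nhds_zero
  refine h.congr' ?_
  filter_upwards [eventually_gt_atTop 0] with x hx
  rw [Real.rpow_neg hx.le, Real.rpow_natCast, div_eq_mul_inv, mul_comm]

section
variable {σ δ α : ℝ}

lemma glim_int (hα : α ∈ Ioo (0 : ℝ) 2) (p e p' e' : ℝ) {a : ℝ} (ha : 0 < a) :
    ∫ ξ in Ioi a, glim α p e p' e' ξ = cAlpha α * (a ^ (-α) * (PP α p e * PP α p' e' / α
      - (PP α p e * e' + e * PP α p' e') * (Real.log a / α + 1 / α ^ 2)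
      + e * e' * (Real.log a ^ 2 / α + 2 * Real.log a / α ^ 2 + 2 / α ^ 3))) := by
  have hα0 := hα.1
  have hc := cAlpha_pos hα
  set P := PP α p e with hP
  set P' := PP α p' e' with hP'
  obtain ⟨K, hK, hk⟩ := log_fac2 hα0 ha
  set F : ℝ → ℝ := fun x => -(cAlpha α * (x ^ (-α) * (P * P' / α
      - (P * e' + e * P') * (Real.log x / α + 1 / α ^ 2)
      + e * e' * (Real.log x ^ 2 / α + 2 * Real.log x / α ^ 2 + 2 / α ^ 3)))) with hF
  have hd : ∀ x, 0 < x → HasDerivAt F (glim α p e p' e' x) x := by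
    intro x hx
    have d1 := Real.hasDerivAt_rpow_const (p := -α) (Or.inl hx.ne')
    have d2 := Real.hasDerivAt_log hx.ne'
    have d3 := ((((d2.div_const α).add_const (1 / α ^ 2)).const_mul (P * e' + e * P')).const_sub (P * P' / α)).add
      ((((((d2.pow 2).div_const α).add ((d2.const_mul 2).div_const (α ^ 2))).add_const (2 / α ^ 3))).const_mul (e * e'))
    have d4 := ((d1.mul d3).const_mul (cAlpha α)).neg
    refine (d4.congr_deriv ?_).congr_of_eventuallyEq (Eventually.of_forall fun y => ?_)
    · have e1 : x ^ (-α - 1) = x ^ (-1 - α) := by congr 1; ring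
      have e2 : x ^ (-α) = x * x ^ (-1 - α) := by
        nth_rewrite 2 [← Real.rpow_one x]
        rw [← Real.rpow_add hx]; congr 1; ring
      unfold glim
      simp only [Pi.add_apply, Pi.pow_apply, e1, e2]
      rw [← hP, ← hP']
      generalize x ^ (-1 - α) = r
      generalize Real.log x = l
      field_simp
      ring
    · simp only [hF, Pi.neg_apply, Pi.mul_apply, Pi.add_apply, Pi.pow_apply]
  have hlim : Tendsto F atTop (𝓝 0) := by
    have l0 := log2_rpow_lim hα0 0
    have l1 := log2_rpow_lim hα0 1
    have l2 := log2_rpow_lim hα0 2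
    have := ((l0.const_mul (P * P' / α - (P * e' + e * P') / α ^ 2 + 2 * (e * e') / α ^ 3)).add
      (l1.const_mul (-(P * e' + e * P') / α + 2 * (e * e') / α ^ 2))).add (l2.const_mul (e * e' / α))
    have := this.const_mul (-cAlpha α)
    simp only [mul_zero, add_zero] at this
    refine this.congr fun x => ?_
    simp only [hF]
    ring
  have hint : IntegrableOn (glim α p e p' e') (Ioi a) := by
    have hI : IntegrableOn (fun x : ℝ => cAlpha α * ((|P| + |e|) * K) * ((|P'| + |e'|) * K) * x ^ (-1 - α / 2)) (Ioi a) :=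
      (integrableOn_Ioi_rpow_of_lt (by linarith) ha).const_mul _
    refine hI.mono' (by unfold glim; fun_prop) ?_
    refine (ae_restrict_iff' measurableSet_Ioi).2 (ae_of_all _ fun x hx => ?_)
    have hxa : a ≤ x := le_of_lt hx
    have hx0 : 0 < x := by linarith
    have hb := hk x hxa
    have q : ∀ p e : ℝ, |p - e * Real.log x| ≤ (|p| + |e|) * (K * x ^ (α / 4)) := by
      intro p e
      refine (abs_sub _ _).trans ?_
      rw [abs_mul]
      have := abs_nonneg (Real.log x)
      have a1 : |p| * 1 ≤ |p| * (K * x ^ (α / 4)) := by gcongr; linarith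
      have a2 : |e| * |Real.log x| ≤ |e| * (K * x ^ (α / 4)) := by gcongr; linarith
      linarith
    have e3 : x ^ (-1 - α) * (x ^ (α / 4) * x ^ (α / 4)) = x ^ (-1 - α / 2) := by
      rw [← Real.rpow_add hx0, ← Real.rpow_add hx0]; congr 1; ring
    unfold glim
    rw [Real.norm_eq_abs, abs_mul, abs_mul, abs_of_pos (by positivity), ← hP, ← hP']
    calc _ ≤ cAlpha α * x ^ (-1 - α) * ((|P| + |e|) * (K * x ^ (α / 4))) * ((|P'| + |e'|) * (K * x ^ (α / 4))) := by
          gcongr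
          · exact q P e
          · exact q P' e'
      _ = cAlpha α * ((|P| + |e|) * K) * ((|P'| + |e'|) * K) * (x ^ (-1 - α) * (x ^ (α / 4) * x ^ (α / 4))) := by ring
      _ = _ := by rw [e3]
  have := integral_Ioi_of_hasDerivAt_of_tendsto (hd a ha).continuousAt.continuousWithinAt
    (fun x hx => hd x (ha.trans hx)) hint hlim
  rw [this]
  simp only [hF]
  ring

def pj (σ δ α : ℝ) : Fin 3 → ℝ := ![0, α / δ, Real.log (δ / σ)]
def ej : Fin 3 → ℝ := ![0, 0, 1]

lemma Zt_AT (hσ : 0 < σ) (hδ : 0 < δ) (hα : α ∈ Ioo (0 : ℝ) 2) {n : ℕ} (hn : 3 ≤ n) {j : Fin 3} (hj : j ≠ 0) (x : ℝ) :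
    Zt n σ δ α j x = -(rate n α * vn n σ δ α) * AT α (vn n σ δ α) (pj σ δ α j) (ej j) (sn n) x := by
  have hn1 : 1 ≤ n := by omega
  have hα0 := hα.1
  have hl := log_ge_one hn
  fin_cases j
  · exact absurd rfl hj
  · simp only [Fin.mk_one]
    rw [Zt1, PF1_at1 hσ hδ hα hn1 x]
    simp [AT, pj, ej]
    ring
  · simp only [Fin.reduceFinMk]
    rw [Zt2, PF1_at1 hσ hδ hα hn1 x, PF1_at2 hσ hδ hα hn1 x]
    simp only [AT, pj, ej, sn, uoff, lam]
    rw [Real.log_sqrt (by linarith)]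
    simp only [Matrix.cons_val]
    rw [Real.log_div hδ.ne' hσ.ne']
    field_simp
    ring

lemma AT_abs (v p e s x : ℝ) : AT α v p e s |x| = AT α v p e s x := by
  simp only [AT, T, FT_abs]

lemma scale_eq (hσ : 0 < σ) (hδ : 0 < δ) {n : ℕ} (hn : 3 ≤ n) :
    (n : ℝ) * rate n α ^ 2 * vn n σ δ α = sn n ^ α * (δ / σ) ^ α := by
  have hn0 : (0 : ℝ) < n := by positivity
  rw [rate_pow hn, sn_rpow]
  unfold vn
  have e : (n : ℝ) * (n : ℝ) ^ (-(α / 4 * ((2 : ℕ) : ℝ))) * (n : ℝ) ^ (α / 2 - 1) = 1 := by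
    nth_rewrite 1 [← Real.rpow_one (n : ℝ)]
    rw [← Real.rpow_add hn0, ← Real.rpow_add hn0]
    rw [show 1 + -(α / 4 * ((2 : ℕ) : ℝ)) + (α / 2 - 1) = 0 by push_cast; ring, Real.rpow_zero]
  have e2 : Real.log n ^ (α / 4 * ((2 : ℕ) : ℝ)) = Real.log n ^ (α / 2) := by
    congr 1; push_cast; ring
  rw [e2]
  linear_combination (Real.log n ^ (α / 2) * (δ / σ) ^ α) * e

lemma Zt_gg (hσ : 0 < σ) (hδ : 0 < δ) (hα : α ∈ Ioo (0 : ℝ) 2) {n : ℕ} (hn : 3 ≤ n) {i j : Fin 3} (hi : i ≠ 0) (hj : j ≠ 0) :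
    (n : ℝ) * ∫ x, Zt n σ δ α i x * Zt n σ δ α j x / T α (vn n σ δ α) 0 0 x
      = 2 * (δ / σ) ^ α * ∫ ξ in Ioi (0 : ℝ), gg n σ δ α (pj σ δ α i) (ej i) (pj σ δ α j) (ej j) ξ := by
  set v := vn n σ δ α with hv
  have hs := sn_ge_one hn
  have hs0 : 0 < sn n := by linarith
  set H : ℝ → ℝ := fun x => AT α v (pj σ δ α i) (ej i) (sn n) x * AT α v (pj σ δ α j) (ej j) (sn n) x / T α v 0 0 x with hH
  have e1 : ∀ x, Zt n σ δ α i x * Zt n σ δ α j x / T α v 0 0 x = (rate n α * v) ^ 2 * H |x| := by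
    intro x
    rw [Zt_AT hσ hδ hα hn hi, Zt_AT hσ hδ hα hn hj]
    simp only [hH, AT_abs]
    rw [show T α v 0 0 |x| = T α v 0 0 x by simp only [T, FT_abs]]
    ring
  have e2 : ∀ ξ, gg n σ δ α (pj σ δ α i) (ej i) (pj σ δ α j) (ej j) ξ = sn n ^ (1 + α) * v * H (sn n * ξ) := by
    intro ξ
    simp only [gg, hH]
    ring
  simp_rw [e1, e2]
  rw [integral_const_mul, integral_const_mul, integral_comp_abs, integral_comp_mul_left_Ioi _ _ hs0, mul_zero, smul_eq_mul]
  have e3 := scale_eq (α := α) hσ hδ hn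
  have e4 : sn n ^ (1 + α) = sn n * sn n ^ α := by rw [Real.rpow_add hs0, Real.rpow_one]
  rw [e4]
  rw [← hv] at e3
  generalize (∫ x in Ioi (0 : ℝ), H x) = I
  have e5 : 2 * (δ / σ) ^ α * (sn n * sn n ^ α * v * ((sn n)⁻¹ * I)) = 2 * v * I * (sn n ^ α * (δ / σ) ^ α) := by
    field_simp
  rw [e5, ← e3]
  ring

lemma Cij (hσ : 0 < σ) (hδ : 0 < δ) (hα : α ∈ Ioo (0 : ℝ) 2) {i j : Fin 3} (hi : i ≠ 0) (hj : j ≠ 0) :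
    Tendsto (fun n : ℕ => (n : ℝ) * ∫ x, Zt n σ δ α i x * Zt n σ δ α j x / T α (vn n σ δ α) 0 0 x) atTop
      (𝓝 (Imat ![σ, δ, α] i j)) := by
  have h := (gg_int hσ hδ hα (pj σ δ α i) (ej i) (pj σ δ α j) (ej j)).const_mul (2 * (δ / σ) ^ α)
  have h2 : 0 < 2 - α := by linarith [hα.2]
  have hα0 := hα.1
  have hc := cAlpha_pos hα
  have hsq : 0 < √(2 - α) := Real.sqrt_pos.2 h2
  rw [setIntegral_indicator measurableSet_Ioi, Ioi_inter_Ioi, sup_eq_right.2 hsq.le, glim_int hα _ _ _ _ hsq,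
    Real.log_sqrt h2.le] at h
  have e1 : √(2 - α) ^ (-α) = ((2 - α) ^ (α / 2))⁻¹ := by
    rw [Real.sqrt_eq_rpow, ← Real.rpow_mul h2.le, ← Real.rpow_neg h2.le]; congr 1; ring
  rw [e1] at h
  have h3 : (2 - α) ^ (α / 2) ≠ 0 := by positivity
  have lim : Imat ![σ, δ, α] i j = 2 * (δ / σ) ^ α * (cAlpha α * (((2 - α) ^ (α / 2))⁻¹ *
      (PP α (pj σ δ α i) (ej i) * PP α (pj σ δ α j) (ej j) / α
      - (PP α (pj σ δ α i) (ej i) * ej j + ej i * PP α (pj σ δ α j) (ej j)) * (Real.log (2 - α) / 2 / α + 1 / α ^ 2)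
      + ej i * ej j * ((Real.log (2 - α) / 2) ^ 2 / α + 2 * (Real.log (2 - α) / 2) / α ^ 2 + 2 / α ^ 3)))) := by
    fin_cases i <;> fin_cases j <;> first | exact absurd rfl hi | exact absurd rfl hj | skip
    all_goals
      simp [Imat, PP, pj, ej, kappa0, kappa1]
      generalize (2 - α) ^ (α / 2) = a at *
      generalize (δ / σ) ^ α = b at *
      generalize Real.log (δ / σ) = l at *
      generalize Real.log (2 - α) = l' at *
      field_simp
      try ring
  rw [lim]
  refine h.congr' ?_
  filter_upwards [eventually_ge_atTop 3] with n hn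
  rw [Zt_gg hσ hδ hα hn hi hj]
end

lemma all_C {σ δ α : ℝ} (hσ : 0 < σ) (hδ : 0 < δ) (hα : α ∈ Ioo (0 : ℝ) 2) (i j : Fin 3) :
    Tendsto (fun n : ℕ => (n : ℝ) * ∫ x, Zt n σ δ α i x * Zt n σ δ α j x / T α (vn n σ δ α) 0 0 x) atTop
      (𝓝 (Imat ![σ, δ, α] i j)) := by
  by_cases hi : i = 0
  · by_cases hj : j = 0
    · rw [hi, hj]
      have := C00 hσ hδ hα
      simpa [Imat] using this
    · rw [hi]
      have e : Imat ![σ, δ, α] 0 j = 0 := by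
        fin_cases j
        · exact absurd rfl hj
        · simp [Imat]
        · simp [Imat]
      rw [e]
      exact C0j hσ hδ hα hj
  · by_cases hj : j = 0
    · rw [hj]
      have e : Imat ![σ, δ, α] i 0 = 0 := by
        fin_cases i
        · exact absurd rfl hi
        · simp [Imat]
        · simp [Imat]
      rw [e]
      refine (C0j hσ hδ hα hi).congr fun n => ?_
      congr 1
      refine integral_congr_ae (ae_of_all _ fun x => ?_)
      ring
    · exact Cij hσ hδ hα hi hj

end

/-- `u_n(θ₀)ᵀ J_n(θ₀) u_n(θ₀)` converges to `-I(θ₀)` in `ℙ_n`-probability. -/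
theorem statement1 (σ₀ δ₀ α₀ : ℝ) (hσ : 0 < σ₀) (hδ : 0 < δ₀) (hα : α₀ ∈ Set.Ioo (0 : ℝ) 2) :
    ∀ ε > (0 : ℝ),
      Tendsto
        (fun n : ℕ => Pn n ![σ₀, δ₀, α₀]
          {x | ε < frobNorm
            ((un n ![σ₀, δ₀, α₀])ᵀ * hessMat n ![σ₀, δ₀, α₀] x * un n ![σ₀, δ₀, α₀]
              + Imat ![σ₀, δ₀, α₀])})
        atTop (𝓝 0) := by
  intro ε hε
  exact final_of hσ hδ hα (all_C hσ hδ hα) hε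

end LevyLAN
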